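/- Let T be any set of prime numbers containing 2 and 3. Then the second integral group homology of SL₂(ℤ_T) satisfies H₂(SL₂(ℤ_T), ℤ) ≅ ℤ ⊕ (⊕_{p ∈ T} (ℤ/pℤ)^×), the direct sum of an infinite cyclic group and the multiplicative groups of the fields ℤ/pℤ for p ∈ T. In particular, if m is a positive integer divisible by 6 then H₂(SL₂(ℤ[1/m]), ℤ) ≅ ℤ ⊕ (⊕_{p | m} (ℤ/pℤ)^×), the sum over the prime divisors p of m. -/

import Mathlib

open Finsupp DirectSum

set_option maxHeartbeats 1000000
set_option synthInstance.maxHeartbeats 400000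

/-- `ℤ_S`: the subring of `ℚ` obtained by localizing `ℤ` at the primes in `S`, i.e. the smallest
subring of `ℚ` containing the inverses of the elements of `S`. -/
def ZS (S : Set ℕ) : Subring ℚ :=
  Subring.closure ((fun p : ℕ => (p : ℚ)⁻¹) '' S)

/-- `ℤ[1/m]`: the subring of `ℚ` obtained from `ℤ` by inverting `m`. -/
def Zinv (m : ℕ) : Subring ℚ :=
  Subring.closure {(m : ℚ)⁻¹}





noncomputable section

/-- Degree-2 differential of the bar complex of `G` with trivial `ℤ` coefficients:
`d₂([g|h]) = [h] - [gh] + [g]`. -/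
def barD2 (G : Type*) [Group G] : ((G × G) →₀ ℤ) →ₗ[ℤ] (G →₀ ℤ) :=
  Finsupp.lsum ℤ fun p => LinearMap.toSpanSingleton ℤ _
    (Finsupp.single p.2 1 - Finsupp.single (p.1 * p.2) 1 + Finsupp.single p.1 1)

/-- Degree-3 differential of the bar complex of `G` with trivial `ℤ` coefficients:
`d₃([g|h|k]) = [h|k] - [gh|k] + [g|hk] - [g|h]`. -/
def barD3 (G : Type*) [Group G] : ((G × G × G) →₀ ℤ) →ₗ[ℤ] ((G × G) →₀ ℤ) :=
  Finsupp.lsum ℤ fun t => LinearMap.toSpanSingleton ℤ _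
    (Finsupp.single (t.2.1, t.2.2) 1 - Finsupp.single (t.1 * t.2.1, t.2.2) 1 +
      Finsupp.single (t.1, t.2.1 * t.2.2) 1 - Finsupp.single (t.1, t.2.1) 1)

/-- The second homology group `H₂(G, ℤ)` of a group `G` with trivial integer coefficients,
computed via the bar complex: 2-cycles modulo 2-boundaries. -/
abbrev H2 (G : Type*) [Group G] :=
  ↥(LinearMap.ker (barD2 G)) ⧸
    (LinearMap.range (barD3 G)).comap (LinearMap.ker (barD2 G)).subtype

variable {G G' : Type*} [Group G] [Group G']

/-- The map on degree-1 bar chains induced by a group homomorphism. -/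
def mapC1 (f : G →* G') : (G →₀ ℤ) →ₗ[ℤ] (G' →₀ ℤ) :=
  Finsupp.lmapDomain ℤ ℤ f

/-- The map on degree-2 bar chains induced by a group homomorphism. -/
def mapC2 (f : G →* G') : ((G × G) →₀ ℤ) →ₗ[ℤ] ((G' × G') →₀ ℤ) :=
  Finsupp.lmapDomain ℤ ℤ (Prod.map f f)

/-- The map on degree-3 bar chains induced by a group homomorphism. -/
def mapC3 (f : G →* G') : ((G × G × G) →₀ ℤ) →ₗ[ℤ] ((G' × G' × G') →₀ ℤ) :=
  Finsupp.lmapDomain ℤ ℤ (fun t => (f t.1, f t.2.1, f t.2.2))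

lemma mapC1_single (f : G →* G') (a : G) (b : ℤ) :
    mapC1 f (Finsupp.single a b) = Finsupp.single (f a) b := by
  simp [mapC1, Finsupp.lmapDomain_apply, Finsupp.mapDomain_single]

lemma mapC2_single (f : G →* G') (a : G × G) (b : ℤ) :
    mapC2 f (Finsupp.single a b) = Finsupp.single (f a.1, f a.2) b := by
  simp [mapC2, Finsupp.lmapDomain_apply, Finsupp.mapDomain_single, Prod.map]

lemma mapC3_single (f : G →* G') (a : G × G × G) (b : ℤ) :
    mapC3 f (Finsupp.single a b) = Finsupp.single (f a.1, f a.2.1, f a.2.2) b := by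
  simp [mapC3, Finsupp.lmapDomain_apply, Finsupp.mapDomain_single]

lemma barD2_comm (f : G →* G') :
    (barD2 G').comp (mapC2 f) = (mapC1 f).comp (barD2 G) := by
  apply Finsupp.lhom_ext
  intro p b
  simp only [LinearMap.comp_apply, mapC2_single, barD2, Finsupp.lsum_single,
    LinearMap.toSpanSingleton_apply, map_smul, map_add, map_sub, mapC1_single, map_mul]

lemma barD3_comm (f : G →* G') :
    (barD3 G').comp (mapC3 f) = (mapC2 f).comp (barD3 G) := by
  apply Finsupp.lhom_ext
  intro t b
  simp only [LinearMap.comp_apply, mapC3_single, barD3, Finsupp.lsum_single,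
    LinearMap.toSpanSingleton_apply, map_smul, map_add, map_sub, mapC2_single, map_mul]

/-- The map `H₂(G, ℤ) → H₂(G′, ℤ)` induced by a group homomorphism `f : G → G′`. -/
def mapH2 (f : G →* G') : H2 G →ₗ[ℤ] H2 G' :=
  Submodule.mapQ _ _
    ((mapC2 f).restrict (p := LinearMap.ker (barD2 G)) (q := LinearMap.ker (barD2 G'))
      (fun x hx => by
        have := LinearMap.congr_fun (barD2_comm f) x
        simp only [LinearMap.comp_apply] at this
        simp only [LinearMap.mem_ker] at hx ⊢
        rw [this, hx, map_zero]))
    (by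
      rintro ⟨x, hx⟩ hmem
      simp only [Submodule.mem_comap, LinearMap.mem_range, Submodule.coe_subtype] at hmem ⊢
      obtain ⟨z, hz⟩ := hmem
      refine ⟨mapC3 f z, ?_⟩
      have := LinearMap.congr_fun (barD3_comm f) z
      simp only [LinearMap.comp_apply] at this
      rw [this, hz]
      rfl)

namespace SL2H

open scoped commutatorElement

/-- Abbreviation for `SL₂(ℚ)`. -/
abbrev S2 := Matrix.SpecialLinearGroup (Fin 2) ℚ

/-- The element of `SL₂(ℚ)` with the given entries. -/
def mk (a b c d : ℚ) (h : a * d - b * c = 1) : S2 :=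
  ⟨!![a, b; c, d], by rw [Matrix.det_fin_two_of]; exact h⟩

section entries
variable (a b c d : ℚ) (h : a * d - b * c = 1)
@[simp] lemma mk_00 : (mk a b c d h) 0 0 = a := rfl
@[simp] lemma mk_01 : (mk a b c d h) 0 1 = b := rfl
@[simp] lemma mk_10 : (mk a b c d h) 1 0 = c := rfl
@[simp] lemma mk_11 : (mk a b c d h) 1 1 = d := rfl
end entries

lemma S2_ext {g h : S2} (h1 : g 0 0 = h 0 0) (h2 : g 0 1 = h 0 1) (h3 : g 1 0 = h 1 0)
    (h4 : g 1 1 = h 1 1) : g = h := by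
  apply Matrix.SpecialLinearGroup.ext
  intro i j
  fin_cases i <;> fin_cases j <;> assumption

@[simp] lemma mul_00 (g h : S2) : (g * h) 0 0 = g 0 0 * h 0 0 + g 0 1 * h 1 0 := by
  simp [Matrix.mul_apply, Fin.sum_univ_two]
@[simp] lemma mul_01 (g h : S2) : (g * h) 0 1 = g 0 0 * h 0 1 + g 0 1 * h 1 1 := by
  simp [Matrix.mul_apply, Fin.sum_univ_two]
@[simp] lemma mul_10 (g h : S2) : (g * h) 1 0 = g 1 0 * h 0 0 + g 1 1 * h 1 0 := by
  simp [Matrix.mul_apply, Fin.sum_univ_two]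
@[simp] lemma mul_11 (g h : S2) : (g * h) 1 1 = g 1 0 * h 0 1 + g 1 1 * h 1 1 := by
  simp [Matrix.mul_apply, Fin.sum_univ_two]
@[simp] lemma one_00 : (1 : S2) 0 0 = 1 := by simp
@[simp] lemma one_01 : (1 : S2) 0 1 = 0 := by simp
@[simp] lemma one_10 : (1 : S2) 1 0 = 0 := by simp
@[simp] lemma one_11 : (1 : S2) 1 1 = 1 := by simp
@[simp] lemma inv_00 (g : S2) : (g⁻¹) 0 0 = g 1 1 := by
  simp [Matrix.SpecialLinearGroup.coe_inv, Matrix.adjugate_fin_two]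
@[simp] lemma inv_01 (g : S2) : (g⁻¹) 0 1 = -g 0 1 := by
  simp [Matrix.SpecialLinearGroup.coe_inv, Matrix.adjugate_fin_two]
@[simp] lemma inv_10 (g : S2) : (g⁻¹) 1 0 = -g 1 0 := by
  simp [Matrix.SpecialLinearGroup.coe_inv, Matrix.adjugate_fin_two]
@[simp] lemma inv_11 (g : S2) : (g⁻¹) 1 1 = g 0 0 := by
  simp [Matrix.SpecialLinearGroup.coe_inv, Matrix.adjugate_fin_two]
@[simp] lemma neg_e (g : S2) (i j : Fin 2) : (-g) i j = -(g i j) := by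
  simp [Matrix.SpecialLinearGroup.coe_neg]

lemma det_eq (g : S2) : g 0 0 * g 1 1 - g 0 1 * g 1 0 = 1 := by
  have := g.2
  rwa [Matrix.det_fin_two] at this

/-- Upper unipotent. -/
def xU (t : ℚ) : S2 := mk 1 t 0 1 (by ring)
/-- Lower unipotent. -/
def xL (t : ℚ) : S2 := mk 1 0 t 1 (by ring)
/-- Diagonal element. -/
def dg (u : ℚˣ) : S2 := mk u 0 0 (u⁻¹ : ℚˣ) (by simp)
/-- Antidiagonal element. -/
def wt (u : ℚˣ) : S2 := mk 0 u (-(u⁻¹ : ℚˣ)) 0 (by simp)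

section
variable (t : ℚ) (u : ℚˣ)
@[simp] lemma xU_00 : (xU t) 0 0 = 1 := rfl
@[simp] lemma xU_01 : (xU t) 0 1 = t := rfl
@[simp] lemma xU_10 : (xU t) 1 0 = 0 := rfl
@[simp] lemma xU_11 : (xU t) 1 1 = 1 := rfl
@[simp] lemma xL_00 : (xL t) 0 0 = 1 := rfl
@[simp] lemma xL_01 : (xL t) 0 1 = 0 := rfl
@[simp] lemma xL_10 : (xL t) 1 0 = t := rfl
@[simp] lemma xL_11 : (xL t) 1 1 = 1 := rfl
@[simp] lemma dg_00 : (dg u) 0 0 = u := rfl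
@[simp] lemma dg_01 : (dg u) 0 1 = 0 := rfl
@[simp] lemma dg_10 : (dg u) 1 0 = 0 := rfl
@[simp] lemma dg_11 : (dg u) 1 1 = (u : ℚ)⁻¹ := by simp [dg]
@[simp] lemma wt_00 : (wt u) 0 0 = 0 := rfl
@[simp] lemma wt_01 : (wt u) 0 1 = u := rfl
@[simp] lemma wt_10 : (wt u) 1 0 = -(u : ℚ)⁻¹ := by simp [wt]
@[simp] lemma wt_11 : (wt u) 1 1 = 0 := rfl
end

lemma xU_add (s t : ℚ) : xU (s + t) = xU s * xU t := by
  apply S2_ext <;> simp [add_comm]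
lemma xL_add (s t : ℚ) : xL (s + t) = xL s * xL t := by
  apply S2_ext <;> simp
@[simp] lemma xU_zero : xU 0 = 1 := by apply S2_ext <;> simp
@[simp] lemma xL_zero : xL 0 = 1 := by apply S2_ext <;> simp
lemma xU_neg (t : ℚ) : xU (-t) = (xU t)⁻¹ := by apply S2_ext <;> simp
lemma xL_neg (t : ℚ) : xL (-t) = (xL t)⁻¹ := by apply S2_ext <;> simp
lemma dg_mul (u v : ℚˣ) : dg (u * v) = dg u * dg v := by apply S2_ext <;> simp [mul_comm]
@[simp] lemma dg_one : dg 1 = 1 := by apply S2_ext <;> simp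
lemma dg_inv (u : ℚˣ) : dg u⁻¹ = (dg u)⁻¹ := by apply S2_ext <;> simp

lemma wt_eq (u : ℚˣ) : wt u = xU u * xL (-(u : ℚ)⁻¹) * xU u := by
  apply S2_ext <;> simp
lemma wt_mul (u v : ℚˣ) : wt u * wt v = dg (-(u / v)) := by
  apply S2_ext <;> simp [div_eq_mul_inv, mul_comm]
lemma dg_conj_xU (u : ℚˣ) (t : ℚ) : dg u * xU t * (dg u)⁻¹ = xU ((u : ℚ) ^ 2 * t) := by
  apply S2_ext <;> simp; ring
lemma dg_conj_xL (u : ℚˣ) (t : ℚ) : dg u * xL t * (dg u)⁻¹ = xL (t / (u : ℚ) ^ 2) := by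
  apply S2_ext <;> simp; field_simp
lemma wt_conj_xU (u : ℚˣ) (t : ℚ) : wt u * xU t * (wt u)⁻¹ = xL (-(t / (u : ℚ) ^ 2)) := by
  apply S2_ext <;> simp; field_simp
lemma wt_conj_xL (u : ℚˣ) (t : ℚ) : wt u * xL t * (wt u)⁻¹ = xU (-((u : ℚ) ^ 2 * t)) := by
  apply S2_ext <;> simp; ring
lemma wt_conj_dg (u v : ℚˣ) : wt u * dg v * (wt u)⁻¹ = dg v⁻¹ := by
  apply S2_ext <;> simp <;> field_simp

/-! ### Localizations of `ℤ` -/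

lemma mem_ZS_den {T : Set ℕ} (hT : ∀ p ∈ T, Nat.Prime p) {x : ℚ} (hx : x ∈ ZS T) :
    ∀ q : ℕ, q.Prime → q ∣ x.den → q ∈ T := by
  induction hx using Subring.closure_induction with
  | mem x hx =>
    obtain ⟨p, hp, rfl⟩ := hx
    intro q hq hd
    have : ((p : ℚ)⁻¹).den = p := by
      rw [Rat.inv_natCast_den]; simp [(hT p hp).ne_zero]
    simp only [this] at hd
    rw [(Nat.prime_dvd_prime_iff_eq hq (hT p hp)).1 hd]; exact hp
  | zero => intro q hq hd; simp at hd; exact absurd hd hq.ne_one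
  | one => intro q hq hd; simp at hd; exact absurd hd hq.ne_one
  | add x y _ _ hx hy =>
    intro q hq hd
    rcases hq.dvd_mul.1 (hd.trans (Rat.add_den_dvd x y)) with h | h
    exacts [hx q hq h, hy q hq h]
  | neg x _ hx => intro q hq hd; exact hx q hq (by simpa using hd)
  | mul x y _ _ hx hy =>
    intro q hq hd
    rcases hq.dvd_mul.1 (hd.trans (Rat.mul_den_dvd x y)) with h | h
    exacts [hx q hq h, hy q hq h]

lemma inv_mem_ZS {T : Set ℕ} (n : ℕ) (h : ∀ q : ℕ, q.Prime → q ∣ n → q ∈ T) :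
    (n : ℚ)⁻¹ ∈ ZS T := by
  induction n using induction_on_primes with
  | zero => simp [(ZS T).zero_mem]
  | one => simp [(ZS T).one_mem]
  | prime_mul p a hp ih =>
    push_cast
    rw [mul_inv]
    refine (ZS T).mul_mem (Subring.subset_closure ⟨p, h p hp (dvd_mul_right _ _), rfl⟩)
      (ih fun q hq hd => h q hq (hd.mul_left _))

lemma mem_ZS {T : Set ℕ} {x : ℚ} (h : ∀ q : ℕ, q.Prime → q ∣ x.den → q ∈ T) : x ∈ ZS T := by
  rw [← Rat.num_div_den x, div_eq_mul_inv]
  exact (ZS T).mul_mem (intCast_mem _ _) (inv_mem_ZS _ h)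

lemma ZS_mono {T T' : Set ℕ} (h : T ⊆ T') : ZS T ≤ ZS T' :=
  Subring.closure_mono (Set.image_mono h)

lemma inv_prime_mem {T : Set ℕ} {p : ℕ} (h : p ∈ T) : (p : ℚ)⁻¹ ∈ ZS T :=
  Subring.subset_closure ⟨p, h, rfl⟩

/-- Every element of `ZS (insert p T)` becomes an element of `ZS T` after multiplication by a
power of `p`. -/
lemma exists_pow_mul_mem {T : Set ℕ} (p : ℕ) (hp : p.Prime) {x : ℚ} (hx : x ∈ ZS (insert p T)) :
    ∃ n : ℕ, (p : ℚ) ^ n * x ∈ ZS T := by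
  have hp0 : (p : ℚ) ≠ 0 := by exact_mod_cast hp.ne_zero
  induction hx using Subring.closure_induction with
  | mem x hx =>
    obtain ⟨q, hq, rfl⟩ := hx
    rcases hq with rfl | hq
    · exact ⟨1, by simp [hp0, (ZS T).one_mem]⟩
    · exact ⟨0, by simpa using inv_prime_mem hq⟩
  | zero => exact ⟨0, by simp [(ZS T).zero_mem]⟩
  | one => exact ⟨0, by simp [(ZS T).one_mem]⟩
  | add x y _ _ hx hy =>
    obtain ⟨n, hn⟩ := hx
    obtain ⟨m, hm⟩ := hy
    refine ⟨n + m, ?_⟩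
    have : (p : ℚ) ^ (n + m) * (x + y) =
        (p : ℚ) ^ m * (p ^ n * x) + (p : ℚ) ^ n * (p ^ m * y) := by ring
    rw [this]
    exact (ZS T).add_mem ((ZS T).mul_mem (pow_mem (natCast_mem _ _) _) hn)
      ((ZS T).mul_mem (pow_mem (natCast_mem _ _) _) hm)
  | neg x _ hx => obtain ⟨n, hn⟩ := hx; exact ⟨n, by simpa using (ZS T).neg_mem hn⟩
  | mul x y _ _ hx hy =>
    obtain ⟨n, hn⟩ := hx
    obtain ⟨m, hm⟩ := hy
    refine ⟨n + m, ?_⟩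
    have : (p : ℚ) ^ (n + m) * (x * y) = (p ^ n * x) * (p ^ m * y) := by ring
    rw [this]
    exact (ZS T).mul_mem hn hm

/-- `SL₂(ZS T)` as a subgroup of `SL₂(ℚ)`. -/
def GT (T : Set ℕ) : Subgroup S2 where
  carrier := {g | g 0 0 ∈ ZS T ∧ g 0 1 ∈ ZS T ∧ g 1 0 ∈ ZS T ∧ g 1 1 ∈ ZS T}
  mul_mem' := by
    rintro g h ⟨a, b, c, d⟩ ⟨a', b', c', d'⟩
    simp only [Set.mem_ofPred_eq, mul_00, mul_01, mul_10, mul_11]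
    exact ⟨add_mem (mul_mem a a') (mul_mem b c'), add_mem (mul_mem a b') (mul_mem b d'),
      add_mem (mul_mem c a') (mul_mem d c'), add_mem (mul_mem c b') (mul_mem d d')⟩
  one_mem' := by simp [zero_mem, one_mem]
  inv_mem' := by
    rintro g ⟨a, b, c, d⟩
    simp only [Set.mem_ofPred_eq, inv_00, inv_01, inv_10, inv_11]
    exact ⟨d, neg_mem b, neg_mem c, a⟩

lemma mem_GT {T : Set ℕ} {g : S2} :
    g ∈ GT T ↔ g 0 0 ∈ ZS T ∧ g 0 1 ∈ ZS T ∧ g 1 0 ∈ ZS T ∧ g 1 1 ∈ ZS T := Iff.rfl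

lemma GT_mono {T T' : Set ℕ} (h : T ⊆ T') : GT T ≤ GT T' := fun _ hg =>
  ⟨ZS_mono h hg.1, ZS_mono h hg.2.1, ZS_mono h hg.2.2.1, ZS_mono h hg.2.2.2⟩

lemma xU_mem {T : Set ℕ} {t : ℚ} (h : t ∈ ZS T) : xU t ∈ GT T := by
  simp [mem_GT, h, zero_mem, one_mem]
lemma xL_mem {T : Set ℕ} {t : ℚ} (h : t ∈ ZS T) : xL t ∈ GT T := by
  simp [mem_GT, h, zero_mem, one_mem]
lemma dg_mem {T : Set ℕ} {u : ℚˣ} (h : (u : ℚ) ∈ ZS T) (h' : (u : ℚ)⁻¹ ∈ ZS T) : dg u ∈ GT T := by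
  simp [mem_GT, h, h', zero_mem]
lemma wt_mem {T : Set ℕ} {u : ℚˣ} (h : (u : ℚ) ∈ ZS T) (h' : (u : ℚ)⁻¹ ∈ ZS T) : wt u ∈ GT T := by
  simp [mem_GT, h, h', zero_mem]
lemma neg_mem_GT {T : Set ℕ} {g : S2} (h : g ∈ GT T) : -g ∈ GT T := by
  rw [mem_GT] at *; simpa using h

section AL
variable (p : ℕ) [hp : Fact p.Prime]

lemma p_ne : (p : ℚ) ≠ 0 := by exact_mod_cast hp.out.ne_zero

/-- The Atkin–Lehner involution. -/
def ALfun (g : S2) : S2 := mk (g 1 1) (-(g 1 0 / p)) (-(p * g 0 1)) (g 0 0) (by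
  have := det_eq g; have := p_ne p; field_simp; linarith)

/-- The Atkin–Lehner involution, conjugation by `(0, -1; p, 0)`. -/
def AL : S2 ≃* S2 where
  toFun := ALfun p
  invFun := ALfun p
  left_inv g := by have := p_ne p; apply S2_ext <;> simp [ALfun] <;> field_simp
  right_inv g := by have := p_ne p; apply S2_ext <;> simp [ALfun] <;> field_simp
  map_mul' g h := by have := p_ne p; apply S2_ext <;> simp [ALfun] <;> field_simp <;> ring

variable (g : S2)
@[simp] lemma AL_00 : (AL p g) 0 0 = g 1 1 := rfl
@[simp] lemma AL_01 : (AL p g) 0 1 = -(g 1 0 / p) := rfl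
@[simp] lemma AL_10 : (AL p g) 1 0 = -(p * g 0 1) := rfl
@[simp] lemma AL_11 : (AL p g) 1 1 = g 0 0 := rfl
@[simp] lemma AL_AL : AL p (AL p g) = g := (AL p).left_inv g

/-- The other vertex group. -/
def GT' (T : Set ℕ) : Subgroup S2 := (GT T).comap (AL p).toMonoidHom

/-- The edge group `Γ₀(p)`. -/
def Gam (T : Set ℕ) : Subgroup S2 := GT T ⊓ GT' p T

variable {p g}
lemma mem_GT' {T : Set ℕ} : g ∈ GT' p T ↔ AL p g ∈ GT T := Iff.rfl

lemma AL_mem_GT' {T : Set ℕ} (h : g ∈ GT T) : AL p g ∈ GT' p T := by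
  rw [mem_GT', AL_AL]; exact h

lemma AL_mem_Gam {T : Set ℕ} (h : g ∈ Gam p T) : AL p g ∈ Gam p T :=
  ⟨h.2, AL_mem_GT' h.1⟩

lemma mem_Gam {T : Set ℕ} : g ∈ Gam p T ↔ g ∈ GT T ∧ g 1 0 / p ∈ ZS T := by
  constructor
  · rintro ⟨h, h'⟩
    refine ⟨h, ?_⟩
    have := h'.2.1
    simpa using neg_mem this
  · rintro ⟨h, h'⟩
    refine ⟨h, ?_⟩
    change AL p g ∈ GT T
    rw [mem_GT]
    simp only [AL_00, AL_01, AL_10, AL_11]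
    exact ⟨h.2.2.2, neg_mem h', neg_mem (mul_mem (natCast_mem _ _) h.2.1), h.1⟩
end AL

/-! ### Amalgamated products inside a group -/

/-- `f` is multiplicative on the subgroup `H`. -/
def HomOn {Y X : Type*} [Group Y] [Group X] (H : Subgroup Y) (f : Y → X) : Prop :=
  ∀ g ∈ H, ∀ h ∈ H, f (g * h) = f g * f h

/-- The homomorphism attached to a function that is multiplicative on `H`. -/
def HomOn.toHom {Y X : Type*} [Group Y] [Group X] {H : Subgroup Y} {f : Y → X} (hf : HomOn H f) :
    H →* X := MonoidHom.mk' (fun g => f g) (fun g h => hf g g.2 h h.2)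

@[simp] lemma HomOn.toHom_apply {Y X : Type*} [Group Y] [Group X] {H : Subgroup Y} {f : Y → X}
    (hf : HomOn H f) (g : H) : hf.toHom g = f g := rfl

lemma HomOn.map_one {Y X : Type*} [Group Y] [Group X] {H : Subgroup Y} {f : Y → X}
    (hf : HomOn H f) : f 1 = 1 := by simpa using hf.toHom.map_one

lemma HomOn.map_inv {Y X : Type*} [Group Y] [Group X] {H : Subgroup Y} {f : Y → X}
    (hf : HomOn H f) {g : Y} (hg : g ∈ H) : f g⁻¹ = (f g)⁻¹ := by
  simpa using hf.toHom.map_inv ⟨g, hg⟩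

lemma HomOn.mono {Y X : Type*} [Group Y] [Group X] {H K : Subgroup Y} {f : Y → X}
    (hf : HomOn H f) (hK : K ≤ H) : HomOn K f := fun g hg h hh => hf g (hK hg) h (hK hh)

open Classical in
/-- Extend a homomorphism on a subgroup by `1` to a function. -/
def extendHom {Y X : Type*} [Group Y] [Group X] {H : Subgroup Y} (f : H →* X) (g : Y) : X :=
  if h : g ∈ H then f ⟨g, h⟩ else 1

lemma extendHom_apply {Y X : Type*} [Group Y] [Group X] {H : Subgroup Y} (f : H →* X) {g : Y}
    (h : g ∈ H) : extendHom f g = f ⟨g, h⟩ := by simp [extendHom, h]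

lemma homOn_extendHom {Y X : Type*} [Group Y] [Group X] {H : Subgroup Y} (f : H →* X) :
    HomOn H (extendHom f) := by
  intro g hg h hh
  rw [extendHom_apply f hg, extendHom_apply f hh, extendHom_apply f (H.mul_mem hg hh), ← map_mul]
  rfl

/-- Homomorphisms which agree on `K₁ ⊓ K₂` extend to `K₁ ⊔ K₂`. -/
def Amalg {Y : Type} [Group Y] (K₁ K₂ : Subgroup Y) : Prop :=
  ∀ (X : Type) [Group X] (f₁ f₂ : Y → X), HomOn K₁ f₁ → HomOn K₂ f₂ →
    (∀ g ∈ K₁, g ∈ K₂ → f₁ g = f₂ g) →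
    ∃ F : Y → X, HomOn (K₁ ⊔ K₂) F ∧ (∀ g ∈ K₁, F g = f₁ g) ∧ (∀ g ∈ K₂, F g = f₂ g)

section pingpong
variable {Y : Type} [Group Y]

/-- The pair of subgroups as a family. -/
abbrev fam (K₁ K₂ : Subgroup Y) (i : Bool) : Subgroup Y := if i then K₁ else K₂

/-- The inclusions of the intersection. -/
def famIncl (K₁ K₂ : Subgroup Y) (i : Bool) : ↥(K₁ ⊓ K₂) →* ↥(fam K₁ K₂ i) :=
  Subgroup.inclusion (by cases i; exacts [inf_le_right, inf_le_left])

lemma famIncl_injective (K₁ K₂ : Subgroup Y) (i : Bool) :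
    Function.Injective (famIncl K₁ K₂ i) := Subgroup.inclusion_injective _

/-- The natural map from the pushout. -/
def pushMap (K₁ K₂ : Subgroup Y) : Monoid.PushoutI (famIncl K₁ K₂) →* Y :=
  Monoid.PushoutI.lift (fun i => (fam K₁ K₂ i).subtype) (K₁ ⊓ K₂).subtype (fun _ => rfl)

lemma pushMap_of (K₁ K₂ : Subgroup Y) (i : Bool) (x : fam K₁ K₂ i) :
    pushMap K₁ K₂ (Monoid.PushoutI.of i x) = x :=
  Monoid.PushoutI.lift_of (φ := famIncl K₁ K₂) (fun i => (fam K₁ K₂ i).subtype) _ _ x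

lemma pushMap_base (K₁ K₂ : Subgroup Y) (x : ↥(K₁ ⊓ K₂)) :
    pushMap K₁ K₂ (Monoid.PushoutI.base (famIncl K₁ K₂) x) = x :=
  Monoid.PushoutI.lift_base (φ := famIncl K₁ K₂) (fun i => (fam K₁ K₂ i).subtype) _ _ x

lemma pushMap_injective (K₁ K₂ : Subgroup Y)
    (hred : ∀ l : List (Σ i, fam K₁ K₂ i), l.IsChain (fun a b => a.1 ≠ b.1) →
      (∀ x ∈ l, (x.2 : Y) ∉ K₁ ⊓ K₂) → l ≠ [] → (l.map fun x => (x.2 : Y)).prod ∉ K₁ ⊓ K₂) :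
    Function.Injective (pushMap K₁ K₂) := by
  rw [injective_iff_map_eq_one]
  intro a ha
  classical
  obtain ⟨d⟩ := Monoid.PushoutI.NormalWord.transversal_nonempty (famIncl K₁ K₂)
    (famIncl_injective K₁ K₂)
  obtain ⟨w, rfl⟩ := (Monoid.PushoutI.NormalWord.equiv (d := d)).symm.surjective a
  change pushMap K₁ K₂ w.prod = 1 at ha
  change w.prod = 1
  have key : ∀ l : List (Σ i, fam K₁ K₂ i), pushMap K₁ K₂ (Monoid.PushoutI.ofCoprodI
      (l.map fun x => Monoid.CoprodI.of x.2).prod) = (l.map fun x => (x.2 : Y)).prod := by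
    intro l
    induction l with
    | nil => simp
    | cons x l ih =>
      simp only [List.map_cons, List.prod_cons, map_mul, ih]
      rw [Monoid.PushoutI.ofCoprodI_of, pushMap_of]
  by_cases hl : w.toList = []
  · have hp : w.toWord.prod = 1 := by simp [Monoid.CoprodI.Word.prod, hl]
    rw [Monoid.PushoutI.NormalWord.prod, hp, map_one, mul_one] at ha ⊢
    have : w.head = 1 := by
      rw [pushMap_base] at ha
      exact Subtype.ext ha
    rw [this, map_one]
  · exfalso
    refine hred w.toList w.chain_ne ?_ hl ?_
    · rintro ⟨i, x⟩ hx hmem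
      refine w.ne_one _ hx ?_
      have h1 := (d.compl i).1
      have := @h1 (⟨x, ⟨⟨x, hmem⟩, rfl⟩⟩, ⟨1, d.one_mem i⟩)
        (⟨1, one_mem _⟩, ⟨x, w.normalized i x hx⟩) (by simp)
      simp only [Prod.mk.injEq, Subtype.mk.injEq] at this
      exact this.2.symm
    · rw [Monoid.PushoutI.NormalWord.prod, map_mul, Monoid.CoprodI.Word.prod, key] at ha
      have h2 : pushMap K₁ K₂ (Monoid.PushoutI.base (famIncl K₁ K₂) w.head) = w.head :=
        pushMap_base _ _ _
      rw [h2] at ha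
      rw [← inv_eq_of_mul_eq_one_right ha]
      exact inv_mem w.head.2

lemma amalg_of_injective (K₁ K₂ : Subgroup Y) (hinj : Function.Injective (pushMap K₁ K₂)) :
    Amalg K₁ K₂ := by
  intro X _ f₁ f₂ h₁ h₂ hag
  have hhom : ∀ i, HomOn (fam K₁ K₂ i) (if i then f₁ else f₂) := by
    rintro (_ | _)
    exacts [h₂, h₁]
  let L : Monoid.PushoutI (famIncl K₁ K₂) →* X :=
    Monoid.PushoutI.lift (fun i => (hhom i).toHom) (h₁.mono inf_le_left).toHom (by
      rintro (_ | _)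
      · ext x; exact (hag _ x.2.1 x.2.2).symm
      · rfl)
  have hr1 : ∀ g (h : g ∈ K₁), pushMap K₁ K₂ (Monoid.PushoutI.of (φ := famIncl K₁ K₂) true ⟨g, h⟩)
      = g := fun g h => pushMap_of K₁ K₂ _ _
  have hr2 : ∀ g (h : g ∈ K₂), pushMap K₁ K₂ (Monoid.PushoutI.of (φ := famIncl K₁ K₂) false ⟨g, h⟩)
      = g := fun g h => pushMap_of K₁ K₂ _ _
  have hle : K₁ ⊔ K₂ ≤ (pushMap K₁ K₂).range :=
    sup_le (fun g h => ⟨_, hr1 g h⟩) (fun g h => ⟨_, hr2 g h⟩)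
  have hinv : ∀ a, Function.invFun (pushMap K₁ K₂) (pushMap K₁ K₂ a) = a :=
    Function.leftInverse_invFun hinj
  refine ⟨fun g => L (Function.invFun (pushMap K₁ K₂) g), ?_, ?_, ?_⟩
  · intro g hg h hh
    obtain ⟨a, rfl⟩ := hle hg
    obtain ⟨b, rfl⟩ := hle hh
    beta_reduce
    rw [← map_mul, hinv, hinv, hinv, map_mul]
  · intro g hg
    have := hinv (Monoid.PushoutI.of (φ := famIncl K₁ K₂) true ⟨g, hg⟩)
    rw [hr1 g hg] at this
    beta_reduce
    rw [this]
    exact Monoid.PushoutI.lift_of (φ := famIncl K₁ K₂) _ _ _ _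
  · intro g hg
    have := hinv (Monoid.PushoutI.of (φ := famIncl K₁ K₂) false ⟨g, hg⟩)
    rw [hr2 g hg] at this
    beta_reduce
    rw [this]
    exact Monoid.PushoutI.lift_of (φ := famIncl K₁ K₂) _ _ _ _

/-- The ping-pong criterion. -/
lemma amalg_of_pingpong {V : Type*} (K₁ K₂ : Subgroup Y) (act : Y → V → V)
    (act_mul : ∀ g h v, act (g * h) v = act g (act h v)) (A B : Set V) (μ : V → ℚ)
    (hAB : ∀ v ∈ A, v ∉ B) (a₀ b₀ : V) (ha₀ : a₀ ∈ A) (hb₀ : b₀ ∈ B)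
    (h₁ : ∀ k ∈ K₁, k ∉ K₂ → ∀ v ∈ B, act k v ∈ A ∧ μ v ≤ μ (act k v))
    (h₂ : ∀ k ∈ K₂, k ∉ K₁ → ∀ v ∈ A, act k v ∈ B ∧ μ v < μ (act k v))
    (hμ : ∀ k ∈ K₁, k ∈ K₂ → ∀ v, v ∈ A ∪ B → μ (act k v) = μ v)
    (hB : ∀ k ∈ K₁, k ∈ K₂ → ∀ v ∈ B, act k v ∈ B) : Amalg K₁ K₂ := by
  apply amalg_of_injective
  apply pushMap_injective
  have key : ∀ l : List (Σ i, fam K₁ K₂ i), l.IsChain (fun a b => a.1 ≠ b.1) →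
      (∀ x ∈ l, (x.2 : Y) ∉ K₁ ⊓ K₂) → ∀ x ∈ l.head?, ∃ v₀ ∈ A ∪ B,
        (act (l.map fun x => (x.2 : Y)).prod v₀ ∈ if x.1 then A else B) ∧
        μ v₀ ≤ μ (act (l.map fun x => (x.2 : Y)).prod v₀) ∧
        ((v₀ ∈ B ∧ x.1 = true) ∨
          μ v₀ < μ (act (l.map fun x => (x.2 : Y)).prod v₀)) := by
    intro l
    induction l with
    | nil => simp
    | cons x l ih =>
      intro hc hl y hy
      obtain rfl : x = y := by simpa using hy
      rcases l with _ | ⟨z, l⟩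
      · obtain ⟨i, x, hx⟩ := x
        have hx' := hl _ List.mem_cons_self
        cases i with
        | true =>
          have := h₁ x hx (fun h => hx' ⟨hx, h⟩) b₀ hb₀
          exact ⟨b₀, Or.inr hb₀, by simpa using this.1, by simpa using this.2, Or.inl ⟨hb₀, rfl⟩⟩
        | false =>
          have := h₂ x hx (fun h => hx' ⟨h, hx⟩) a₀ ha₀
          exact ⟨a₀, Or.inl ha₀, by simpa using this.1, by simpa using this.2.le,
            Or.inr (by simpa using this.2)⟩
      · rw [List.isChain_cons_cons] at hc
        obtain ⟨v₀, hv, h3, h4, h5⟩ := ih hc.2 (fun y hy => hl y (List.mem_cons_of_mem _ hy)) z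
          (by simp)
        refine ⟨v₀, hv, ?_⟩
        rw [List.map_cons, List.prod_cons, act_mul]
        set w := act (List.map (fun x => (x.2 : Y)) (z :: l)).prod v₀ with hw
        have hx' := hl _ List.mem_cons_self
        obtain ⟨i, x, hx⟩ := x
        obtain ⟨j, z, hz⟩ := z
        cases i with
        | true =>
          obtain rfl : j = false := by simpa using hc.1
          have := h₁ x hx (fun h => hx' ⟨hx, h⟩) w (by simpa using h3)
          refine ⟨by simpa using this.1, h4.trans this.2, Or.inr ?_⟩
          rcases h5 with h5 | h5
          · simp at h5
          · exact h5.trans_le this.2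
        | false =>
          obtain rfl : j = true := by simpa using hc.1
          have := h₂ x hx (fun h => hx' ⟨h, hx⟩) w (by simpa using h3)
          exact ⟨by simpa using this.1, (h4.trans_lt this.2).le, Or.inr (h4.trans_lt this.2)⟩
  intro l hc hl hne hmem
  obtain ⟨x, hx⟩ : ∃ x, x ∈ l.head? := by
    cases l with
    | nil => exact absurd rfl hne
    | cons x l => exact ⟨x, rfl⟩
  obtain ⟨v₀, hv, h3, h4, h5⟩ := key l hc hl x hx
  rw [hμ _ hmem.1 hmem.2 v₀ hv] at h5
  rcases h5 with ⟨h5, h6⟩ | h5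
  · rw [h6] at h3
    exact hAB _ h3 (hB _ hmem.1 hmem.2 _ h5)
  · exact lt_irrefl _ h5
end pingpong

/-! ### Generation by elementary matrices -/

lemma exists_num_sub_lt {T : Set ℕ} (hT : ∀ p ∈ T, Nat.Prime p) {a c : ℚ} (ha : a ∈ ZS T)
    (hc0 : c ≠ 0) : ∃ t ∈ ZS T, (a - t * c).num.natAbs < c.num.natAbs := by
  have hcn : c.num ≠ 0 := by simpa using hc0
  refine ⟨c.den * (a.num / c.num : ℤ) * (a.den : ℚ)⁻¹, ?_, ?_⟩
  · exact mul_mem (mul_mem (natCast_mem _ _) (intCast_mem _ _))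
      (inv_mem_ZS _ (mem_ZS_den hT ha))
  · have h1 : a - c.den * (a.num / c.num : ℤ) * (a.den : ℚ)⁻¹ * c =
        ((a.num % c.num : ℤ) : ℚ) / (a.den : ℤ) := by
      have e1 := Rat.num_div_den a
      have h3 : (a.num % c.num : ℤ) = a.num - c.num * (a.num / c.num) := by
        rw [Int.emod_def]
      have e3 : (c.den : ℚ) * c = c.num := by rw [mul_comm, Rat.mul_den_eq_num]
      have e4 : a = a.num * (a.den : ℚ)⁻¹ := by rw [← div_eq_mul_inv, e1]
      rw [h3]
      push_cast
      rw [div_eq_mul_inv, ← e3]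
      nth_rewrite 1 [e4]
      ring
    rw [h1]
    have h2 := Rat.num_dvd (a.num % c.num) (b := a.den) (by simp)
    rw [Rat.divInt_eq_div] at h2
    by_cases h0 : a.num % c.num = 0
    · rw [h0]; simpa using hcn
    · have h4 : (((a.num % c.num : ℤ) : ℚ) / (a.den : ℤ)).num.natAbs ≤ (a.num % c.num).natAbs :=
        Nat.le_of_dvd (by simpa [Int.natAbs_pos] using h0) (Int.natAbs_dvd_natAbs.2 h2)
      refine h4.trans_lt ?_
      have := Int.emod_lt_abs a.num hcn
      have h5 := Int.emod_nonneg a.num hcn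
      rw [Int.abs_eq_natAbs] at this
      omega

lemma wt_mem_of_gen {T : Set ℕ} {H : Subgroup S2} (hU : ∀ a ∈ ZS T, xU a ∈ H)
    (hL : ∀ a ∈ ZS T, xL a ∈ H) {u : ℚˣ} (h : (u : ℚ) ∈ ZS T) (h' : (u : ℚ)⁻¹ ∈ ZS T) :
    wt u ∈ H := by
  rw [wt_eq]
  exact mul_mem (mul_mem (hU _ h) (hL _ (neg_mem h'))) (hU _ h)

lemma dg_mem_of_gen {T : Set ℕ} {H : Subgroup S2} (hU : ∀ a ∈ ZS T, xU a ∈ H)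
    (hL : ∀ a ∈ ZS T, xL a ∈ H) {u : ℚˣ} (h : (u : ℚ) ∈ ZS T) (h' : (u : ℚ)⁻¹ ∈ ZS T) :
    dg u ∈ H := by
  have : dg u = wt (-u) * wt 1 := by rw [wt_mul]; simp
  rw [this]
  exact mul_mem (wt_mem_of_gen hU hL (by simpa using h) (by simpa [inv_neg] using h'))
    (wt_mem_of_gen hU hL (by simp [one_mem]) (by simp [one_mem]))

/-- `SL₂(ZS T)` is generated by elementary matrices. -/
lemma GT_le_of_gen {T : Set ℕ} (hT : ∀ p ∈ T, Nat.Prime p) {H : Subgroup S2}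
    (hU : ∀ a ∈ ZS T, xU a ∈ H) (hL : ∀ a ∈ ZS T, xL a ∈ H) : GT T ≤ H := by
  have key : ∀ n : ℕ, ∀ g ∈ GT T, (g 1 0).num.natAbs = n → g ∈ H := by
    intro n
    induction n using Nat.strong_induction_on with
    | _ n ih =>
      intro g hg hn
      by_cases hc : g 1 0 = 0
      · have hd := det_eq g
        rw [hc, mul_zero, sub_zero] at hd
        have ha : g 0 0 ≠ 0 := fun h => by simp [h] at hd
        have h11 : g 1 1 = (g 0 0)⁻¹ := eq_inv_of_mul_eq_one_right hd
        have : g = dg (Units.mk0 _ ha) * xU (g 1 1 * g 0 1) := by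
          apply S2_ext <;> simp [hc, h11] <;> field_simp
        rw [this]
        refine mul_mem (dg_mem_of_gen hU hL hg.1 ?_) (hU _ (mul_mem hg.2.2.2 hg.2.1))
        rw [Units.val_mk0, ← h11]; exact hg.2.2.2
      · obtain ⟨t, ht, hlt⟩ := exists_num_sub_lt hT hg.1 hc
        have hw : wt 1 ∈ GT T := wt_mem (by simp [one_mem]) (by simp [one_mem])
        have h1 : wt 1 * (xU (-t) * g) ∈ H := by
          refine ih _ ?_ _ (mul_mem hw (mul_mem (xU_mem (neg_mem ht)) hg)) rfl
          rw [← hn]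
          have e : (wt 1 * (xU (-t) * g)) 1 0 = -(g 0 0 - t * g 1 0) := by simp; ring
          rw [e, Rat.num_neg_eq_neg_num, Int.natAbs_neg]
          exact hlt
        have hw' : wt 1 ∈ H := wt_mem_of_gen hU hL (by simp [one_mem]) (by simp [one_mem])
        have h2 := H.mul_mem (H.mul_mem (hU t ht) (H.inv_mem hw')) h1
        have : xU t * (wt 1)⁻¹ * (wt 1 * (xU (-t) * g)) = g := by
          rw [xU_neg]; group
        rwa [this] at h2
  exact fun g hg => key _ g hg rfl

/-! ### The `p`-adic amalgam decomposition -/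

section padic
variable (p : ℕ) [hp : Fact p.Prime] {T : Set ℕ}

lemma norm_le_one_of_mem (hT : ∀ p ∈ T, Nat.Prime p) (hpT : p ∉ T) {x : ℚ} (hx : x ∈ ZS T) :
    padicNorm p x ≤ 1 := by
  induction hx using Subring.closure_induction with
  | mem x hx =>
    obtain ⟨q, hq, rfl⟩ := hx
    have h1 : padicNorm p q = 1 := by
      refine (padicNorm.nat_eq_one_iff _).2 ?_
      intro hd
      rw [(Nat.prime_dvd_prime_iff_eq hp.out (hT q hq)).1 hd] at hpT
      exact hpT hq
    have h2 : padicNorm p ((q : ℚ)⁻¹ * q) = 1 := by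
      rw [inv_mul_cancel₀ (by exact_mod_cast (hT q hq).ne_zero)]; simp
    rw [padicNorm.mul, h1, mul_one] at h2
    exact h2.le
  | zero => simp
  | one => simp
  | add x y _ _ hx hy => exact padicNorm.nonarchimedean.trans (max_le hx hy)
  | neg x _ hx => simpa using hx
  | mul x y _ _ hx hy =>
    rw [padicNorm.mul]
    exact mul_le_one₀ hx (padicNorm.nonneg _) hy

lemma norm_p_lt : padicNorm p (p : ℚ) < 1 := padicNorm.padicNorm_p_lt_one_of_prime

lemma norm_p_pos : 0 < padicNorm p (p : ℚ) :=
  lt_of_le_of_ne (padicNorm.nonneg _) (Ne.symm (padicNorm.nonzero (p_ne p)))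

variable {p}
lemma div_mem_of_norm_lt {x : ℚ} (hx : x ∈ ZS T) (hT : ∀ p ∈ T, Nat.Prime p)
    (hn : padicNorm p x < 1) : x / p ∈ ZS T := by
  have h1 : (p : ℤ) ∣ x.num := by
    by_contra hd
    have h2 : padicNorm p x.num = 1 := (padicNorm.int_eq_one_iff _).2 hd
    have h3 : (x.num : ℚ) = x * x.den := by
      rw [Rat.mul_den_eq_num]
    rw [h3, padicNorm.mul] at h2
    have h4 : padicNorm p x.den ≤ 1 := padicNorm.of_nat _
    nlinarith [padicNorm.nonneg (p := p) x, padicNorm.nonneg (p := p) (x.den : ℚ)]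
  obtain ⟨k, hk⟩ := h1
  have : x / p = k * (x.den : ℚ)⁻¹ := by
    conv_lhs => rw [← Rat.num_div_den x, hk]
    have := p_ne p
    push_cast
    field_simp
  rw [this]
  exact mul_mem (intCast_mem _ _) (inv_mem_ZS _ (mem_ZS_den hT hx))

lemma norm_add_of_lt {x y : ℚ} (h : padicNorm p x < padicNorm p y) :
    padicNorm p (x + y) = padicNorm p y := by
  rw [padicNorm.add_eq_max_of_ne h.ne, max_eq_right h.le]

lemma norm_add_of_lt' {x y : ℚ} (h : padicNorm p y < padicNorm p x) :
    padicNorm p (x + y) = padicNorm p x := by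
  rw [padicNorm.add_eq_max_of_ne h.ne', max_eq_left h.le]

lemma norm_Gam (hT : ∀ p ∈ T, Nat.Prime p) (hpT : p ∉ T) {g : S2} (hg : g ∈ Gam p T) :
    padicNorm p (g 0 0) = 1 ∧ padicNorm p (g 1 1) = 1 ∧ padicNorm p (g 0 1) ≤ 1 ∧
      padicNorm p (g 1 0) < 1 := by
  obtain ⟨hg, hc⟩ := mem_Gam.1 hg
  have ha := norm_le_one_of_mem p hT hpT hg.1
  have hb := norm_le_one_of_mem p hT hpT hg.2.1
  have hd := norm_le_one_of_mem p hT hpT hg.2.2.2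
  have hc' := norm_le_one_of_mem p hT hpT hc
  have hc2 : padicNorm p (g 1 0) < 1 := by
    have : g 1 0 = g 1 0 / p * p := by have := p_ne p; field_simp
    rw [this, padicNorm.mul]
    have := norm_p_lt p
    have := norm_p_pos p
    nlinarith
  have h1 : padicNorm p (g 0 0 * g 1 1) = 1 := by
    have e : g 0 0 * g 1 1 = g 0 1 * g 1 0 + 1 := by linarith [det_eq g]
    have : padicNorm p (g 0 1 * g 1 0) < padicNorm p 1 := by
      rw [padicNorm.mul, padicNorm.one]
      nlinarith [padicNorm.nonneg (p := p) (g 1 0), padicNorm.nonneg (p := p) (g 0 1)]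
    rw [e, norm_add_of_lt this, padicNorm.one]
  rw [padicNorm.mul] at h1
  have n1 := padicNorm.nonneg (p := p) (g 0 0)
  have n2 := padicNorm.nonneg (p := p) (g 1 1)
  refine ⟨?_, ?_, hb, hc2⟩ <;> nlinarith

/-- Linear action on column vectors. -/
def actv (g : S2) (v : ℚ × ℚ) : ℚ × ℚ := (g 0 0 * v.1 + g 0 1 * v.2, g 1 0 * v.1 + g 1 1 * v.2)

lemma actv_mul (g h : S2) (v : ℚ × ℚ) : actv (g * h) v = actv g (actv h v) := by
  simp only [actv, mul_00, mul_01, mul_10, mul_11, Prod.mk.injEq]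
  constructor <;> ring

theorem amalg_GT (hT : ∀ p ∈ T, Nat.Prime p) (hpT : p ∉ T) : Amalg (GT T) (GT' p T) := by
  have nn := fun x => padicNorm.nonneg (p := p) x
  refine amalg_of_pingpong (GT T) (GT' p T) actv actv_mul
    {v | padicNorm p v.1 ≤ padicNorm p v.2 ∧ 0 < padicNorm p v.2}
    {v | padicNorm p v.2 < padicNorm p v.1} (fun v => max (padicNorm p v.1) (padicNorm p v.2))
    ?_ (0, 1) (1, 0) (by simp) (by simp) ?_ ?_ ?_ ?_
  · rintro v ⟨h, -⟩
    exact not_lt.2 h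
  · rintro k hk hk' ⟨x, y⟩ (hv : padicNorm p y < padicNorm p x)
    have hc1 : padicNorm p (k 1 0) = 1 := by
      refine le_antisymm (norm_le_one_of_mem p hT hpT hk.2.2.1) (not_lt.1 fun h => hk' ?_)
      exact (mem_Gam.2 ⟨hk, div_mem_of_norm_lt hk.2.2.1 hT h⟩).2
    have ha := norm_le_one_of_mem p hT hpT hk.1
    have hb := norm_le_one_of_mem p hT hpT hk.2.1
    have hd := norm_le_one_of_mem p hT hpT hk.2.2.2
    have hy : padicNorm p (k 1 0 * x + k 1 1 * y) = padicNorm p x := by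
      rw [norm_add_of_lt', padicNorm.mul, hc1, one_mul]
      rw [padicNorm.mul, padicNorm.mul, hc1, one_mul]
      nlinarith [nn (k 1 1), nn y]
    have hx : padicNorm p (k 0 0 * x + k 0 1 * y) ≤ padicNorm p x := by
      refine padicNorm.nonarchimedean.trans (max_le ?_ ?_)
      · rw [padicNorm.mul]; nlinarith [nn x]
      · rw [padicNorm.mul]; nlinarith [nn y, nn (k 0 1)]
    refine ⟨⟨?_, ?_⟩, ?_⟩
    · simp only [actv]; rw [hy]; exact hx
    · simp only [actv]; rw [hy]; exact (nn y).trans_lt hv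
    · simp only [actv]; rw [hy, max_eq_left hv.le]; exact le_max_right _ _
  · rintro k hk hk' ⟨x, y⟩ ⟨hv, hy0⟩
    simp only at hv hy0
    have hk2 := hk
    rw [mem_GT', mem_GT] at hk2
    simp only [AL_00, AL_01, AL_10, AL_11] at hk2
    obtain ⟨kd, kc, kb, ka⟩ := hk2
    have pp := norm_p_pos p
    have pl := norm_p_lt p
    have hb : 1 < padicNorm p (k 0 1) := by
      by_contra hb
      refine hk' ?_
      have : AL p k ∈ Gam p T := by
        refine mem_Gam.2 ⟨hk, div_mem_of_norm_lt hk.2.2.1 hT ?_⟩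
        rw [AL_10, padicNorm.neg, padicNorm.mul]
        nlinarith [nn (k 0 1)]
      have h3 := AL_mem_Gam this
      rw [AL_AL] at h3
      exact h3.1
    have ha := norm_le_one_of_mem p hT hpT ka
    have hd := norm_le_one_of_mem p hT hpT kd
    have hc : padicNorm p (k 1 0) ≤ 1 := by
      have h1 := norm_le_one_of_mem p hT hpT kc
      have : k 1 0 = k 1 0 / p * p := by have := p_ne p; field_simp
      rw [this, padicNorm.mul]
      rw [padicNorm.neg] at h1
      nlinarith [nn (k 1 0 / p)]
    have hx : padicNorm p (k 0 0 * x + k 0 1 * y) = padicNorm p (k 0 1) * padicNorm p y := by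
      rw [norm_add_of_lt, padicNorm.mul]
      rw [padicNorm.mul, padicNorm.mul]
      nlinarith [nn x]
    have hy : padicNorm p (k 1 0 * x + k 1 1 * y) ≤ padicNorm p y := by
      refine padicNorm.nonarchimedean.trans (max_le ?_ ?_)
      · rw [padicNorm.mul]; nlinarith [nn x, nn (k 1 0)]
      · rw [padicNorm.mul]; nlinarith [nn y]
    have hlt : padicNorm p y < padicNorm p (k 0 1) * padicNorm p y := by nlinarith
    refine ⟨?_, ?_⟩
    · change padicNorm p (k 1 0 * x + k 1 1 * y) < padicNorm p (k 0 0 * x + k 0 1 * y)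
      rw [hx]; exact hy.trans_lt hlt
    · simp only [actv]
      rw [max_eq_right hv, hx]
      exact hlt.trans_le (le_max_left _ _)
  · rintro k hk hk' ⟨x, y⟩ hv
    obtain ⟨ha, hd, hb, hc⟩ := norm_Gam hT hpT ⟨hk, hk'⟩
    simp only [actv]
    rcases hv with ⟨h1, h2⟩ | h1
    · simp only at h1 h2
      have hy : padicNorm p (k 1 0 * x + k 1 1 * y) = padicNorm p y := by
        rw [norm_add_of_lt, padicNorm.mul, hd, one_mul]
        rw [padicNorm.mul, padicNorm.mul, hd, one_mul]
        nlinarith [nn x, nn (k 1 0)]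
      rw [hy, max_eq_right h1, max_eq_right]
      refine padicNorm.nonarchimedean.trans (max_le ?_ ?_)
      · rw [padicNorm.mul, ha, one_mul]; exact h1
      · rw [padicNorm.mul]; nlinarith
    · change padicNorm p y < padicNorm p x at h1
      have hx : padicNorm p (k 0 0 * x + k 0 1 * y) = padicNorm p x := by
        rw [norm_add_of_lt', padicNorm.mul, ha, one_mul]
        rw [padicNorm.mul, padicNorm.mul, ha, one_mul]
        nlinarith [nn y, nn (k 0 1)]
      rw [hx, max_eq_left h1.le, max_eq_left]
      refine padicNorm.nonarchimedean.trans (max_le ?_ ?_)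
      · rw [padicNorm.mul]; nlinarith [nn x]
      · rw [padicNorm.mul, hd, one_mul]; exact h1.le
  · rintro k hk hk' ⟨x, y⟩ (hv : padicNorm p y < padicNorm p x)
    obtain ⟨ha, hd, hb, hc⟩ := norm_Gam hT hpT ⟨hk, hk'⟩
    change padicNorm p (k 1 0 * x + k 1 1 * y) < padicNorm p (k 0 0 * x + k 0 1 * y)
    have hx : padicNorm p (k 0 0 * x + k 0 1 * y) = padicNorm p x := by
      rw [norm_add_of_lt', padicNorm.mul, ha, one_mul]
      rw [padicNorm.mul, padicNorm.mul, ha, one_mul]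
      nlinarith [nn y, nn (k 0 1)]
    rw [hx]
    refine padicNorm.nonarchimedean.trans_lt (max_lt ?_ ?_)
    · rw [padicNorm.mul]; nlinarith [nn y]
    · rw [padicNorm.mul, hd, one_mul]; exact hv

lemma dg_pow (u : ℚˣ) (n : ℕ) : dg (u ^ n) = dg u ^ n := by
  induction n with
  | zero => simp
  | succ n ih => rw [pow_succ, dg_mul, pow_succ, ih]

/-- The unit `p` of `ℚ`. -/
def pu (p : ℕ) [hp : Fact p.Prime] : ℚˣ := Units.mk0 (p : ℚ) (p_ne p)

@[simp] lemma pu_val : ((pu p : ℚˣ) : ℚ) = p := rfl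

lemma wt_inv_mem_GT' : wt (pu p)⁻¹ ∈ GT' p T := by
  have := p_ne p
  have e : AL p (wt (pu p)⁻¹) = wt 1 := by
    apply S2_ext <;> simp [this]
  rw [mem_GT', e]
  exact wt_mem (by simp [one_mem]) (by simp [one_mem])

theorem GT_insert (hT : ∀ p ∈ T, Nat.Prime p) : GT T ⊔ GT' p T = GT (insert p T) := by
  have hp0 := p_ne p
  have hpm : (p : ℚ) ∈ ZS (insert p T) := natCast_mem _ _
  have hpi : (p : ℚ)⁻¹ ∈ ZS (insert p T) := inv_prime_mem (Set.mem_insert _ _)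
  have hle := ZS_mono (Set.subset_insert p T)
  apply le_antisymm
  · refine sup_le (GT_mono (Set.subset_insert _ _)) fun g hg => ?_
    rw [mem_GT', mem_GT] at hg
    simp only [AL_00, AL_01, AL_10, AL_11] at hg
    obtain ⟨kd, kc, kb, ka⟩ := hg
    refine ⟨hle ka, ?_, ?_, hle kd⟩
    · have : g 0 1 = -((p : ℚ)⁻¹ * -(p * g 0 1)) := by field_simp
      rw [this]
      exact neg_mem (mul_mem hpi (hle kb))
    · have : g 1 0 = -(p * -(g 1 0 / p)) := by field_simp
      rw [this]
      exact neg_mem (mul_mem hpm (hle kc))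
  · have hw1 : wt 1 ∈ GT T ⊔ GT' p T :=
      Subgroup.mem_sup_left (wt_mem (by simp [one_mem]) (by simp [one_mem]))
    have hdp : dg (pu p) ∈ GT T ⊔ GT' p T := by
      have : dg (pu p) = wt 1 * wt 1 * (wt 1 * wt (pu p)⁻¹) := by
        apply S2_ext <;> simp
      rw [this]
      exact mul_mem (mul_mem hw1 hw1) (mul_mem hw1 (Subgroup.mem_sup_right wt_inv_mem_GT'))
    have hU : ∀ a ∈ ZS (insert p T), xU a ∈ GT T ⊔ GT' p T := by
      intro a ha
      obtain ⟨n, hn⟩ := exists_pow_mul_mem p hp.out ha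
      have h1 : xU ((p : ℚ) ^ (2 * n) * a) ∈ GT T := by
        apply xU_mem
        rw [two_mul, pow_add, mul_assoc]
        exact mul_mem (pow_mem (natCast_mem _ _) _) hn
      have h2 : xU a = (dg (pu p ^ n))⁻¹ * xU ((p : ℚ) ^ (2 * n) * a) * dg (pu p ^ n) := by
        rw [pow_mul']
        have := dg_conj_xU (pu p ^ n) a
        simp only [Units.val_pow_eq_pow_val, pu_val] at this
        rw [← this]; group
      have h3 : dg (pu p ^ n) = dg (pu p) ^ n := dg_pow _ _
      rw [h2, h3]
      exact mul_mem (mul_mem (inv_mem (pow_mem hdp _)) (Subgroup.mem_sup_left h1)) (pow_mem hdp _)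
    refine GT_le_of_gen ?_ hU fun a ha => ?_
    · rintro q (rfl | hq)
      exacts [hp.out, hT q hq]
    · have : xL a = wt 1 * xU (-a) * (wt 1)⁻¹ := by rw [wt_conj_xU]; simp
      rw [this]
      exact mul_mem (mul_mem hw1 (hU _ (neg_mem ha))) (inv_mem hw1)

end padic

/-! ### Cocycles and central extensions -/

/-- `x` satisfies the 2-cocycle identity on `H`. -/
def IsCoc {Y Q : Type*} [Group Y] [AddCommGroup Q] (H : Subgroup Y) (x : Y → Y → Q) : Prop :=
  ∀ g ∈ H, ∀ h ∈ H, ∀ k ∈ H, x g h + x (g * h) k = x h k + x g (h * k)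

/-- `x` is a coboundary on `H`, witnessed by `t`. -/
def CobOn {Y Q : Type*} [Group Y] [AddCommGroup Q] (H : Subgroup Y) (x : Y → Y → Q) (t : Y → Q) :
    Prop := ∀ g ∈ H, ∀ h ∈ H, x g h = t g + t h - t (g * h)

lemma IsCoc.mono {Y Q : Type*} [Group Y] [AddCommGroup Q] {H K : Subgroup Y} {x : Y → Y → Q}
    (h : IsCoc H x) (hK : K ≤ H) : IsCoc K x :=
  fun g hg k hk l hl => h g (hK hg) k (hK hk) l (hK hl)

lemma CobOn.mono {Y Q : Type*} [Group Y] [AddCommGroup Q] {H K : Subgroup Y} {x : Y → Y → Q}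
    {t : Y → Q} (h : CobOn H x t) (hK : K ≤ H) : CobOn K x t :=
  fun g hg k hk => h g (hK hg) k (hK hk)

/-- The central extension of `H` defined by a cocycle. -/
@[ext] structure ExtC {Y Q : Type*} [Group Y] [AddCommGroup Q] {H : Subgroup Y} {x : Y → Y → Q}
    (hx : IsCoc H x) where
  /-- image in the group -/
  g : H
  /-- central coordinate -/
  q : Q

namespace ExtC
variable {Y Q : Type*} [Group Y] [AddCommGroup Q] {H : Subgroup Y} {x : Y → Y → Q}
  {hx : IsCoc H x}

lemma coc_one_left (hx : IsCoc H x) (g : Y) (hg : g ∈ H) : x 1 g = x 1 1 := by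
  have := hx 1 H.one_mem 1 H.one_mem g hg
  simp only [one_mul] at this
  exact (add_right_cancel (this.trans (add_comm _ _))).symm

lemma coc_one_right (hx : IsCoc H x) (g : Y) (hg : g ∈ H) : x g 1 = x 1 1 := by
  have := hx g hg 1 H.one_mem 1 H.one_mem
  simp only [mul_one] at this
  exact add_right_cancel this

instance : Mul (ExtC hx) := ⟨fun a b => ⟨a.g * b.g, a.q + b.q + x a.g b.g⟩⟩
instance : One (ExtC hx) := ⟨⟨1, -x 1 1⟩⟩
instance : Inv (ExtC hx) := ⟨fun a => ⟨a.g⁻¹, -a.q - x 1 1 - x ((a.g : Y)⁻¹) a.g⟩⟩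

@[simp] lemma mul_g (a b : ExtC hx) : (a * b).g = a.g * b.g := rfl
@[simp] lemma mul_q (a b : ExtC hx) : (a * b).q = a.q + b.q + x a.g b.g := rfl
@[simp] lemma one_g : (1 : ExtC hx).g = 1 := rfl
@[simp] lemma one_q : (1 : ExtC hx).q = -x 1 1 := rfl

instance : Group (ExtC hx) := Group.ofLeftAxioms
  (by
    intro a b c
    ext
    · simp [mul_assoc]
    · simp only [mul_q, mul_g, Subgroup.coe_mul]
      have := hx a.g a.g.2 b.g b.g.2 c.g c.g.2
      rw [show a.q + b.q + x a.g b.g + c.q + x (a.g * b.g) c.g =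
        a.q + b.q + c.q + (x a.g b.g + x (a.g * b.g) c.g) by abel, this]
      abel)
  (by
    intro a
    ext
    · simp
    · simp only [mul_q, one_q, one_g, Subgroup.coe_one, coc_one_left hx a.g a.g.2]
      abel)
  (by
    intro a
    ext
    · change ((a.g⁻¹ * a.g : H) : Y) = 1; simp
    · change -a.q - x 1 1 - x ((a.g : Y)⁻¹) a.g + a.q + x ((a.g⁻¹ : H) : Y) a.g = -x 1 1
      rw [Subgroup.coe_inv]
      abel)

/-- The projection. -/
def proj (hx : IsCoc H x) : ExtC hx →* Y := MonoidHom.mk' (fun a => a.g) (fun _ _ => rfl)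

@[simp] lemma proj_apply (a : ExtC hx) : proj hx a = a.g := rfl

/-- The central inclusion. -/
def cen (hx : IsCoc H x) (q : Q) : ExtC hx := ⟨1, q - x 1 1⟩

lemma cen_mul (q r : Q) : cen hx q * cen hx r = cen hx (q + r) := by
  ext
  · simp [cen]
  · simp [cen]
    abel

lemma cen_zero : cen hx 0 = 1 := by
  ext <;> simp [cen]

lemma cen_pow (q : Q) (n : ℕ) : (cen hx q) ^ n = cen hx (n • q) := by
  induction n with
  | zero => simp [cen_zero]
  | succ n ih => rw [pow_succ, ih, cen_mul, succ_nsmul]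

lemma cen_inj {q r : Q} : cen hx q = cen hx r ↔ q = r := by
  constructor
  · intro h
    have := congrArg ExtC.q h
    simpa [cen] using this
  · rintro rfl; rfl

lemma cen_comm (q : Q) (a : ExtC hx) : cen hx q * a = a * cen hx q := by
  ext
  · simp [cen]
  · simp [cen, coc_one_left hx a.g a.g.2, coc_one_right hx a.g a.g.2, add_comm]

lemma eq_cen {a : ExtC hx} (h : proj hx a = 1) : ∃ q, a = cen hx q := by
  refine ⟨a.q + x 1 1, ?_⟩
  ext
  · simpa [cen] using h
  · simp [cen]

lemma cen_mul_q (q : Q) (a : ExtC hx) : (cen hx q * a).q = q + a.q := by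
  simp only [cen, mul_q, Subgroup.coe_one, coc_one_left hx a.g a.g.2]
  abel

@[simp] lemma proj_cen (q : Q) : proj hx (cen hx q) = 1 := rfl

open Classical in
/-- The section of `ExtC hx` over `K` with central coordinate `-t`. -/
def sec (hx : IsCoc H x) (t : Y → Q) (g : Y) : ExtC hx :=
  if h : g ∈ H then ⟨⟨g, h⟩, -t g⟩ else 1

lemma sec_apply (hx : IsCoc H x) (t : Y → Q) {g : Y} (h : g ∈ H) :
    sec hx t g = ⟨⟨g, h⟩, -t g⟩ := by simp [sec, h]

lemma proj_sec (hx : IsCoc H x) (t : Y → Q) {g : Y} (h : g ∈ H) : proj hx (sec hx t g) = g := by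
  rw [sec_apply hx t h]; rfl

lemma homOn_sec {K : Subgroup Y} (hx : IsCoc H x) (hK : K ≤ H) {t : Y → Q} (ht : CobOn K x t) :
    HomOn K (sec hx t) := by
  intro g hg h hh
  rw [sec_apply hx t (hK hg), sec_apply hx t (hK hh), sec_apply hx t (hK (K.mul_mem hg hh))]
  ext
  · simp
  · simp only [mul_q, ht g hg h hh]
    abel

lemma cobOn_of_section {K : Subgroup Y} {s : Y → ExtC hx} (hs : HomOn K s)
    (hp : ∀ g ∈ K, proj hx (s g) = g) : CobOn K x (fun g => -(s g).q) := by
  intro g hg h hh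
  beta_reduce
  rw [hs g hg h hh, mul_q, ← proj_apply, ← proj_apply, hp g hg, hp h hh]
  abel

/-- Functoriality in the coefficients. -/
def mapE {Q' : Type*} [AddCommGroup Q'] {x' : Y → Y → Q'} (hx : IsCoc H x) (hx' : IsCoc H x')
    (φ : Q →+ Q') (h : ∀ a ∈ H, ∀ b ∈ H, x' a b = φ (x a b)) : ExtC hx →* ExtC hx' :=
  MonoidHom.mk' (fun a => ⟨a.g, φ a.q⟩) (by
    intro a b
    ext
    · simp
    · simp [h a.g a.g.2 b.g b.g.2])

lemma mapE_cen {Q' : Type*} [AddCommGroup Q'] {x' : Y → Y → Q'} {hx' : IsCoc H x'}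
    {φ : Q →+ Q'} (h : ∀ a ∈ H, ∀ b ∈ H, x' a b = φ (x a b)) (q : Q) :
    mapE hx hx' φ h (cen hx q) = cen hx' (φ q) := by
  ext
  · rfl
  · simp [cen, mapE, h 1 H.one_mem 1 H.one_mem]

end ExtC

/-! ### Canonical lifts of elementary matrices -/

/-- A group over `SL₂(ℚ)` with central kernel whose image contains `SL₂(ZS T)`. -/
structure CExt (T : Set ℕ) (X : Type*) [Group X] where
  /-- the projection -/
  pr : X →* S2
  /-- the kernel is central -/
  central : ∀ z, pr z = 1 → ∀ y, z * y = y * z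
  /-- lifts exist -/
  surj : ∀ g ∈ GT T, ∃ a, pr a = g

/-- The central extension of a cocycle as an extension over `GT T`. -/
def ExtC.toCExt {Q : Type*} [AddCommGroup Q] {H : Subgroup S2} {x : S2 → S2 → Q} (hx : IsCoc H x)
    {T : Set ℕ} (hT : GT T ≤ H) : CExt T (ExtC hx) where
  pr := ExtC.proj hx
  central z hz y := by
    obtain ⟨q, rfl⟩ := ExtC.eq_cen hz
    exact ExtC.cen_comm q y
  surj g hg := ⟨ExtC.sec hx 0 g, ExtC.proj_sec hx 0 (hT hg)⟩

/-- The unit `2`. -/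
def u2 : ℚˣ := Units.mk0 2 (by norm_num)
@[simp] lemma u2_val : (u2 : ℚ) = 2 := rfl

/-- Sets of primes containing 2 and 3. -/
structure Good (T : Set ℕ) : Prop where
  prime : ∀ p ∈ T, Nat.Prime p
  two : 2 ∈ T
  three : 3 ∈ T

namespace Good
variable {T : Set ℕ} (hT : Good T)
include hT

lemma half : (2 : ℚ)⁻¹ ∈ ZS T := inv_prime_mem hT.two
lemma third : (3 : ℚ)⁻¹ ∈ ZS T := inv_prime_mem hT.three
lemma div3 {a : ℚ} (ha : a ∈ ZS T) : a / 3 ∈ ZS T := by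
  rw [div_eq_mul_inv]; exact mul_mem ha hT.third
lemma dg2 : dg u2 ∈ GT T := dg_mem (by simp [ofNat_mem]) (by simpa using hT.half)
end Good

namespace CExt
variable {X : Type*} [Group X] {T : Set ℕ} (E : CExt T X)

lemma comm_eq {a a' b b' : X} (ha : E.pr a = E.pr a') (hb : E.pr b = E.pr b') :
    ⁅a, b⁆ = ⁅a', b'⁆ := by
  have h1 : E.pr (a' ⁻¹ * a) = 1 := by simp [ha]
  have h2 : E.pr (b' ⁻¹ * b) = 1 := by simp [hb]
  obtain ⟨z, rfl⟩ : ∃ z, a = a' * z := ⟨a'⁻¹ * a, by group⟩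
  obtain ⟨w, rfl⟩ : ∃ w, b = b' * w := ⟨b'⁻¹ * b, by group⟩
  simp only [inv_mul_cancel_left] at h1 h2
  have c1 := E.central z h1
  have c2 := E.central w h2
  rw [commutatorElement_def, commutatorElement_def]
  have e1 : (a' * z)⁻¹ = a'⁻¹ * z⁻¹ := by rw [← c1, mul_inv_rev]
  have e2 : (b' * w)⁻¹ = b'⁻¹ * w⁻¹ := by rw [← c2, mul_inv_rev]
  rw [e1, e2]
  calc a' * z * (b' * w) * (a'⁻¹ * z⁻¹) * (b'⁻¹ * w⁻¹)
      = a' * (z * b') * (w * a'⁻¹) * z⁻¹ * (b'⁻¹ * w⁻¹) := by group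
    _ = a' * b' * (z * a'⁻¹) * (w * z⁻¹) * (b'⁻¹ * w⁻¹) := by rw [c1 b', c2 a'⁻¹]; group
    _ = a' * b' * a'⁻¹ * z * (z⁻¹ * w) * (b'⁻¹ * w⁻¹) := by rw [c1 a'⁻¹, c2 z⁻¹]; group
    _ = a' * b' * a'⁻¹ * (w * b'⁻¹) * w⁻¹ := by group
    _ = a' * b' * a'⁻¹ * b'⁻¹ := by rw [c2]; group

/-- Some lift. -/
def lft (g : S2) : X := Function.invFun E.pr g

lemma pr_lft_of {g : S2} (h : ∃ a, E.pr a = g) : E.pr (E.lft g) = g := Function.invFun_eq h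

/-- Canonical lift of `xU a`. -/
def X12 (a : ℚ) : X := ⁅E.lft (dg u2), E.lft (xU (a / 3))⁆
/-- Canonical lift of `xL a`. -/
def X21 (a : ℚ) : X := ⁅E.lft (dg u2⁻¹), E.lft (xL (a / 3))⁆

lemma comm_eq_X12 {a : ℚ} {h l : X} (hh : E.pr h = dg u2) (hl : E.pr l = xU (a / 3)) :
    ⁅h, l⁆ = E.X12 a :=
  E.comm_eq (by rw [E.pr_lft_of ⟨h, hh⟩, hh]) (by rw [E.pr_lft_of ⟨l, hl⟩, hl])

lemma comm_eq_X21 {a : ℚ} {h l : X} (hh : E.pr h = dg u2⁻¹) (hl : E.pr l = xL (a / 3)) :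
    ⁅h, l⁆ = E.X21 a :=
  E.comm_eq (by rw [E.pr_lft_of ⟨h, hh⟩, hh]) (by rw [E.pr_lft_of ⟨l, hl⟩, hl])

variable (hT : Good T)
include hT

lemma exists_h : ∃ h, E.pr h = dg u2 := E.surj _ hT.dg2
lemma exists_h' : ∃ h, E.pr h = dg u2⁻¹ := E.surj _ (by rw [dg_inv]; exact inv_mem hT.dg2)
lemma exists_U {a : ℚ} (ha : a ∈ ZS T) : ∃ h, E.pr h = xU (a / 3) :=
  E.surj _ (xU_mem (hT.div3 ha))
lemma exists_L {a : ℚ} (ha : a ∈ ZS T) : ∃ h, E.pr h = xL (a / 3) :=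
  E.surj _ (xL_mem (hT.div3 ha))

lemma pr_X12 {a : ℚ} (ha : a ∈ ZS T) : E.pr (E.X12 a) = xU a := by
  rw [X12, map_commutatorElement, E.pr_lft_of (E.exists_h hT), E.pr_lft_of (E.exists_U hT ha),
    commutatorElement_def, dg_conj_xU, ← xU_neg, ← xU_add]
  congr 1
  simp; ring

lemma pr_X21 {a : ℚ} (ha : a ∈ ZS T) : E.pr (E.X21 a) = xL a := by
  rw [X21, map_commutatorElement, E.pr_lft_of (E.exists_h' hT), E.pr_lft_of (E.exists_L hT ha),
    commutatorElement_def, dg_conj_xL, ← xL_neg, ← xL_add]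
  congr 1
  simp; ring

lemma conj_dg_X12 {a : ℚ} (ha : a ∈ ZS T) {d : X} {u : ℚˣ} (hd : E.pr d = dg u) :
    d * E.X12 a * d⁻¹ = E.X12 ((u : ℚ) ^ 2 * a) := by
  obtain ⟨h, hh⟩ := E.exists_h hT
  obtain ⟨l, hl⟩ := E.exists_U hT ha
  rw [← E.comm_eq_X12 hh hl, conjugate_commutatorElement]
  apply E.comm_eq_X12
  · simp only [map_mul, map_inv, hd, hh, ← dg_inv, ← dg_mul]; simp
  · simp only [map_mul, map_inv, hd, hl, dg_conj_xU]; congr 1; ring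

lemma conj_dg_X21 {a : ℚ} (ha : a ∈ ZS T) {d : X} {u : ℚˣ} (hd : E.pr d = dg u) :
    d * E.X21 a * d⁻¹ = E.X21 (a / (u : ℚ) ^ 2) := by
  obtain ⟨h, hh⟩ := E.exists_h' hT
  obtain ⟨l, hl⟩ := E.exists_L hT ha
  rw [← E.comm_eq_X21 hh hl, conjugate_commutatorElement]
  apply E.comm_eq_X21
  · simp only [map_mul, map_inv, hd, hh]; simp only [← dg_inv, ← dg_mul]; simp
  · simp only [map_mul, map_inv, hd, hl, dg_conj_xL]; congr 1; ring

lemma conj_wt_X12 {a : ℚ} (ha : a ∈ ZS T) {d : X} {u : ℚˣ} (hd : E.pr d = wt u) :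
    d * E.X12 a * d⁻¹ = E.X21 (-(a / (u : ℚ) ^ 2)) := by
  obtain ⟨h, hh⟩ := E.exists_h hT
  obtain ⟨l, hl⟩ := E.exists_U hT ha
  rw [← E.comm_eq_X12 hh hl, conjugate_commutatorElement]
  apply E.comm_eq_X21
  · simp only [map_mul, map_inv, hd, hh, wt_conj_dg]
  · simp only [map_mul, map_inv, hd, hl, wt_conj_xU]; congr 1; ring

lemma conj_wt_X21 {a : ℚ} (ha : a ∈ ZS T) {d : X} {u : ℚˣ} (hd : E.pr d = wt u) :
    d * E.X21 a * d⁻¹ = E.X12 (-((u : ℚ) ^ 2 * a)) := by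
  obtain ⟨h, hh⟩ := E.exists_h' hT
  obtain ⟨l, hl⟩ := E.exists_L hT ha
  rw [← E.comm_eq_X21 hh hl, conjugate_commutatorElement]
  apply E.comm_eq_X12
  · simp only [map_mul, map_inv, hd, hh, wt_conj_dg, inv_inv]
  · simp only [map_mul, map_inv, hd, hl, wt_conj_xL]; congr 1; ring

lemma comm_of_xU {a b : ℚ} (ha : a ∈ ZS T) (hb : b ∈ ZS T) {x y : X} (hx : E.pr x = xU a)
    (hy : E.pr y = xU b) : x * y = y * x := by
  have hpow : ∀ (c : ℚ) (n : ℤ), xU c ^ n = xU (n * c) := by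
    intro c n
    induction n using Int.induction_on with
    | zero => simp
    | succ n ih => rw [zpow_add_one, ih, ← xU_add]; congr 1; push_cast; ring
    | pred n ih => rw [zpow_sub_one, ih, ← xU_neg, ← xU_add]; congr 1; push_cast; ring
  set c : ℚ := (a.den : ℚ)⁻¹ * (b.den : ℚ)⁻¹ with hc
  obtain ⟨z, hz⟩ := E.surj (xU c) (xU_mem (mul_mem (inv_mem_ZS _ (mem_ZS_den hT.prime ha))
    (inv_mem_ZS _ (mem_ZS_den hT.prime hb))))
  have e1 := Rat.num_div_den a
  have e2 := Rat.num_div_den b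
  have h1 : E.pr (x * z ^ (-(a.num * b.den))) = 1 := by
    rw [map_mul, map_zpow, hz, hpow, hx, ← xU_add]
    convert xU_zero
    rw [hc]
    nth_rewrite 1 [← e1]
    push_cast
    field_simp
    ring
  have h2 : E.pr (y * z ^ (-(b.num * a.den))) = 1 := by
    rw [map_mul, map_zpow, hz, hpow, hy, ← xU_add]
    convert xU_zero
    rw [hc]
    nth_rewrite 1 [← e2]
    push_cast
    field_simp
    ring
  have k1 := E.central _ h1
  have k2 := E.central _ h2
  have hzx : x * z = z * x := by
    have := k1 z
    have h3 : z ^ (-(a.num * b.den)) * z = z * z ^ (-(a.num * b.den)) :=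
      ((Commute.refl z).zpow_left _).eq
    rw [mul_assoc, h3, ← mul_assoc, ← mul_assoc] at this
    exact mul_right_cancel this
  have h4 : z ^ (-(b.num * a.den)) * x = x * z ^ (-(b.num * a.den)) :=
    (Commute.zpow_left (show Commute z x from hzx.symm) _).eq
  have := k2 x
  rw [mul_assoc, h4, ← mul_assoc, ← mul_assoc] at this
  exact (mul_right_cancel this).symm

lemma X12_add {a b : ℚ} (ha : a ∈ ZS T) (hb : b ∈ ZS T) :
    E.X12 (a + b) = E.X12 a * E.X12 b := by
  obtain ⟨h, hh⟩ := E.exists_h hT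
  obtain ⟨l, hl⟩ := E.exists_U hT ha
  obtain ⟨m, hm⟩ := E.exists_U hT hb
  have h3 : E.X12 b * l = l * E.X12 b := E.comm_of_xU hT hb (hT.div3 ha) (E.pr_X12 hT hb) hl
  have e : ⁅h, l * m⁆ = E.X12 (a + b) := E.comm_eq_X12 hh (by
    rw [map_mul, hl, hm, ← xU_add]; congr 1; ring)
  rw [← e, ← E.comm_eq_X12 hh hl]
  have : ⁅h, l * m⁆ = ⁅h, l⁆ * (l * ⁅h, m⁆ * l⁻¹) := by
    simp only [commutatorElement_def]; group
  rw [this, E.comm_eq_X12 hh hm, ← h3, mul_inv_cancel_right]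

lemma X12_zero : E.X12 0 = 1 := by
  have := E.X12_add hT (zero_mem (ZS T)) (zero_mem _)
  simpa using this

lemma X12_neg {a : ℚ} (ha : a ∈ ZS T) : E.X12 (-a) = (E.X12 a)⁻¹ := by
  rw [eq_inv_iff_mul_eq_one, ← E.X12_add hT (neg_mem ha) ha, neg_add_cancel, E.X12_zero hT]

lemma exists_wt : ∃ w, E.pr w = wt 1 := E.surj _ (wt_mem (by simp [one_mem]) (by simp [one_mem]))

lemma X21_add {a b : ℚ} (ha : a ∈ ZS T) (hb : b ∈ ZS T) :
    E.X21 (a + b) = E.X21 a * E.X21 b := by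
  obtain ⟨w, hw⟩ := E.exists_wt hT
  have e : ∀ a ∈ ZS T, E.X21 a = w * E.X12 (-a) * w⁻¹ := by
    intro a ha
    rw [E.conj_wt_X12 hT (neg_mem ha) hw]; simp
  rw [e _ ha, e _ hb, e _ (add_mem ha hb), neg_add, E.X12_add hT (neg_mem ha) (neg_mem hb)]
  group

lemma X21_zero : E.X21 0 = 1 := by
  have := E.X21_add hT (zero_mem (ZS T)) (zero_mem _)
  simpa using this

lemma X21_neg {a : ℚ} (ha : a ∈ ZS T) : E.X21 (-a) = (E.X21 a)⁻¹ := by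
  rw [eq_inv_iff_mul_eq_one, ← E.X21_add hT (neg_mem ha) ha, neg_add_cancel, E.X21_zero hT]

omit hT

lemma section_X12 {K : Subgroup S2} {s : S2 → X} (hs : HomOn K s)
    (hp : ∀ g ∈ K, E.pr (s g) = g) (h2 : dg u2 ∈ K) {a : ℚ} (ha : xU (a / 3) ∈ K) :
    s (xU a) = E.X12 a := by
  have : xU a = dg u2 * xU (a / 3) * (dg u2)⁻¹ * (xU (a / 3))⁻¹ := by
    rw [dg_conj_xU, ← xU_neg, ← xU_add]; congr 1; simp; ring
  rw [this, hs _ (mul_mem (mul_mem h2 ha) (inv_mem h2)) _ (inv_mem ha),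
    hs _ (mul_mem h2 ha) _ (inv_mem h2), hs _ h2 _ ha, hs.map_inv h2, hs.map_inv ha,
    ← commutatorElement_def]
  exact E.comm_eq_X12 (hp _ h2) (hp _ ha)

lemma section_X21 {K : Subgroup S2} {s : S2 → X} (hs : HomOn K s)
    (hp : ∀ g ∈ K, E.pr (s g) = g) (h2 : dg u2 ∈ K) {a : ℚ} (ha : xL (a / 3) ∈ K) :
    s (xL a) = E.X21 a := by
  have h2' : dg u2⁻¹ ∈ K := by rw [dg_inv]; exact inv_mem h2
  have : xL a = dg u2⁻¹ * xL (a / 3) * (dg u2⁻¹)⁻¹ * (xL (a / 3))⁻¹ := by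
    rw [dg_conj_xL, ← xL_neg, ← xL_add]; congr 1; simp; ring
  rw [this, hs _ (mul_mem (mul_mem h2' ha) (inv_mem h2')) _ (inv_mem ha),
    hs _ (mul_mem h2' ha) _ (inv_mem h2'), hs _ h2' _ ha, hs.map_inv h2', hs.map_inv ha,
    ← commutatorElement_def]
  exact E.comm_eq_X21 (hp _ h2') (hp _ ha)

lemma map_X12 {X' : Type*} [Group X'] (E' : CExt T X') (F : X →* X')
    (hF : ∀ a, E'.pr (F a) = E.pr a) (hT : Good T) {a : ℚ} (ha : a ∈ ZS T) :
    F (E.X12 a) = E'.X12 a := by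
  obtain ⟨h, hh⟩ := E.exists_h hT
  obtain ⟨l, hl⟩ := E.exists_U hT ha
  rw [← E.comm_eq_X12 hh hl, map_commutatorElement]
  exact E'.comm_eq_X12 (by rw [hF, hh]) (by rw [hF, hl])

lemma map_X21 {X' : Type*} [Group X'] (E' : CExt T X') (F : X →* X')
    (hF : ∀ a, E'.pr (F a) = E.pr a) (hT : Good T) {a : ℚ} (ha : a ∈ ZS T) :
    F (E.X21 a) = E'.X21 a := by
  obtain ⟨h, hh⟩ := E.exists_h' hT
  obtain ⟨l, hl⟩ := E.exists_L hT ha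
  rw [← E.comm_eq_X21 hh hl, map_commutatorElement]
  exact E'.comm_eq_X21 (by rw [hF, hh]) (by rw [hF, hl])

end CExt

/-! ### The tame cocycles -/

/-- The cocycle of a set-theoretic section of a central extension. -/
lemma exists_coc_of_section {Y P F : Type*} [Group Y] [Group P] [CommGroup F] (π : P →* Y)
    (c : F →* P) (hc : Function.Injective c) (hcen : ∀ f y, c f * y = y * c f)
    (hker : ∀ y, π y = 1 → ∃ f, c f = y) (H : Subgroup Y) (s : Y → P)
    (hs : ∀ g ∈ H, π (s g) = g) :
    ∃ x : Y → Y → Additive F, IsCoc H x ∧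
      ∀ g ∈ H, ∀ h ∈ H, c (x g h).toMul * s (g * h) = s g * s h := by
  have hex : ∀ g h : Y, ∃ f : F, g ∈ H → h ∈ H → c f * s (g * h) = s g * s h := by
    intro g h
    by_cases hg : g ∈ H
    · by_cases hh : h ∈ H
      · obtain ⟨f, hf⟩ := hker (s g * s h * (s (g * h))⁻¹) (by
          rw [map_mul, map_mul, map_inv, hs g hg, hs h hh, hs _ (H.mul_mem hg hh)]; group)
        exact ⟨f, fun _ _ => by rw [hf]; group⟩
      · exact ⟨1, fun _ h => absurd h hh⟩
    · exact ⟨1, fun h => absurd h hg⟩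
  choose x hx using hex
  refine ⟨fun g h => Additive.ofMul (x g h), ?_, fun g hg h hh => hx g h hg hh⟩
  intro g hg h hh k hk
  change Additive.ofMul (x g h * x (g * h) k) = Additive.ofMul (x h k * x g (h * k))
  congr 1
  apply hc
  have e1 := hx g h hg hh
  have e2 := hx (g * h) k (H.mul_mem hg hh) hk
  have e3 := hx h k hh hk
  have e4 := hx g (h * k) hg (H.mul_mem hh hk)
  rw [map_mul, map_mul]
  apply mul_right_cancel (b := s (g * h * k))
  calc c (x g h) * c (x (g * h) k) * s (g * h * k)
      = (c (x g h) * s (g * h)) * s k := by rw [mul_assoc, e2, mul_assoc]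
    _ = s g * (s h * s k) := by rw [e1, mul_assoc]
    _ = s g * c (x h k) * s (h * k) := by rw [← e3, mul_assoc]
    _ = c (x h k) * (s g * s (h * k)) := by rw [← hcen, mul_assoc]
    _ = c (x h k) * c (x g (h * k)) * s (g * h * k) := by rw [← e4, ← mul_assoc, mul_assoc g h k]

section twist
variable {Y F : Type} [Group Y] [CommGroup F] {K₁ K₂ : Subgroup Y}

/-- The amalgamation data twisted by a character. -/
def twistIncl (K₁ K₂ : Subgroup Y) (χ : ↥(K₁ ⊓ K₂) →* F) (i : Bool) :
    ↥(K₁ ⊓ K₂) × F →* ↥(fam K₁ K₂ i) × F :=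
  MonoidHom.prod ((famIncl K₁ K₂ i).comp (MonoidHom.fst _ _))
    (MonoidHom.snd _ _ * (if i then 1 else χ.comp (MonoidHom.fst _ _)))

lemma twistIncl_injective (χ : ↥(K₁ ⊓ K₂) →* F) (i : Bool) :
    Function.Injective (twistIncl K₁ K₂ χ i) := by
  rintro ⟨a, f⟩ ⟨b, g⟩ h
  have h1 : famIncl K₁ K₂ i a = famIncl K₁ K₂ i b := congrArg Prod.fst h
  have h1 := famIncl_injective K₁ K₂ i h1
  subst h1
  have h2 := congrArg Prod.snd h
  have h2 : f * _ = g * _ := h2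
  have h2 : f = g := by
    cases i
    · exact mul_right_cancel (b := χ a) h2
    · exact mul_right_cancel (b := 1) h2
  exact Prod.ext rfl h2

/-- A central extension of an amalgam with prescribed gluing character. -/
theorem exists_twisted (hA : Amalg K₁ K₂) (χ : Y → F) (hχ : HomOn (K₁ ⊓ K₂) χ) :
    ∃ (x : Y → Y → Additive F) (u : Y → Additive F), IsCoc (K₁ ⊔ K₂) x ∧
      (∀ g ∈ K₁, ∀ h ∈ K₁, x g h = 0) ∧ CobOn K₂ x u ∧
      ∀ γ ∈ K₁, γ ∈ K₂ → u γ = Additive.ofMul (χ γ) := by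
  classical
  set X : ↥(K₁ ⊓ K₂) →* F := hχ.toHom with hX
  let φ := twistIncl K₁ K₂ X
  let P := Monoid.PushoutI φ
  let b : ↥(K₁ ⊓ K₂) × F →* P := Monoid.PushoutI.base φ
  let o : ∀ i, ↥(fam K₁ K₂ i) × F →* P := fun i => Monoid.PushoutI.of (φ := φ) i
  have ob : ∀ i z, o i (φ i z) = b z := fun i z => Monoid.PushoutI.of_apply_eq_base φ i z
  let π : P →* Y := Monoid.PushoutI.lift (φ := φ)
    (fun i => (fam K₁ K₂ i).subtype.comp (MonoidHom.fst _ _))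
    ((K₁ ⊓ K₂).subtype.comp (MonoidHom.fst _ _)) (fun _ => rfl)
  have πo : ∀ i z, π (o i z) = z.1 := fun i z =>
    Monoid.PushoutI.lift_of (φ := φ) (fun i => (fam K₁ K₂ i).subtype.comp (MonoidHom.fst _ _)) _ _ z
  let c : F →* P := b.comp (MonoidHom.inr _ _)
  have hc : Function.Injective c := fun f g h => by
    have := Monoid.PushoutI.base_injective (φ := φ) (fun i => twistIncl_injective X i) h
    exact congrArg Prod.snd this
  have co : ∀ i f, c f = o i (1, f) := by
    intro i f
    change b (1, f) = _
    rw [← ob i]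
    congr 1
    ext
    · rfl
    · change f * _ = f
      cases i <;> simp
  have hgen : ∀ (Q : P → Prop), (∀ i z, Q (o i z)) → (∀ x y, Q x → Q y → Q (x * y)) →
      ∀ y, Q y := by
    intro Q h1 h2 y
    induction y using Monoid.PushoutI.induction_on with
    | of i g => exact h1 i g
    | base h => 
      have := h1 true (φ true h)
      rwa [ob] at this
    | mul x y hx hy => exact h2 x y hx hy
  have hcen : ∀ f y, c f * y = y * c f := by
    intro f y
    refine hgen (fun y => c f * y = y * c f) (fun i z => ?_) (fun x y hx hy => ?_) y
    · rw [co i, ← map_mul, ← map_mul]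
      congr 1
      ext
      · simp
      · simp [mul_comm]
    · rw [← mul_assoc, hx, mul_assoc, hy, mul_assoc]
  have hπc : ∀ f, π (c f) = 1 := by
    intro f
    rw [co true, πo]; rfl
  have hN : (c.range).Normal := ⟨by
    rintro _ ⟨f, rfl⟩ g
    rw [← hcen]
    exact ⟨f, by group⟩⟩
  let q : P →* P ⧸ c.range := QuotientGroup.mk' c.range
  have qc : ∀ f, q (c f) = 1 := fun f => (QuotientGroup.eq_one_iff _).2 ⟨f, rfl⟩
  let e : ∀ i, ↥(fam K₁ K₂ i) →* ↥(fam K₁ K₂ i) × F := fun i => MonoidHom.inl _ _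
  have split : ∀ i (z : ↥(fam K₁ K₂ i) × F), o i z = o i (e i z.1) * c z.2 := by
    intro i z
    rw [co i, ← map_mul]
    congr 1
    ext <;> simp [e]
  let j₁ : K₁ →* P := (o true).comp (e true)
  let j₂ : K₂ →* P := (o false).comp (e false)
  have hj : ∀ γ (h1 : γ ∈ K₁) (h2 : γ ∈ K₂), j₁ ⟨γ, h1⟩ = j₂ ⟨γ, h2⟩ * c (χ γ) := by
    intro γ h1 h2
    have a1 := ob true (⟨γ, h1, h2⟩, 1)
    have a2 := ob false (⟨γ, h1, h2⟩, 1)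
    rw [← a2, split] at a1
    rw [split false] at a1
    have f1 : (φ true (⟨γ, h1, h2⟩, 1)).2 = 1 := by
      change (1 : F) * 1 = 1; simp
    have f2 : (φ false (⟨γ, h1, h2⟩, 1)).2 = χ γ := by
      change (1 : F) * _ = _; simp [hX]
    rw [f1, f2, map_one, mul_one] at a1
    exact a1
  obtain ⟨F₀, hF₀, hF₁, hF₂⟩ := hA (P ⧸ c.range) (extendHom (q.comp j₁)) (extendHom (q.comp j₂))
    (homOn_extendHom _) (homOn_extendHom _) (by
      intro g h1 h2
      rw [extendHom_apply _ h1, extendHom_apply _ h2]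
      change q (j₁ _) = q (j₂ _)
      rw [hj g h1 h2, map_mul, qc, mul_one])
  have hF : ∀ y, π y ∈ K₁ ⊔ K₂ ∧ F₀ (π y) = q y := by
    intro y
    refine hgen (fun y => π y ∈ K₁ ⊔ K₂ ∧ F₀ (π y) = q y) (fun i z => ?_)
      (fun x y hx hy => ?_) y
    · rw [πo, split, map_mul, qc, mul_one]
      cases i with
      | true =>
        have hz : (z.1 : Y) ∈ K₁ := z.1.2
        exact ⟨le_sup_left (a := K₁) hz, by rw [hF₁ _ hz, extendHom_apply _ hz]; rfl⟩
      | false =>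
        have hz : (z.1 : Y) ∈ K₂ := z.1.2
        exact ⟨le_sup_right (b := K₂) hz, by rw [hF₂ _ hz, extendHom_apply _ hz]; rfl⟩
    · rw [map_mul]
      exact ⟨mul_mem hx.1 hy.1, by rw [hF₀ _ hx.1 _ hy.1, hx.2, hy.2, map_mul]⟩
  have hker : ∀ y, π y = 1 → ∃ f, c f = y := by
    intro y hy
    have := (hF y).2
    rw [hy, hF₀.map_one] at this
    exact (QuotientGroup.eq_one_iff y).1 this.symm
  have hsurj : K₁ ⊔ K₂ ≤ π.range := by
    rw [sup_le_iff]
    exact ⟨fun g hg => ⟨j₁ ⟨g, hg⟩, πo true _⟩, fun g hg => ⟨j₂ ⟨g, hg⟩, πo false _⟩⟩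
  let s : Y → P := fun g => if h : g ∈ K₁ then j₁ ⟨g, h⟩ else Function.invFun π g
  have s1 : ∀ g (h : g ∈ K₁), s g = j₁ ⟨g, h⟩ := fun g h => by simp [s, h]
  have hs : ∀ g ∈ K₁ ⊔ K₂, π (s g) = g := by
    intro g hg
    by_cases h : g ∈ K₁
    · rw [s1 g h]; exact πo true _
    · simp only [s, h, dite_false]
      exact Function.invFun_eq (hsurj hg)
  obtain ⟨x, hx, hxs⟩ := exists_coc_of_section π c hc hcen hker (K₁ ⊔ K₂) s hs
  have hu : ∀ g : Y, ∃ f : F, ∀ h : g ∈ K₂, s g = j₂ ⟨g, h⟩ * c f := by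
    intro g
    by_cases h : g ∈ K₂
    · obtain ⟨f, hf⟩ := hker ((j₂ ⟨g, h⟩)⁻¹ * s g) (by
        rw [map_mul, map_inv, hs g (le_sup_right (b := K₂) h)]
        have : π (j₂ ⟨g, h⟩) = g := πo false _
        rw [this]; group)
      exact ⟨f, fun _ => by rw [hf]; group⟩
    · exact ⟨1, fun h' => absurd h' h⟩
  choose u hu using hu
  refine ⟨x, fun g => Additive.ofMul (u g), hx, ?_, ?_, ?_⟩
  · intro g hg h hh
    have := hxs g (le_sup_left (a := K₁) hg) h (le_sup_left (a := K₁) hh)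
    rw [s1 g hg, s1 h hh, s1 _ (mul_mem hg hh), ← map_mul] at this
    have h3 : c (x g h).toMul = c 1 := by rw [map_one]; exact mul_eq_right.1 this
    exact hc h3
  · intro g hg h hh
    have := hxs g (le_sup_right (b := K₂) hg) h (le_sup_right (b := K₂) hh)
    rw [hu g hg, hu h hh, hu _ (mul_mem hg hh)] at this
    have e1 : j₂ ⟨g * h, mul_mem hg hh⟩ = j₂ ⟨g, hg⟩ * j₂ ⟨h, hh⟩ := map_mul j₂ ⟨g, hg⟩ ⟨h, hh⟩
    have e2 : j₂ ⟨g * h, mul_mem hg hh⟩ * c ((x g h).toMul * u (g * h)) =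
        j₂ ⟨g * h, mul_mem hg hh⟩ * c (u g * u h) := by
      rw [map_mul, ← mul_assoc, ← hcen (x g h).toMul, mul_assoc, this, e1, map_mul]
      rw [mul_assoc, ← mul_assoc (c (u g)), hcen (u g)]
      simp only [mul_assoc]
    have e3 := hc (mul_left_cancel e2)
    have e4 : (x g h).toMul = u g * u h / u (g * h) := eq_div_of_mul_eq' e3
    exact congrArg Additive.ofMul e4
  · intro γ h1 h2
    have := hu γ h2
    rw [s1 γ h1, hj γ h1 h2] at this
    exact congrArg Additive.ofMul (hc (mul_left_cancel this)).symm

end twist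

section residue
variable (p : ℕ) [hp : Fact p.Prime] {T : Set ℕ}

lemma den_ne_zero (hT : ∀ q ∈ T, Nat.Prime q) (hpT : p ∉ T) {x : ℚ} (hx : x ∈ ZS T) :
    (x.den : ZMod p) ≠ 0 := by
  rw [Ne, ZMod.natCast_eq_zero_iff]
  exact fun h => hpT (mem_ZS_den hT hx p hp.out h)

lemma rs_add (hT : ∀ q ∈ T, Nat.Prime q) (hpT : p ∉ T) {x y : ℚ} (hx : x ∈ ZS T) (hy : y ∈ ZS T) :
    ((x + y : ℚ) : ZMod p) = x + y :=
  Rat.cast_add_of_ne_zero (den_ne_zero p hT hpT hx) (den_ne_zero p hT hpT hy)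

lemma rs_mul (hT : ∀ q ∈ T, Nat.Prime q) (hpT : p ∉ T) {x y : ℚ} (hx : x ∈ ZS T) (hy : y ∈ ZS T) :
    ((x * y : ℚ) : ZMod p) = x * y :=
  Rat.cast_mul_of_ne_zero (den_ne_zero p hT hpT hx) (den_ne_zero p hT hpT hy)

lemma rs_eq_zero (hT : ∀ q ∈ T, Nat.Prime q) (hpT : p ∉ T) {x : ℚ} (hx : x / p ∈ ZS T) :
    (x : ZMod p) = 0 := by
  have h : x = (p : ℚ) * (x / p) := by field_simp [p_ne p]
  rw [h, rs_mul p hT hpT (natCast_mem _ _) hx]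
  simp

lemma div_mem_of_rs (hT : ∀ q ∈ T, Nat.Prime q) {x : ℚ} (hx : x ∈ ZS T) (hpT : p ∉ T)
    (h : (x : ZMod p) = 0) : x / p ∈ ZS T := by
  rw [Rat.cast_def, div_eq_zero_iff, or_iff_left (den_ne_zero p hT hpT hx)] at h
  obtain ⟨k, hk⟩ := (ZMod.intCast_zmod_eq_zero_iff_dvd _ _).1 h
  have : x / p = k * (x.den : ℚ)⁻¹ := by
    nth_rewrite 1 [← Rat.num_div_den x]
    rw [hk]
    push_cast
    field_simp [p_ne p]
  rw [this]
  exact mul_mem (intCast_mem _ _) (inv_mem_ZS _ (mem_ZS_den hT hx))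

/-- The unit in `ZMod p` of the upper left entry (`1` if it is not a unit). -/
def chi (g : S2) : (ZMod p)ˣ :=
  if h : ((g 0 0 : ℚ) : ZMod p) ≠ 0 then Units.mk0 _ h else 1

lemma chi_ne (hT : ∀ q ∈ T, Nat.Prime q) (hpT : p ∉ T) {g : S2} (hg : g ∈ Gam p T) :
    ((g 0 0 : ℚ) : ZMod p) * ((g 1 1 : ℚ) : ZMod p) = 1 := by
  obtain ⟨⟨h1, h2, h3, h4⟩, h5⟩ := mem_Gam.1 hg
  have e : g 0 0 * g 1 1 = 1 + g 0 1 * g 1 0 := by linarith [det_eq g]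
  rw [← rs_mul p hT hpT h1 h4, e, rs_add p hT hpT (one_mem _) (mul_mem h2 h3),
    rs_mul p hT hpT h2 h3, rs_eq_zero p hT hpT h5]
  simp

lemma chi_val (hT : ∀ q ∈ T, Nat.Prime q) (hpT : p ∉ T) {g : S2} (hg : g ∈ Gam p T) :
    (chi p g : ZMod p) = ((g 0 0 : ℚ) : ZMod p) := by
  have : ((g 0 0 : ℚ) : ZMod p) ≠ 0 := left_ne_zero_of_mul_eq_one (chi_ne p hT hpT hg)
  simp [chi, this]

lemma homOn_chi (hT : ∀ q ∈ T, Nat.Prime q) (hpT : p ∉ T) : HomOn (Gam p T) (chi p) := by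
  intro g hg h hh
  ext
  rw [Units.val_mul, chi_val p hT hpT hg, chi_val p hT hpT hh, chi_val p hT hpT (mul_mem hg hh)]
  obtain ⟨⟨h1, h2, h3, h4⟩, h5⟩ := mem_Gam.1 hg
  obtain ⟨⟨k1, k2, k3, k4⟩, k5⟩ := mem_Gam.1 hh
  rw [mul_00, rs_add p hT hpT (mul_mem h1 k1) (mul_mem h2 k3), rs_mul p hT hpT h1 k1,
    rs_mul p hT hpT h2 k3, rs_eq_zero p hT hpT k5]
  simp

lemma exists_chi (T : Set ℕ) (hT : ∀ q ∈ T, Nat.Prime q) (hpT : p ∉ T) (c : (ZMod p)ˣ) :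
    ∃ g ∈ Gam p T, chi p g = c := by
  have hc : Nat.Coprime (c : ZMod p).val p := ZMod.val_coe_unit_coprime c
  have hb := Nat.isCoprime_iff_coprime.2 hc
  obtain ⟨u, v, huv⟩ := hb
  have hm : mk ((c : ZMod p).val : ℚ) (-v) p u (by
      have : ((u * (c : ZMod p).val + v * p : ℤ) : ℚ) = 1 := by rw [huv]; simp
      push_cast at this; linarith) ∈ Gam p T := by
    refine mem_Gam.2 ⟨⟨natCast_mem _ _, neg_mem (intCast_mem _ _), natCast_mem _ _,
      intCast_mem _ _⟩, ?_⟩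
    rw [mk_10, div_self (p_ne p)]; exact one_mem _
  refine ⟨_, hm, ?_⟩
  ext
  rw [chi_val p hT hpT hm, mk_00, Rat.cast_natCast, ZMod.natCast_zmod_val]

end residue

/-- All primes other than `p`. -/
def cop (p : ℕ) : Set ℕ := {q | q.Prime ∧ q ≠ p}

lemma cop_prime (p : ℕ) : ∀ q ∈ cop p, Nat.Prime q := fun _ h => h.1
lemma notMem_cop (p : ℕ) : p ∉ cop p := fun h => h.2 rfl

lemma le_GT_insert_cop (p : ℕ) [Fact p.Prime] : GT (insert p (cop p)) = ⊤ := by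
  rw [eq_top_iff]
  intro g _
  have : ∀ x : ℚ, x ∈ ZS (insert p (cop p)) := by
    intro x
    apply mem_ZS
    intro q hq _
    by_cases h : q = p
    · exact Or.inl h
    · exact Or.inr ⟨hq, h⟩
  exact ⟨this _, this _, this _, this _⟩

lemma exists_tau (p : ℕ) (hp : p.Prime) : ∃ (x : S2 → S2 → Additive (ZMod p)ˣ),
    IsCoc ⊤ x ∧ (∀ g ∈ GT (cop p), ∀ h ∈ GT (cop p), x g h = 0) ∧
      ∃ u, CobOn (haveI := Fact.mk hp; GT' p (cop p)) x u ∧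
        ∀ g ∈ (haveI := Fact.mk hp; Gam p (cop p)), u g =
          Additive.ofMul (haveI := Fact.mk hp; chi p g) := by
  have := Fact.mk hp
  obtain ⟨x, u, h1, h2, h3, h4⟩ := exists_twisted (amalg_GT (p := p) (cop_prime p) (notMem_cop p))
    (chi p) (homOn_chi p (cop_prime p) (notMem_cop p))
  rw [GT_insert (cop_prime p), le_GT_insert_cop] at h1
  exact ⟨x, h1, h2, u, h3, fun g hg => h4 g hg.1 hg.2⟩

open Classical in
/-- The tame cocycle at `p`. -/
def tau (p : ℕ) : S2 → S2 → Additive (ZMod p)ˣ :=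
  if hp : p.Prime then (exists_tau p hp).choose else 0

lemma tau_coc (p : ℕ) : IsCoc ⊤ (tau p) := by
  by_cases hp : p.Prime
  · simp only [tau, hp, dite_true]
    exact (exists_tau p hp).choose_spec.1
  · simp [tau, hp, IsCoc]

lemma tau_eq_zero (p : ℕ) {g h : S2} (hg : g ∈ GT (cop p)) (hh : h ∈ GT (cop p)) :
    tau p g h = 0 := by
  by_cases hp : p.Prime
  · simp only [tau, hp, dite_true]
    exact (exists_tau p hp).choose_spec.2.1 g hg h hh
  · simp [tau, hp]

lemma tau_cob (p : ℕ) [hp : Fact p.Prime] : ∃ u, CobOn (GT' p (cop p)) (tau p) u ∧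
    ∀ g ∈ Gam p (cop p), u g = Additive.ofMul (chi p g) := by
  have : tau p = (exists_tau p hp.out).choose := by simp [tau, hp.out]
  rw [this]
  exact (exists_tau p hp.out).choose_spec.2.2

/-! ### The winding cocycle -/

/-- The closed-open upper half plane. -/
def posv (v : ℚ × ℚ) : Prop := 0 < v.2 ∨ (v.2 = 0 ∧ 0 < v.1)

/-- The cross product. -/
def crs (w v : ℚ × ℚ) : ℚ := w.1 * v.2 - w.2 * v.1

/-- Comparison of arguments in `[0, 2π)`. -/
def angLt (w v : ℚ × ℚ) : Prop := (posv w ∧ ¬ posv v) ∨ ((posv w ↔ posv v) ∧ 0 < crs w v)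

open Classical in
/-- Indicator of `angLt`. -/
def angI (w v : ℚ × ℚ) : ℤ := if angLt w v then 1 else 0

lemma crs_actv (g : S2) (w v : ℚ × ℚ) : crs (actv g w) (actv g v) = crs w v := by
  have := det_eq g
  simp only [crs, actv]
  linear_combination (w.1 * v.2 - w.2 * v.1) * this

lemma actv_ne {g : S2} {v : ℚ × ℚ} (hv : v ≠ 0) : actv g v ≠ 0 := by
  intro h
  apply hv
  have := actv_mul g⁻¹ g v
  rw [inv_mul_cancel, h] at this
  simpa [actv, Prod.ext_iff] using this

lemma actv_one (v : ℚ × ℚ) : actv 1 v = v := by simp [actv]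

/-- The elements which change the order of arguments by a cut. -/
def cutGroup : Subgroup S2 where
  carrier := {g | ∃ n : ℚ × ℚ → ℤ, ∀ v w, v ≠ 0 → w ≠ 0 →
    angI (actv g w) (actv g v) = angI w v + n w - n v}
  one_mem' := ⟨0, fun v w _ _ => by simp [actv_one]⟩
  mul_mem' := by
    rintro g h ⟨m, hm⟩ ⟨n, hn⟩
    refine ⟨fun v => n v + m (actv h v), fun v w hv hw => ?_⟩
    rw [actv_mul, actv_mul, hm _ _ (actv_ne hv) (actv_ne hw), hn _ _ hv hw]
    ring
  inv_mem' := by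
    rintro g ⟨n, hn⟩
    refine ⟨fun v => - n (actv g⁻¹ v), fun v w hv hw => ?_⟩
    have := hn (actv g⁻¹ v) (actv g⁻¹ w) (actv_ne hv) (actv_ne hw)
    rw [← actv_mul, ← actv_mul, mul_inv_cancel, actv_one, actv_one] at this
    rw [this]
    ring

lemma xU_mem_cut (t : ℚ) : xU t ∈ cutGroup := by
  refine ⟨0, fun v w hv hw => ?_⟩
  have h : ∀ v, posv (actv (xU t) v) ↔ posv v := by
    intro v
    simp only [posv, actv, xU_10, xU_11, xU_00, xU_01, zero_mul, zero_add, one_mul]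
    constructor
    · rintro (h | ⟨h, k⟩)
      · exact Or.inl h
      · rw [h] at k; exact Or.inr ⟨h, by simpa using k⟩
    · rintro (h | ⟨h, k⟩)
      · exact Or.inl h
      · rw [h]; exact Or.inr ⟨rfl, by simpa using k⟩
  have : angLt (actv (xU t) w) (actv (xU t) v) ↔ angLt w v := by
    simp only [angLt, h, crs_actv]
  have : angI (actv (xU t) w) (actv (xU t) v) = angI w v := by
    classical exact if_congr this rfl rfl
  simp [this]

lemma quadrant (v : ℚ × ℚ) (hv : v ≠ 0) : (0 < v.1 ∧ 0 ≤ v.2) ∨ (v.1 ≤ 0 ∧ 0 < v.2) ∨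
    (v.1 < 0 ∧ v.2 ≤ 0) ∨ (0 ≤ v.1 ∧ v.2 < 0) := by
  have : v.1 ≠ 0 ∨ v.2 ≠ 0 := by
    by_contra h
    push Not at h
    exact hv (Prod.ext h.1 h.2)
  grind

lemma rot_mem_cut : wt (-1) ∈ cutGroup := by
  classical
  refine ⟨fun v => if 0 ≤ v.1 ∧ v.2 < 0 then 1 else 0, fun v w hv hw => ?_⟩
  have hS : ∀ v, actv (wt (-1)) v = (-v.2, v.1) := by intro v; simp [actv]
  have key : ∀ v, v ≠ 0 → (posv v ∧ posv (-v.2, v.1) ∧ ¬ (0 ≤ v.1 ∧ v.2 < 0) ∧ 0 < v.1 ∧ 0 ≤ v.2) ∨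
      (posv v ∧ ¬ posv (-v.2, v.1) ∧ ¬ (0 ≤ v.1 ∧ v.2 < 0) ∧ v.1 ≤ 0 ∧ 0 < v.2) ∨
      (¬ posv v ∧ ¬ posv (-v.2, v.1) ∧ ¬ (0 ≤ v.1 ∧ v.2 < 0) ∧ v.1 < 0 ∧ v.2 ≤ 0) ∨
      (¬ posv v ∧ posv (-v.2, v.1) ∧ (0 ≤ v.1 ∧ v.2 < 0) ∧ 0 ≤ v.1 ∧ v.2 < 0) := by
    intro v hv
    simp only [posv]
    rcases quadrant v hv with h | h | h | h <;> grind
  have hc := crs_actv (wt (-1)) w v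
  rw [hS, hS] at hc
  simp only [angI, angLt, hS, hc]
  rcases key v hv with ⟨a1, a2, a3, a4, a5⟩ | ⟨a1, a2, a3, a4, a5⟩ | ⟨a1, a2, a3, a4, a5⟩ |
    ⟨a1, a2, a3, a4, a5⟩ <;>
  rcases key w hw with ⟨b1, b2, b3, b4, b5⟩ | ⟨b1, b2, b3, b4, b5⟩ | ⟨b1, b2, b3, b4, b5⟩ |
    ⟨b1, b2, b3, b4, b5⟩ <;>
  simp only [a1, a2, a3, b1, b2, b3, crs, true_and, not_true, not_false_eq_true, false_and,
    and_false, or_false, false_or, and_true, if_true, if_false, iff_true,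
    iff_false] <;>
  first
  | omega
  | (split_ifs with h <;> first | omega | (exfalso; nlinarith))

lemma cutGroup_eq : cutGroup = ⊤ := by
  have : Fact (Nat.Prime 2) := ⟨Nat.prime_two⟩
  rw [eq_top_iff, ← le_GT_insert_cop 2]
  refine GT_le_of_gen ?_ (fun a _ => xU_mem_cut a) (fun a _ => ?_)
  · rintro q (rfl | h)
    exacts [Nat.prime_two, h.1]
  · have := wt_conj_xU (-1) (-a)
    rw [show xL a = xL (-(-a / ((-1 : ℚˣ) : ℚ) ^ 2)) by simp, ← this]
    exact mul_mem (mul_mem rot_mem_cut (xU_mem_cut _)) (inv_mem rot_mem_cut)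

/-- The first column. -/
def colv (g : S2) : ℚ × ℚ := (g 0 0, g 1 0)

lemma colv_mul (g h : S2) : colv (g * h) = actv g (colv h) := by simp [colv, actv]

lemma colv_ne (g : S2) : colv g ≠ 0 := by
  intro h
  have := det_eq g
  rw [show g 0 0 = 0 from congrArg Prod.fst h, show g 1 0 = 0 from congrArg Prod.snd h] at this
  simp at this

/-- The winding number cocycle. -/
def Wc (g h : S2) : ℤ := angI (colv (g * h)) (colv g)

lemma angI_one (v : ℚ × ℚ) : angI v (1, 0) = 0 := by
  have h1 : posv (1, 0) := Or.inr ⟨rfl, one_pos⟩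
  have : ¬ angLt v (1, 0) := by
    simp only [angLt, h1, not_true, and_false, iff_true, false_or, crs, mul_zero, mul_one, zero_sub]
    rintro ⟨h | h, h'⟩
    · linarith
    · linarith [h.1]
  simp [angI, this]

lemma Wc_coc (H : Subgroup S2) : IsCoc H Wc := by
  intro g _ h _ k _
  have hg : g ∈ cutGroup := by rw [cutGroup_eq]; trivial
  obtain ⟨n, hn⟩ := hg
  have h1 : colv (1 : S2) = (1, 0) := by simp [colv]
  have e : ∀ w, w ≠ 0 → angI (actv g w) (colv g) = n w - n (1, 0) := by
    intro w hw
    have := hn (1, 0) w (by simp) hw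
    rw [angI_one, zero_add] at this
    rw [← this, ← h1, ← colv_mul, mul_one]
  simp only [Wc, colv_mul g]
  rw [mul_assoc, colv_mul g, e _ (colv_ne _), e _ (colv_ne _), hn _ _ (colv_ne _) (colv_ne _)]
  ring

/-! ### Characters of the congruence subgroup -/

section csp
variable (p : ℕ) [hp : Fact p.Prime] {T : Set ℕ} {Q : Type*} [AddCommGroup Q]

/-- Additive characters on `Gam p T`. -/
def AddOn (H : Subgroup S2) (f : S2 → Q) : Prop := ∀ g ∈ H, ∀ h ∈ H, f (g * h) = f g + f h

namespace AddOn
variable {H : Subgroup S2} {f : S2 → Q} (hf : AddOn H f)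
include hf

lemma one : f 1 = 0 := by
  have := hf 1 H.one_mem 1 H.one_mem
  simpa using this

lemma inv {g : S2} (hg : g ∈ H) : f g⁻¹ = -f g := by
  have := hf g hg g⁻¹ (H.inv_mem hg)
  rw [mul_inv_cancel, hf.one] at this
  exact (neg_eq_of_add_eq_zero_right this.symm).symm

lemma conj {g h : S2} (hg : g ∈ H) (hh : h ∈ H) : f (g * h * g⁻¹) = f h := by
  rw [hf _ (mul_mem hg hh) _ (inv_mem hg), hf _ hg _ hh, hf.inv hg]
  abel

end AddOn

/-- `(a, c)` is a first column of an element of `Gam p T`. -/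
def Col (T : Set ℕ) (a c : ℚ) : Prop := ∃ g ∈ Gam p T, g 0 0 = a ∧ g 1 0 = c

open Classical in
/-- The value of `f` on a matrix with first column `(a, c)`. -/
def bet (T : Set ℕ) (f : S2 → Q) (a c : ℚ) : Q := if h : Col p T a c then f h.choose else 0

lemma mem_Gam_xU {t : ℚ} (ht : t ∈ ZS T) : xU t ∈ Gam p T :=
  mem_Gam.2 ⟨xU_mem ht, by simp⟩

lemma mem_Gam_xL {t : ℚ} (ht : t ∈ ZS T) : xL (p * t) ∈ Gam p T :=
  mem_Gam.2 ⟨xL_mem (mul_mem (natCast_mem _ _) ht), by simpa [p_ne p] using ht⟩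

lemma mem_Gam_dg2 (hT : Good T) : dg u2 ∈ Gam p T :=
  mem_Gam.2 ⟨hT.dg2, by simp⟩

lemma mem_Gam_neg {g : S2} (h : g ∈ Gam p T) : -g ∈ Gam p T := by
  rw [mem_Gam] at h ⊢
  exact ⟨neg_mem_GT h.1, by rw [neg_e, neg_div]; exact neg_mem h.2⟩

variable {p} {f : S2 → Q} (hT : Good T) (hf : AddOn (Gam p T) f)
include hT hf

lemma f_xU {t : ℚ} (ht : t ∈ ZS T) : f (xU t) = 0 := by
  have h2 := mem_Gam_dg2 p hT
  have h3 := mem_Gam_xU p (hT.div3 ht)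
  have : xU t = dg u2 * xU (t / 3) * (dg u2)⁻¹ * (xU (t / 3))⁻¹ := by
    rw [dg_conj_xU, ← xU_neg, ← xU_add]; congr 1; simp; ring
  rw [this, hf _ (mul_mem (mul_mem h2 h3) (inv_mem h2)) _ (inv_mem h3), hf.conj h2 h3, hf.inv h3]
  abel

lemma f_xL {t : ℚ} (ht : t ∈ ZS T) : f (xL (p * t)) = 0 := by
  have h2 := inv_mem (mem_Gam_dg2 p hT)
  have h3 := mem_Gam_xL p (hT.div3 ht)
  have : xL (p * t) = (dg u2)⁻¹ * xL (p * (t / 3)) * ((dg u2)⁻¹)⁻¹ * (xL (p * (t / 3)))⁻¹ := by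
    rw [← dg_inv, dg_conj_xL, ← xL_neg, ← xL_add]; congr 1; simp; ring
  rw [this, hf _ (mul_mem (mul_mem h2 h3) (inv_mem h2)) _ (inv_mem h3), hf.conj h2 h3, hf.inv h3]
  abel

lemma bet_eq {g : S2} (hg : g ∈ Gam p T) : bet p T f (g 0 0) (g 1 0) = f g := by
  have hc : Col p T (g 0 0) (g 1 0) := ⟨g, hg, rfl, rfl⟩
  simp only [bet, hc, dite_true]
  obtain ⟨h1, h2, h3⟩ := hc.choose_spec
  set h := hc.choose
  have e : h = g * xU (g 1 1 * h 0 1 - g 0 1 * h 1 1) := by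
    have d1 := det_eq g
    have d2 := det_eq h
    rw [h2, h3] at d2
    apply S2_ext
    · simp [h2]
    · simp only [mul_01, xU_01, xU_11]
      linear_combination (-h 0 1) * d1 + g 0 1 * d2
    · simp [h3]
    · simp only [mul_11, xU_01, xU_11]
      linear_combination (-h 1 1) * d1 + g 1 1 * d2
  have ht : g 1 1 * h 0 1 - g 0 1 * h 1 1 ∈ ZS T :=
    sub_mem (mul_mem hg.1.2.2.2 h1.1.2.1) (mul_mem hg.1.2.1 h1.1.2.2.2)
  rw [e, hf g hg _ (mem_Gam_xU p ht), f_xU hT hf ht, add_zero]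

omit hT hf in
lemma bet_of_not {a c : ℚ} (h : ¬ Col p T a c) : bet p T f a c = 0 := by simp [bet, h]

omit hT hf in
lemma Col.smul {a c : ℚ} (h : Col p T a c) {g : S2} (hg : g ∈ Gam p T) :
    Col p T (g 0 0 * a + g 0 1 * c) (g 1 0 * a + g 1 1 * c) := by
  obtain ⟨k, hk, rfl, rfl⟩ := h
  exact ⟨g * k, mul_mem hg hk, by simp, by simp⟩

lemma bet_mul {g : S2} (hg : g ∈ Gam p T) {a c : ℚ} (h : Col p T a c) :
    bet p T f (g 0 0 * a + g 0 1 * c) (g 1 0 * a + g 1 1 * c) = f g + bet p T f a c := by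
  obtain ⟨k, hk, rfl, rfl⟩ := h
  have := bet_eq hT hf (mul_mem hg hk)
  rw [mul_00, mul_10] at this
  rw [this, bet_eq hT hf hk, hf g hg k hk]

lemma bet_smul {g : S2} (hg : g ∈ Gam p T) (h0 : f g = 0) (a c : ℚ) :
    bet p T f (g 0 0 * a + g 0 1 * c) (g 1 0 * a + g 1 1 * c) = bet p T f a c := by
  by_cases h : Col p T a c
  · rw [bet_mul hT hf hg h, h0, zero_add]
  · rw [bet_of_not h, bet_of_not]
    intro h'
    apply h
    have := h'.smul (inv_mem hg)
    have d := det_eq g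
    convert this using 1
    · simp only [inv_00, inv_01]; linear_combination (-a) * d
    · simp only [inv_10, inv_11]; linear_combination (-c) * d

lemma bet_add_left {t : ℚ} (ht : t ∈ ZS T) (a c : ℚ) : bet p T f (a + t * c) c = bet p T f a c := by
  have := bet_smul hT hf (mem_Gam_xU p ht) (f_xU hT hf ht) a c
  simpa using this

lemma bet_add_right {t : ℚ} (ht : t ∈ ZS T) (a c : ℚ) :
    bet p T f a (c + p * t * a) = bet p T f a c := by
  have := bet_smul hT hf (mem_Gam_xL p ht) (f_xL hT hf ht) a c
  simpa [add_comm] using this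

lemma bet_congr_left {a a' c : ℚ} (h : ∃ t ∈ ZS T, a = a' + t * c) :
    bet p T f a c = bet p T f a' c := by
  obtain ⟨t, ht, rfl⟩ := h
  exact bet_add_left hT hf ht a' c

lemma bet_congr_right {a c c' : ℚ} (h : ∃ t ∈ ZS T, c = c' + p * t * a) :
    bet p T f a c = bet p T f a c' := by
  obtain ⟨t, ht, rfl⟩ := h
  exact bet_add_right hT hf ht a c'

lemma bet_four (a c : ℚ) : bet p T f a (4 * c) = bet p T f a c := by
  have h2 := mem_Gam_dg2 p hT
  by_cases h : Col p T a (4 * c)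
  · obtain ⟨g, hg, rfl, hc⟩ := h
    have := bet_eq hT hf (mul_mem (mul_mem h2 hg) (inv_mem h2))
    rw [hf.conj h2 hg, ← bet_eq hT hf hg, hc] at this
    rw [← this]
    congr 1
    · simp; ring
    · simp [hc]; ring
  · rw [bet_of_not h, bet_of_not]
    rintro ⟨g, hg, rfl, rfl⟩
    exact h ⟨(dg u2)⁻¹ * g * dg u2, mul_mem (mul_mem (inv_mem h2) hg) h2, by simp; ring, by simp; ring⟩

lemma bet_four_pow (n : ℕ) (a c : ℚ) : bet p T f a (4 ^ n * c) = bet p T f a c := by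
  induction n with
  | zero => simp
  | succ n ih => rw [pow_succ', mul_assoc, bet_four hT hf, ih]

lemma bet_neg {a c : ℚ} (h : Col p T a c) :
    bet p T f (-a) (-c) = f (-1) + bet p T f a c := by
  have := bet_mul hT hf (mem_Gam_neg p (one_mem _)) h
  simpa using this

lemma bet_one {t : ℚ} (ht : t ∈ ZS T) : bet p T f 1 (p * t) = 0 := by
  have := bet_eq hT hf (mem_Gam_xL p ht)
  rw [f_xL hT hf ht] at this
  simpa using this

omit hT hf in
lemma col_of {a b c d : ℚ} (ha : a ∈ ZS T) (hb : b ∈ ZS T) (hc : c ∈ ZS T) (hd : d ∈ ZS T)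
    (h : a * d - b * (p * c) = 1) : Col p T a (p * c) :=
  ⟨mk a b (p * c) d h, mem_Gam.2 ⟨⟨ha, hb, mul_mem (natCast_mem _ _) hc, hd⟩,
    by simpa [p_ne p] using hc⟩, rfl, rfl⟩

omit hT hf in
lemma col_int {a c : ℤ} (h : IsCoprime a (p * c)) : Col p T a ((p * c : ℤ) : ℚ) := by
  obtain ⟨u, v, huv⟩ := h
  have := col_of (p := p) (T := T) (a := a) (b := -v) (c := c) (d := u) (intCast_mem _ _)
    (neg_mem (intCast_mem _ _)) (intCast_mem _ _) (intCast_mem _ _) (by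
      have : ((u * a + v * (p * c) : ℤ) : ℚ) = 1 := by rw [huv]; simp
      push_cast at this
      linear_combination this)
  push_cast
  exact this

end csp

section csp
variable {p : ℕ} [hp : Fact p.Prime] {T : Set ℕ} {Q : Type*} [AddCommGroup Q]

lemma exists_prime_zmodEq {a c : ℤ} (hc : c ≠ 0) (h : IsCoprime a c) (n : ℕ) :
    ∃ l : ℕ, n < l ∧ l.Prime ∧ c ∣ l - a := by
  obtain ⟨l, h1, h2, h3⟩ := Nat.forall_exists_prime_gt_and_zmodEq n (q := c.natAbs) (a := a)
    (by simpa using hc) (by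
      rcases Int.natAbs_eq c with e | e
      · rwa [← e]
      · rw [e] at h; simpa using h.neg_right)
  refine ⟨l, h1, h2, ?_⟩
  have := h3.symm.dvd
  exact Int.natAbs_dvd.1 this

lemma exists_prime_zmodEq₂ {a c b d : ℤ} (hc : c ≠ 0) (hd : d ≠ 0) (h : IsCoprime a c)
    (h' : IsCoprime b d) (hcd : IsCoprime c d) (n : ℕ) :
    ∃ l : ℕ, n < l ∧ l.Prime ∧ c ∣ l - a ∧ d ∣ l - b := by
  obtain ⟨u, v, huv⟩ := hcd
  have e1 : b * (u * c) + a * (v * d) = a + c * (u * (b - a)) := by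
    linear_combination a * huv
  have e2 : b * (u * c) + a * (v * d) = b + d * (v * (a - b)) := by
    linear_combination b * huv
  obtain ⟨l, h1, h2, h3⟩ := exists_prime_zmodEq (a := b * (u * c) + a * (v * d)) (mul_ne_zero hc hd)
    (IsCoprime.mul_right (by rw [e1]; exact h.add_mul_left_left _)
      (by rw [e2]; exact h'.add_mul_left_left _)) n
  refine ⟨l, h1, h2, ?_, ?_⟩
  · have := (dvd_mul_right c d).trans h3
    rw [e1] at this
    have := dvd_add this (dvd_mul_right c (u * (b - a)))
    have e : (l : ℤ) - a = l - (a + c * (u * (b - a))) + c * (u * (b - a)) := by ring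
    rwa [e]
  · have := (dvd_mul_left d c).trans h3
    rw [e2] at this
    have := dvd_add this (dvd_mul_right d (v * (a - b)))
    have e : (l : ℤ) - b = l - (b + d * (v * (a - b))) + d * (v * (a - b)) := by ring
    rwa [e]

lemma eq_of_coprime_periods {α : Type*} {q : ℕ → α} {L M : ℕ} (h : Nat.Coprime L M) (h1 : 1 < M)
    (hL : ∀ j, q (j + L) = q j) (hM : ∀ j, q (j + M) = q j) : q 0 = q 1 := by
  have hL' : ∀ n j, q (j + n * L) = q j := by
    intro n; induction n with
    | zero => simp
    | succ n ih => intro j; rw [Nat.succ_mul, ← add_assoc, hL, ih]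
  have hM' : ∀ n j, q (j + n * M) = q j := by
    intro n; induction n with
    | zero => simp
    | succ n ih => intro j; rw [Nat.succ_mul, ← add_assoc, hM, ih]
  obtain ⟨x, -, hx⟩ := Nat.exists_mul_mod_eq_one_of_coprime h h1
  have := Nat.mod_add_div (L * x) M
  rw [hx] at this
  rw [← hL' x 0, ← hM' (L * x / M) 1, mul_comm (L * x / M), this, zero_add, mul_comm]

lemma dvd_four_pow_sub_one {l : ℕ} (hl : l.Prime) (h2 : 2 < l) :
    (l : ℤ) ∣ 4 ^ ((l - 1) / 2) - 1 := by
  have := Fact.mk hl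
  rw [← ZMod.intCast_zmod_eq_zero_iff_dvd]
  push_cast
  have h4 : (4 : ZMod l) = 2 ^ 2 := by norm_num
  have hodd : l - 1 = 2 * ((l - 1) / 2) := by
    have := hl.eq_two_or_odd; omega
  rw [h4, ← pow_mul, ← hodd, ZMod.pow_card_sub_one_eq_one, sub_self]
  intro h
  have : ((2 : ℕ) : ZMod l) = 0 := by exact_mod_cast h
  rw [ZMod.natCast_eq_zero_iff] at this
  exact absurd (Nat.le_of_dvd two_pos this) (by omega)

variable {f : S2 → Q} (hT : Good T) (hf : AddOn (Gam p T) f)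
include hT hf

lemma bet_conj_move {m k : ℤ} (hm : m ≠ 0) (hpm : (p : ℤ) ∣ m) (hk : k = 1 ∨ k = 4) (s a c : ℤ) :
    bet p T f (a + (c + m ^ 2 * s * a) * (k / (3 * m))) (c + m ^ 2 * s * a) =
      bet p T f (a + c * (k / (3 * m))) c := by
  obtain ⟨n, rfl⟩ := hpm
  have hn : (n : ℚ) ≠ 0 := by rintro h; apply hm; rw [Int.cast_eq_zero.1 h]; simp
  have hp0 := p_ne p
  have hk0 : (k : ℚ) ≠ 0 := by rcases hk with rfl | rfl <;> norm_num
  have hki : (k : ℚ)⁻¹ ∈ ZS T := by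
    rcases hk with rfl | rfl
    · simp [one_mem]
    · have := mul_mem hT.half hT.half
      norm_num at this ⊢; exact this
  set V : S2 := xU (k / (3 * (p * n))) * xL (p ^ 2 * n ^ 2 * s) * xU (-(k / (3 * (p * n)))) with hV
  have h3 := hT.third
  have iz : ∀ z : ℤ, (z : ℚ) ∈ ZS T := fun z => intCast_mem _ _
  have e00 : V 0 0 = 1 + k * p * n * s / 3 := by simp [hV]; field_simp
  have e01 : V 0 1 = -(k ^ 2 * s / 9) := by simp [hV]; field_simp; ring
  have e10 : V 1 0 = p ^ 2 * n ^ 2 * s := by simp [hV]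
  have e11 : V 1 1 = 1 - k * p * n * s / 3 := by simp [hV]; field_simp; ring
  have m0 : (k * p * n * s / 3 : ℚ) ∈ ZS T := hT.div3 (by exact_mod_cast iz (k * p * n * s))
  have m1 : (k ^ 2 * s / 9 : ℚ) ∈ ZS T := by
    have := hT.div3 (hT.div3 (iz (k ^ 2 * s)))
    push_cast at this
    convert this using 1; ring
  have hVm : V ∈ Gam p T := by
    rw [mem_Gam, mem_GT, e00, e01, e10, e11]
    refine ⟨⟨add_mem (one_mem _) m0, neg_mem m1, by convert iz ((p : ℤ) ^ 2 * n ^ 2 * s) using 1; push_cast; ring,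
      sub_mem (one_mem _) m0⟩, ?_⟩
    have : (p ^ 2 * n ^ 2 * s / p : ℚ) = (((p : ℤ) * n ^ 2 * s : ℤ) : ℚ) := by push_cast; field_simp
    rw [this]; exact iz _
  have fV : f V = 0 := by
    rw [← bet_eq hT hf hVm, e00, e10]
    have t1 : (-(3 * (n : ℚ) * (k : ℚ)⁻¹)) ∈ ZS T :=
      neg_mem (mul_mem (by exact_mod_cast iz (3 * n)) hki)
    rw [bet_congr_right hT hf (c' := p * (-(3 * (n : ℚ) * (k : ℚ)⁻¹)))
        ⟨3 * (n : ℚ) * (k : ℚ)⁻¹, by simpa using neg_mem t1, by field_simp; ring⟩,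
      bet_congr_left hT hf (a' := 1) ⟨-(k ^ 2 * s / 9), neg_mem m1, by field_simp; ring⟩,
      bet_one hT hf t1]
  have := bet_smul hT hf hVm fV (a + c * (k / (3 * (p * n)))) c
  rw [e00, e01, e10, e11] at this
  push_cast
  rw [← this]
  congr 1
  · field_simp; ring
  · field_simp; ring

lemma bet_scale_aux {m : ℤ} (hm : m ≠ 0) (h6 : IsCoprime m 6) (hpm : (p : ℤ) ∣ m) {a c : ℤ}
    (hc : m ^ 2 ∣ c) (ha : IsCoprime (a - 1) m) (hac : IsCoprime a c) :
    bet p T f (a + c * (1 / (3 * m))) c = bet p T f (a + c * (4 / (3 * m))) c := by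
  have iz : ∀ z : ℤ, (z : ℚ) ∈ ZS T := fun z => intCast_mem _ _
  rcases eq_or_ne c 0 with rfl | hc0
  · simp
  -- replace `a` by a prime
  obtain ⟨l, l3, hl, n, hn⟩ := exists_prime_zmodEq hc0 hac 3
  have hl3 : (3 : ℤ) < l := by exact_mod_cast l3
  have hA : ∀ y : ℚ, bet p T f (a + c * y) c = bet p T f (l + c * y) c := fun y =>
    bet_congr_left hT hf ⟨-n, neg_mem (iz n), by
      have : ((l : ℤ) : ℚ) - a = c * n := by exact_mod_cast hn
      push_cast at this ⊢; linear_combination -this⟩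
  rw [hA, hA]
  have hlc : IsCoprime (l : ℤ) c := by
    have : (l : ℤ) = a + c * n := by linear_combination hn
    rw [this]; exact hac.add_mul_left_left _
  have hlm : IsCoprime ((l : ℤ) - 1) m := by
    obtain ⟨k, rfl⟩ := hc
    have : (l : ℤ) - 1 = (a - 1) + m * (m * k * n) := by linear_combination hn
    rw [this]; exact ha.add_mul_left_left _
  clear hA hn n hac ha a
  have hl6 : IsCoprime (l : ℤ) 6 := by
    have h : Nat.Coprime l 6 := by
      rw [Nat.Prime.coprime_iff_not_dvd hl]
      intro h
      have : l ≤ 6 := Nat.le_of_dvd (by norm_num) h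
      interval_cases l <;> revert hl h <;> decide
    exact_mod_cast Nat.isCoprime_iff_coprime.2 h
  -- make `c ≡ 1` modulo `6 * (l - 1)`
  have hl1 : IsCoprime (l : ℤ) (l - 1) := ⟨1, -1, by ring⟩
  have hcop : IsCoprime (m ^ 2 * l) (6 * (l - 1)) :=
    IsCoprime.mul_left (IsCoprime.pow_left (h6.mul_right hlm.symm)) (hl6.mul_right hl1)
  obtain ⟨u, v, huv⟩ := hcop
  set c₁ : ℤ := c + m ^ 2 * ((1 - c) * u) * l with hc₁
  have hc1 : c₁ = 1 + 6 * (l - 1) * (-(v * (1 - c))) := by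
    rw [hc₁]; linear_combination (1 - c) * huv
  have hM1 := bet_conj_move hT hf hm hpm (Or.inl rfl) ((1 - c) * u) l c
  have hM4 := bet_conj_move hT hf hm hpm (Or.inr rfl) ((1 - c) * u) l c
  have hcq : (c : ℚ) + m ^ 2 * ((1 - c) * u) * l = c₁ := by rw [hc₁]; push_cast; ring
  push_cast at hM1 hM4
  rw [hcq] at hM1 hM4
  rw [← hM1, ← hM4]
  have hc1m : m ^ 2 ∣ c₁ := dvd_add hc ⟨(1 - c) * u * l, by ring⟩
  have hlc1 : IsCoprime (l : ℤ) c₁ := by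
    rw [hc₁]; exact (hlc.add_mul_right_right _)
  have hc10 : c₁ ≠ 0 := by
    intro h
    rw [h] at hc1
    have : (6 : ℤ) ∣ 1 := ⟨(l - 1) * (v * (1 - c)), by linear_combination -hc1⟩
    omega
  have hc14 : IsCoprime (4 : ℤ) c₁ := by
    have : IsCoprime (2 : ℤ) c₁ := ⟨3 * (l - 1) * (v * (1 - c)), 1, by rw [hc1]; ring⟩
    exact (this.pow_left (m := 2))
  have hl1c : IsCoprime ((l : ℤ) - 1) c₁ := ⟨6 * (v * (1 - c)), 1, by rw [hc1]; ring⟩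
  clear_value c₁
  set q : ℕ → Q := fun j => bet p T f (l + 4 ^ j * c₁ * (1 / (3 * m))) (4 ^ j * c₁) with hq
  have hper : ∀ r : ℕ, r.Prime → 2 < r → c₁ ∣ r - l → ∀ j, q (j + (r - 1) / 2) = q j := by
    intro r hr r2 ⟨n, hn⟩ j
    have hn' : (r : ℚ) = l + c₁ * n := by
      have : ((r : ℤ) : ℚ) - l = c₁ * n := by exact_mod_cast hn
      push_cast at this; linear_combination this
    have hA : ∀ i, q i = bet p T f (r + 4 ^ i * c₁ * (1 / (3 * m))) (4 ^ i * c₁) := fun i => by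
      refine bet_congr_left hT hf ⟨-(n * ((2 : ℚ)⁻¹ ^ (2 * i))),
        neg_mem (mul_mem (iz n) (pow_mem hT.half _)), ?_⟩
      have : ((2 : ℚ)⁻¹ ^ (2 * i)) * 4 ^ i = 1 := by rw [pow_mul, ← mul_pow]; norm_num
      rw [hn']; linear_combination (c₁ * n : ℚ) * this
    obtain ⟨d, hd⟩ := dvd_four_pow_sub_one hr r2
    obtain ⟨e, he⟩ := hc1m
    have := bet_conj_move hT hf hm hpm (Or.inl rfl) (4 ^ j * e * d) r (4 ^ j * c₁)
    rw [hA, hA]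
    have hd' : (4 : ℚ) ^ ((r - 1) / 2) = 1 + r * d := by
      have : ((4 : ℤ) : ℚ) ^ ((r - 1) / 2) - 1 = r * d := by exact_mod_cast hd
      push_cast at this; linear_combination this
    have he' : (c₁ : ℚ) = m ^ 2 * e := by exact_mod_cast he
    push_cast at this
    convert this using 2
    · rw [pow_add, hd', he']; ring
    · rw [pow_add, hd', he']; ring
  obtain ⟨r₁, h31, hr1, hrc1⟩ := exists_prime_zmodEq hc10 hlc1 3
  have ho1 := hr1.eq_two_or_odd
  obtain ⟨r₂, h32, hr2, hrc2, hrd2⟩ := exists_prime_zmodEq₂ (a := l) (b := -1) (c := c₁)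
    (d := 4 * ((r₁ - 1) / 2 : ℕ)) hc10 (by omega) hlc1 isCoprime_one_left.neg_left (by
      have : (((r₁ - 1) / 2 : ℕ) : ℤ) * 2 = r₁ - 1 := by omega
      have h2 : IsCoprime ((r₁ : ℤ) - 1) c₁ := by
        obtain ⟨n, hn⟩ := hrc1
        have : (r₁ : ℤ) - 1 = l - 1 + c₁ * n := by linear_combination hn
        rw [this]; exact hl1c.add_mul_left_left _
      rw [← this] at h2
      exact (hc14.mul_left h2.of_mul_left_left).symm) 5
  have ho2 := hr2.eq_two_or_odd
  have hcp : Nat.Coprime ((r₁ - 1) / 2) ((r₂ - 1) / 2) := by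
    obtain ⟨n, hn⟩ := hrd2
    rw [← Nat.isCoprime_iff_coprime]
    have : (((r₂ - 1) / 2 : ℕ) : ℤ) = -1 + (((r₁ - 1) / 2 : ℕ) : ℤ) * (2 * n) := by
      have : (((r₂ - 1) / 2 : ℕ) : ℤ) * 2 = r₂ - 1 := by omega
      linarith
    rw [this]
    exact (isCoprime_one_right.neg_right).add_mul_left_right _
  have key := eq_of_coprime_periods hcp (by omega) (hper r₁ hr1 (by omega) hrc1)
    (hper r₂ hr2 (by omega) hrc2)
  simp only [hq, pow_zero, pow_one, one_mul] at key
  rw [bet_four hT hf] at key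
  rw [key]
  congr 1; ring

/-- Invariance of `bet` under conjugation by `xU (1 / m)`. -/
lemma bet_conj_inv {m : ℤ} (hm : m ≠ 0) (h6 : IsCoprime m 6) (hpm : (p : ℤ) ∣ m) {a c : ℤ}
    (hc : m ^ 2 ∣ c) (ha : m ∣ a - 1) (hac : IsCoprime a c) :
    bet p T f (a + c / m) c = bet p T f a c := by
  have iz : ∀ z : ℤ, (z : ℚ) ∈ ZS T := fun z => intCast_mem _ _
  obtain ⟨n, i, hni⟩ : IsCoprime m 3 := by
    have : (6 : ℤ) = 3 * 2 := by norm_num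
    rw [this] at h6; exact h6.of_mul_right_left
  obtain ⟨e, rfl⟩ := hc
  have hm2 : IsCoprime m 2 := by
    have : (6 : ℤ) = 3 * 2 := by norm_num
    rw [this] at h6; exact h6.of_mul_right_right
  have ham : IsCoprime a m := by
    obtain ⟨w, hw⟩ := ha
    exact ⟨1, -w, by linear_combination hw⟩
  have hae : IsCoprime a e := hac.of_mul_right_right
  have hm0 : (m : ℚ) ≠ 0 := by exact_mod_cast hm
  have := bet_scale_aux hT hf hm h6 hpm (a := -a + i * m * e) (c := -(m ^ 2 * e))
    ⟨-e, by ring⟩ (by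
      obtain ⟨w, hw⟩ := ha
      have : -a + i * m * e - 1 = -2 + m * (i * e - w) := by linear_combination -hw
      rw [this]; exact (hm2.symm.neg_left).add_mul_left_left _) (by
      refine IsCoprime.neg_right (IsCoprime.mul_right (IsCoprime.pow_right ?_) ?_)
      · have : -a + i * m * e = -a + m * (i * e) := by ring
        rw [this]; exact ham.neg_left.add_mul_left_left _
      · exact hae.neg_left.add_mul_right_left _)
  have hniq : (n : ℚ) * m + i * 3 = 1 := by exact_mod_cast hni
  have hpme : IsCoprime a (p * (m ^ 2 * e)) := by
    obtain ⟨w, rfl⟩ := hpm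
    exact IsCoprime.mul_right ham.of_mul_right_left hac
  obtain ⟨pm, hpm'⟩ := hpm
  have hcol : Col p T a ((m ^ 2 * e : ℤ) : ℚ) := by
    have := col_int (p := p) (T := T) (a := a) (c := pm * m * e) (by
      have : (p : ℤ) * (pm * m * e) = m ^ 2 * e := by rw [hpm']; ring
      rw [this]; exact hac)
    convert this using 2
    rw [hpm']; ring
  have hcol' : Col p T (a + m * e : ℚ) ((m ^ 2 * e : ℤ) : ℚ) := by
    have hac' : IsCoprime (a + m * e) (m ^ 2 * e) :=
      IsCoprime.mul_right (IsCoprime.pow_right (ham.add_mul_left_left _)) (hae.add_mul_right_left _)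
    have := col_int (p := p) (T := T) (a := a + m * e) (c := pm * m * e) (by
      have : (p : ℤ) * (pm * m * e) = m ^ 2 * e := by rw [hpm']; ring
      rw [this]; exact hac')
    convert this using 2
    · push_cast; rfl
    · rw [hpm']; ring
  have e1 := bet_neg hT hf hcol
  have e2 := bet_neg hT hf hcol'
  have t1 : ((n : ℚ) / 3) ∈ ZS T := hT.div3 (iz n)
  have s1 : ∀ x : ℚ, bet p T f (x - n * m ^ 2 * e / 3) (-((m ^ 2 * e : ℤ) : ℚ)) =
      bet p T f x (-((m ^ 2 * e : ℤ) : ℚ)) := fun x =>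
    bet_congr_left hT hf ⟨n / 3, t1, by push_cast; ring⟩
  have e3 : bet p T f (-(a : ℚ)) (-((m ^ 2 * e : ℤ) : ℚ)) =
      bet p T f (-((a : ℚ) + m * e)) (-((m ^ 2 * e : ℤ) : ℚ)) := by
    rw [← s1, ← s1 (-((a : ℚ) + m * e))]
    convert this using 2
    · push_cast; field_simp; linear_combination (-m * e) * hniq
    · push_cast; rfl
    · push_cast; field_simp; linear_combination (-m * e) * hniq
    · push_cast; rfl
  rw [e1, e2] at e3
  rw [add_left_cancel e3]
  congr 1
  push_cast; field_simp
end csp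

section csp
variable {p : ℕ} [hp : Fact p.Prime] {T : Set ℕ} {Q : Type*} [AddCommGroup Q]

/-- Integral matrices congruent to the identity modulo `M`. -/
def IntMod (M : ℤ) (g : S2) : Prop :=
  ∃ a b c d : ℤ, g 0 0 = 1 + M * a ∧ g 0 1 = M * b ∧ g 1 0 = M * c ∧ g 1 1 = 1 + M * d

lemma IntMod.conj_xL {M : ℤ} {g : S2} (h : IntMod M g) (t : ℤ) :
    IntMod M (xL t * g * xL (-t)) := by
  obtain ⟨a, b, c, d, h1, h2, h3, h4⟩ := h
  refine ⟨a - b * t, b, c + t * a - t * d - t ^ 2 * b, d + t * b, ?_, ?_, ?_, ?_⟩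
  · simp [h1, h2, h3, h4]; ring
  · simp [h1, h2, h3, h4]
  · simp [h1, h2, h3, h4]; ring
  · simp [h1, h2, h3, h4]; ring

lemma IntMod.conj_xU {m k : ℤ} (hm : m ≠ 0) {g : S2} (h : IntMod (m ^ 2 * k) g) :
    IntMod k (xU (1 / m) * g * xU (-(1 / m))) := by
  obtain ⟨a, b, c, d, h1, h2, h3, h4⟩ := h
  have hm0 : (m : ℚ) ≠ 0 := by exact_mod_cast hm
  refine ⟨m ^ 2 * a + m * c, m ^ 2 * b + m * (d - a) - c, m ^ 2 * c, m ^ 2 * d - m * c,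
    ?_, ?_, ?_, ?_⟩
  · simp [h1, h2, h3, h4]; field_simp; ring
  · simp [h1, h2, h3, h4]; field_simp; ring
  · simp [h1, h2, h3, h4]; ring
  · simp [h1, h2, h3, h4]; field_simp; ring

lemma IntMod.mem_Gam {M : ℤ} {g : S2} (h : IntMod M g) (hM : (p : ℤ) ∣ M) : g ∈ Gam p T := by
  obtain ⟨a, b, c, d, h1, h2, h3, h4⟩ := h
  obtain ⟨n, rfl⟩ := hM
  have iz : ∀ z : ℤ, (z : ℚ) ∈ ZS T := fun z => intCast_mem _ _
  have hp0 := p_ne p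
  rw [SL2H.mem_Gam, mem_GT, h1, h2, h3, h4]
  refine ⟨⟨?_, ?_, ?_, ?_⟩, ?_⟩
  · exact_mod_cast iz (1 + p * n * a)
  · exact_mod_cast iz (p * n * b)
  · exact_mod_cast iz (p * n * c)
  · exact_mod_cast iz (1 + p * n * d)
  · convert iz (n * c) using 1
    push_cast; field_simp

variable {f : S2 → Q} (hT : Good T) (hf : AddOn (Gam p T) f)
include hT hf

lemma f_conj_xU {m k : ℤ} (hm : m ≠ 0) (h6 : IsCoprime m 6) (hpm : (p : ℤ) ∣ m) {g : S2}
    (h : IntMod (m ^ 2 * k) g) : f (xU (1 / m) * g * xU (-(1 / m))) = f g := by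
  have hg : g ∈ Gam p T := h.mem_Gam (hpm.trans ⟨m * k, by ring⟩)
  have hm0 : (m : ℚ) ≠ 0 := by exact_mod_cast hm
  have h' : xU (1 / m) * g * xU (-(1 / m)) ∈ Gam p T := by
    obtain ⟨a, b, c, d, h1, h2, h3, h4⟩ := h.conj_xU hm
    have iz : ∀ z : ℤ, (z : ℚ) ∈ ZS T := fun z => intCast_mem _ _
    rw [SL2H.mem_Gam, mem_GT]
    refine ⟨⟨?_, ?_, ?_, ?_⟩, ?_⟩
    · rw [h1]; exact_mod_cast iz (1 + k * a)
    · rw [h2]; exact_mod_cast iz (k * b)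
    · rw [h3]; exact_mod_cast iz (k * c)
    · rw [h4]; exact_mod_cast iz (1 + k * d)
    · have : (xU (1 / m) * g * xU (-(1 / m))) 1 0 = g 1 0 := by simp
      rw [this]; exact (SL2H.mem_Gam.1 hg).2
  rw [← bet_eq hT hf h', ← bet_eq hT hf hg]
  obtain ⟨a, b, c, d, h1, h2, h3, h4⟩ := h
  have hd := det_eq g
  rw [h1, h2, h3, h4] at hd
  have hd' : (1 + m ^ 2 * k * a) * (1 + m ^ 2 * k * d) - m ^ 2 * k * b * (m ^ 2 * k * c) = 1 := by
    exact_mod_cast hd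
  have := bet_conj_inv hT hf hm h6 hpm (a := 1 + m ^ 2 * k * a) (c := m ^ 2 * k * c)
    ⟨k * c, by ring⟩ ⟨m * k * a, by ring⟩
    ⟨1 + m ^ 2 * k * d, -(m ^ 2 * k * b), by linear_combination hd'⟩
  push_cast at this h1 h3
  rw [h1, h3, ← this]
  congr 1
  · simp [h1, h3]; ring
  · simp [h3]

lemma f_conj_dg (u : ℚˣ) {e : ℤ} (hu : (u : ℚ) = e) (h6 : IsCoprime e 6) {g : S2}
    (hp6 : IsCoprime (p : ℤ) 6) (h : IntMod (p ^ 4 * e ^ 2) g) : f (dg u * g * (dg u)⁻¹) = f g := by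
  have he : e ≠ 0 := by rintro rfl; simp at hu
  have he0 : (e : ℚ) ≠ 0 := by exact_mod_cast he
  have hpz : (p : ℤ) ≠ 0 := by exact_mod_cast hp.out.ne_zero
  have hp0 := p_ne p
  set g₁ := xL ((-((e - 1) * e * p) : ℤ) : ℚ) * g * xL (-((-((e - 1) * e * p) : ℤ) : ℚ)) with hg₁
  have i₁ : IntMod (p ^ 4 * e ^ 2) g₁ := h.conj_xL _
  have e₁ : f g₁ = f g := by
    have hx : xL ((-((e - 1) * e * p) : ℤ) : ℚ) ∈ Gam p T := by
      have := mem_Gam_xL p (T := T) (t := ((-((e - 1) * e) : ℤ) : ℚ)) (intCast_mem _ _)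
      convert this using 2; push_cast; ring
    rw [hg₁, xL_neg, hf.conj hx (h.mem_Gam ⟨p ^ 3 * e ^ 2, by ring⟩)]
  set g₂ := xU (1 / ((-(p * e) : ℤ) : ℚ)) * g₁ * xU (-(1 / ((-(p * e) : ℤ) : ℚ))) with hg₂
  have i₁' : IntMod ((-(p * e)) ^ 2 * p ^ 2) g₁ := by convert i₁ using 1; ring
  have hpe : -((p : ℤ) * e) ≠ 0 := neg_ne_zero.2 (mul_ne_zero hpz he)
  have i₂ : IntMod (p ^ 2) g₂ := i₁'.conj_xU hpe
  have e₂ : f g₂ = f g₁ := f_conj_xU hT hf hpe (hp6.mul_left h6).neg_left ⟨-e, by ring⟩ i₁'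
  set g₃ := xL (((e - 1) * p : ℤ) : ℚ) * g₂ * xL (-(((e - 1) * p : ℤ) : ℚ)) with hg₃
  have i₃ : IntMod (p ^ 2) g₃ := i₂.conj_xL _
  have e₃ : f g₃ = f g₂ := by
    have hx : xL (((e - 1) * p : ℤ) : ℚ) ∈ Gam p T := by
      have := mem_Gam_xL p (T := T) (t := (((e - 1)) : ℤ)) (intCast_mem _ _)
      convert this using 2; push_cast; ring
    rw [hg₃, xL_neg, hf.conj hx (i₂.mem_Gam ⟨p, by ring⟩)]
  have i₃' : IntMod ((p : ℤ) ^ 2 * 1) g₃ := by simpa using i₃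
  have e₄ := f_conj_xU hT hf hpz hp6 dvd_rfl i₃'
  rw [← e₁, ← e₂, ← e₃, ← e₄]
  congr 1
  have hh : dg u = xU (1 / ((p : ℤ) : ℚ)) * xL (((e - 1) * p : ℤ) : ℚ) *
      xU (1 / ((-(p * e) : ℤ) : ℚ)) * xL ((-((e - 1) * e * p) : ℤ) : ℚ) := by
    apply S2_ext <;> simp [hu] <;> field_simp <;> ring
  rw [hh, hg₃, hg₂, hg₁]
  simp only [xU_neg, xL_neg]
  group

lemma bet_sq {e : ℤ} (h6 : IsCoprime e 6) (hp6 : IsCoprime (p : ℤ) 6) {a c : ℤ}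
    (hc : (p : ℤ) ^ 4 ∣ c) (ha : (p : ℤ) ^ 4 * e ^ 2 ∣ a - 1) (hac : IsCoprime a c) :
    bet p T f a (e ^ 2 * c) = bet p T f a c := by
  have he : e ≠ 0 := by rintro rfl; exact absurd (isCoprime_zero_left.1 h6) (by decide)
  have he0 : (e : ℚ) ≠ 0 := by exact_mod_cast he
  obtain ⟨n, rfl⟩ := hc
  obtain ⟨w, hw⟩ := ha
  obtain rfl : a = 1 + p ^ 4 * e ^ 2 * w := by linear_combination hw
  have hae : IsCoprime (1 + p ^ 4 * e ^ 2 * w) e := ⟨1, -(p ^ 4 * e * w), by ring⟩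
  obtain ⟨d, b, hdb⟩ := IsCoprime.mul_right (IsCoprime.pow_right (n := 2) hae) hac
  set a := 1 + (p : ℤ) ^ 4 * e ^ 2 * w with hadef
  set c := e ^ 2 * ((p : ℤ) ^ 4 * n) with hcdef
  have hdet : (a : ℚ) * ((d + c * b : ℤ) : ℚ) - ((-(b - a * b) : ℤ) : ℚ) * (c : ℚ) = 1 := by
    have : a * (d + c * b) - (-(b - a * b)) * c = 1 := by linear_combination hdb
    exact_mod_cast this
  set g := mk (a : ℚ) ((-(b - a * b) : ℤ) : ℚ) (c : ℚ) ((d + c * b : ℤ) : ℚ) hdet with hg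
  have hgm : IntMod (p ^ 4 * e ^ 2) g := by
    refine ⟨w, b * w, n, -w * d - b * n + n * b, ?_, ?_, ?_, ?_⟩
    · simp [hg, hadef]
    · simp [hg, hadef]; ring
    · simp [hg, hcdef]; ring
    · simp only [hg, mk_11]
      have : d + c * b = 1 + p ^ 4 * e ^ 2 * (-w * d - b * n + n * b) := by
        linear_combination hdb
      exact_mod_cast this
  have hgG : g ∈ Gam p T := hgm.mem_Gam ⟨p ^ 3 * e ^ 2, by ring⟩
  have key := f_conj_dg hT hf (Units.mk0 (e : ℚ) he0) rfl h6 hp6 hgm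
  have hmem : dg (Units.mk0 (e : ℚ) he0) * g * (dg (Units.mk0 (e : ℚ) he0))⁻¹ ∈ Gam p T := by
    have iz : ∀ z : ℤ, (z : ℚ) ∈ ZS T := fun z => intCast_mem _ _
    rw [mem_Gam, mem_GT]
    refine ⟨⟨?_, ?_, ?_, ?_⟩, ?_⟩
    · convert iz a using 1; simp [hg]; field_simp
    · convert iz (e ^ 2 * (-(b - a * b))) using 1; simp [hg]; ring
    · convert iz (p ^ 4 * n) using 1; simp [hg, hcdef]; field_simp
    · convert iz (d + c * b) using 1; simp [hg]; field_simp
    · have := p_ne p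
      convert iz (p ^ 3 * n) using 1; simp [hg, hcdef]; field_simp
  rw [← bet_eq hT hf hmem, ← bet_eq hT hf hgG] at key
  have g0 : g 0 0 = (a : ℚ) := rfl
  have g1 : g 1 0 = (c : ℚ) := rfl
  have ec : (e : ℚ) ^ 2 * ((p ^ 4 * n : ℤ) : ℚ) = c := by rw [hcdef]; push_cast; ring
  rw [ec, ← g0, ← g1, ← key]
  congr 1
  · simp; field_simp
  · simp [g1, hcdef]; field_simp
end csp

section csp
variable {p : ℕ} [hp : Fact p.Prime] {T : Set ℕ} {Q : Type*} [AddCommGroup Q]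

lemma prime_coprime_six {l : ℕ} (hl : l.Prime) (h2 : l ≠ 2) (h3 : l ≠ 3) :
    IsCoprime (l : ℤ) 6 := by
  have h : Nat.Coprime l 6 := by
    rw [Nat.Prime.coprime_iff_not_dvd hl]
    intro h
    have : l ≤ 6 := Nat.le_of_dvd (by norm_num) h
    interval_cases l <;> revert hl h h2 h3 <;> decide
  exact_mod_cast Nat.isCoprime_iff_coprime.2 h

lemma Good.coprime_six (hT : Good T) (hpT : p ∉ T) : IsCoprime (p : ℤ) 6 :=
  prime_coprime_six hp.out (fun h => hpT (h ▸ hT.two)) (fun h => hpT (h ▸ hT.three))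

lemma isCoprime_two {a : ℤ} (h : IsCoprime a 6) : IsCoprime a 2 := by
  have : (6 : ℤ) = 3 * 2 := by norm_num
  rw [this] at h; exact h.of_mul_right_right

lemma dvd_four_pow_add_one {l : ℕ} (hl : l.Prime) (h5 : l % 8 = 5) :
    (l : ℤ) ∣ 4 ^ ((l - 1) / 4) + 1 := by
  have := Fact.mk hl
  rw [← ZMod.intCast_zmod_eq_zero_iff_dvd]
  push_cast
  have h20 : (2 : ZMod l) ≠ 0 := by
    intro h
    have : ((2 : ℕ) : ZMod l) = 0 := by exact_mod_cast h
    rw [ZMod.natCast_eq_zero_iff] at this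
    have := Nat.le_of_dvd two_pos this
    omega
  have hns : ¬ IsSquare (2 : ZMod l) := by
    rw [ZMod.exists_sq_eq_two_iff (by omega)]; omega
  rw [ZMod.euler_criterion l h20] at hns
  have h4 : (4 : ZMod l) = 2 ^ 2 := by norm_num
  have he : 2 * ((l - 1) / 4) = l / 2 := by omega
  rw [h4, ← pow_mul, he]
  rcases ZMod.pow_div_two_eq_neg_one_or_one l h20 with h | h
  · exact absurd h hns
  · rw [h]; ring

variable {f : S2 → Q} (hT : Good T) (hf : AddOn (Gam p T) f) (hpT : p ∉ T)
include hT hf hpT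

lemma bet_neg_right {l : ℕ} (hl : l.Prime) (h2 : l ≠ 2) {M : ℤ} (hM : IsCoprime M (l * p)) :
    bet p T f M (-(l * p)) = bet p T f M (l * p) := by
  have iz : ∀ z : ℤ, (z : ℚ) ∈ ZS T := fun z => intCast_mem _ _
  have hp2 := isCoprime_two (hT.coprime_six hpT)
  have hl2 : IsCoprime (l : ℤ) 2 := by
    exact_mod_cast Nat.isCoprime_iff_coprime.2 ((Nat.coprime_primes hl Nat.prime_two).2 h2)
  have hlp : (l : ℤ) * p ≠ 0 := by
    have := hl.ne_zero; have := hp.out.ne_zero; positivity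
  obtain ⟨r, -, hr, ⟨n, hn⟩, h8⟩ := exists_prime_zmodEq₂ (a := M) (b := 5) (c := l * p) (d := 8)
    hlp (by norm_num) hM (by norm_num) (by
      have := (hl2.mul_left hp2).pow_right (n := 3)
      simpa using this) 0
  have hrq : (r : ℚ) = M + l * p * n := by
    have : ((r : ℤ) : ℚ) - M = l * p * n := by exact_mod_cast hn
    push_cast at this; linear_combination this
  have h1 : bet p T f M (l * p) = bet p T f r (l * p) :=
    bet_congr_left hT hf ⟨-n, neg_mem (iz n), by rw [hrq]; ring⟩
  have h2 : bet p T f M (-(l * p)) = bet p T f r (-(l * p)) :=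
    bet_congr_left hT hf ⟨n, iz n, by rw [hrq]; ring⟩
  obtain ⟨d, hd⟩ := dvd_four_pow_add_one hr (by omega)
  have hd' : (4 : ℚ) ^ ((r - 1) / 4) = -1 + r * d := by
    have : ((4 : ℤ) : ℚ) ^ ((r - 1) / 4) + 1 = r * d := by exact_mod_cast hd
    push_cast at this; linear_combination this
  rw [h1, h2, ← bet_four_pow hT hf ((r - 1) / 4) _ (l * p : ℚ)]
  symm
  refine bet_congr_right hT hf ⟨d * l, mul_mem (iz d) (natCast_mem _ _), ?_⟩
  rw [hd']; ring

lemma bet_prime_sub_aux {l : ℕ} (hl : l.Prime) (h3 : 3 < l) {e : ℤ} (he6 : IsCoprime e 6)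
    {c M s : ℤ} (hs : s = 1 ∨ s = -1) (hlp : l ≠ p)
    (hc : IsCoprime (l : ℤ) c) (hc' : IsCoprime (l : ℤ) (c + s * e ^ 2)) (hM1 : (p : ℤ) ∣ M - 1)
    (hM : (l : ℤ) ∣ M * c - (c + s * e ^ 2)) :
    bet p T f l (p * (c + s * e ^ 2)) = bet p T f l (p * c) + bet p T f M (l * p) := by
  have iz : ∀ z : ℤ, (z : ℚ) ∈ ZS T := fun z => intCast_mem _ _
  have hlpc : IsCoprime (l : ℤ) p := by
    exact_mod_cast Nat.isCoprime_iff_coprime.2 ((Nat.coprime_primes hl hp.out).2 hlp)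
  obtain ⟨u, v, huv⟩ : IsCoprime (l : ℤ) (p ^ 4 * c) := (hlpc.pow_right).mul_right hc
  set M₀ : ℤ := 1 + p ^ 4 * e ^ 2 * (s * v) with hM₀
  -- the matrix with first column `(l, p * c)`
  have hdet : (l : ℚ) * (u : ℤ) - ((-(v * p ^ 3) : ℤ) : ℚ) * (p * (c : ℤ)) = 1 := by
    have : ((u * l + v * (p ^ 4 * c) : ℤ) : ℚ) = 1 := by rw [huv]; simp
    push_cast at this ⊢; linear_combination this
  set g := mk _ _ _ _ hdet with hg
  have hgG : g ∈ Gam p T := by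
    rw [mem_Gam, mem_GT]
    have := p_ne p
    refine ⟨⟨natCast_mem _ _, iz _, mul_mem (natCast_mem _ _) (iz _), iz _⟩, ?_⟩
    change (p * (c : ℚ)) / p ∈ _
    rw [mul_div_cancel_left₀ _ this]; exact iz c
  have hMl : (l : ℤ) ∣ M - M₀ := by
    have h1 : (M - M₀) * c = (M * c - (c + s * e ^ 2)) + l * (s * e ^ 2 * u) := by
      rw [hM₀]; linear_combination (-s * e ^ 2) * huv
    have h2 : (l : ℤ) ∣ (M - M₀) * c := by
      rw [h1]; exact dvd_add hM (dvd_mul_right _ _)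
    exact hc.dvd_of_dvd_mul_right h2
  have hM0l : IsCoprime M₀ l := by
    have h1 : M₀ * c = (c + s * e ^ 2) + l * (- (s * e ^ 2 * u)) := by
      rw [hM₀]; linear_combination (s * e ^ 2) * huv
    have h2 : IsCoprime (M₀ * c) l := by
      rw [h1]; exact hc'.symm.add_mul_left_left _
    exact h2.of_mul_left_left
  have hM0p : IsCoprime M₀ p := ⟨1, -(p ^ 3 * e ^ 2 * (s * v)), by rw [hM₀]; ring⟩
  have hM0e : IsCoprime M₀ e := ⟨1, -(p ^ 4 * e * (s * v)), by rw [hM₀]; ring⟩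
  have hM0s : IsCoprime M₀ s := by
    rcases hs with h | h
    · rw [h]; exact isCoprime_one_right
    · rw [h]; exact isCoprime_one_right.neg_right
  have hcol : Col p T M₀ ((p * (s * l * e ^ 2) : ℤ) : ℚ) :=
    col_int (hM0p.mul_right ((hM0s.mul_right hM0l).mul_right hM0e.pow_right))
  have hmul := bet_mul hT hf hgG hcol
  rw [← bet_eq hT hf hgG] at hmul
  have e1 : bet p T f l (p * (c + s * e ^ 2)) =
      bet p T f l (p * c) + bet p T f M₀ ((p * (s * l * e ^ 2) : ℤ) : ℚ) := by
    rw [← show g 0 0 = (l : ℚ) from rfl, ← show g 1 0 = (p * c : ℚ) from rfl, ← hmul]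
    have huvq : (u : ℚ) * l + v * (p ^ 4 * c) = 1 := by exact_mod_cast huv
    congr 1
    · rw [hM₀]; simp only [hg, mk_00, mk_01]; push_cast; ring
    · rw [hM₀]; simp only [hg, mk_10, mk_11]; push_cast
      linear_combination (-(p : ℚ) * s * e ^ 2) * huvq
  rw [e1]
  congr 1
  -- remove the square factor
  set w : ℤ := s * l * p * (1 - M₀) with hw
  have r1 : bet p T f M₀ ((p * (s * l * e ^ 2) : ℤ) : ℚ) = bet p T f M₀ (e ^ 2 * w) := by
    refine bet_congr_right hT hf ⟨s * l * e ^ 2, ?_, ?_⟩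
    · convert iz (s * l * e ^ 2) using 1; push_cast; ring
    · rw [hw]; push_cast; ring
  have hself : IsCoprime M₀ (1 - M₀) := ⟨1, 1, by ring⟩
  have r2 : bet p T f M₀ (e ^ 2 * w) = bet p T f M₀ w :=
    bet_sq hT hf he6 (hT.coprime_six hpT) ⟨s * l * p * (-(e ^ 2 * (s * v))), by
      rw [hw, hM₀]; ring⟩ ⟨s * v, by rw [hM₀]; ring⟩
      (((hM0s.mul_right hM0l).mul_right hM0p).mul_right hself)
  have r3 : bet p T f M₀ w = bet p T f M₀ (s * (l * p)) := by
    refine bet_congr_right hT hf ⟨-(s * l), ?_, ?_⟩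
    · exact_mod_cast iz (-(s * l))
    · rw [hw]; push_cast; ring
  have r4 : bet p T f M₀ (s * (l * p)) = bet p T f M₀ (l * p) := by
    rcases hs with h | h
    · rw [h]; simp
    · rw [h]
      have := bet_neg_right hT hf hpT hl (by omega) (hM0l.mul_right hM0p)
      simpa using this
  rw [r1, r2, r3, r4]
  have hMp : (p : ℤ) ∣ M - M₀ := by
    have : M - M₀ = (M - 1) - p * (p ^ 3 * e ^ 2 * (s * v)) := by rw [hM₀]; ring
    rw [this]; exact dvd_sub hM1 (dvd_mul_right _ _)
  obtain ⟨n, hn⟩ := hlpc.mul_dvd hMl hMp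
  symm
  refine bet_congr_left hT hf ⟨n, iz n, ?_⟩
  have : (M : ℚ) - M₀ = l * p * n := by exact_mod_cast hn
  linear_combination this

lemma bet_prime_sub {l : ℕ} (hl : l.Prime) (h3 : 3 < l) (h4 : l % 4 = 3) (hlp : l ≠ p) {c y M : ℤ}
    (hc : IsCoprime (l : ℤ) c) (hy : IsCoprime (l : ℤ) y) (hM1 : (p : ℤ) ∣ M - 1)
    (hM : (l : ℤ) ∣ M * c - y) :
    bet p T f l (p * y) = bet p T f l (p * c) + bet p T f M (l * p) := by
  have iz : ∀ z : ℤ, (z : ℚ) ∈ ZS T := fun z => intCast_mem _ _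
  have := Fact.mk hl
  have per : ∀ x x' : ℤ, (l : ℤ) ∣ x - x' → bet p T f l (p * x) = bet p T f l (p * x') := by
    rintro x x' ⟨n, hn⟩
    refine bet_congr_right hT hf ⟨n, iz n, ?_⟩
    have : (x : ℚ) - x' = l * n := by exact_mod_cast hn
    linear_combination (p : ℚ) * this
  by_cases hyc : (l : ℤ) ∣ y - c
  · have hM' : (l : ℤ) ∣ M - 1 := by
      have : (M - 1) * c = (M * c - y) + (y - c) := by ring
      exact hc.dvd_of_dvd_mul_right (this ▸ dvd_add hM hyc)
    have hlpc : IsCoprime (l : ℤ) p := by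
      exact_mod_cast Nat.isCoprime_iff_coprime.2 ((Nat.coprime_primes hl hp.out).2 hlp)
    obtain ⟨n, hn⟩ := hlpc.mul_dvd hM' hM1
    rw [per y c hyc, bet_congr_left hT hf (a := M) (a' := 1) ⟨n, iz n, by
      have : (M : ℚ) - 1 = l * p * n := by exact_mod_cast hn
      linear_combination this⟩, mul_comm (l : ℚ) p, bet_one hT hf (natCast_mem _ _), add_zero]
  -- the difference is plus or minus a square
  have hne : ((y - c : ℤ) : ZMod l) ≠ 0 := fun h => hyc ((ZMod.intCast_zmod_eq_zero_iff_dvd _ _).1 h)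
  obtain ⟨s, hs, x, hx⟩ : ∃ s : ℤ, (s = 1 ∨ s = -1) ∧
      ∃ x : ZMod l, ((y - c : ℤ) : ZMod l) = s * x ^ 2 := by
    rcases ZMod.pow_div_two_eq_neg_one_or_one l hne with h | h
    · obtain ⟨x, hx⟩ := (ZMod.euler_criterion l hne).2 h
      exact ⟨1, Or.inl rfl, x, by rw [hx]; push_cast; ring⟩
    · have hne' : -((y - c : ℤ) : ZMod l) ≠ 0 := neg_ne_zero.2 hne
      obtain ⟨x, hx⟩ := (ZMod.euler_criterion l hne').2 (by
        have : Odd (l / 2) := by rw [Nat.odd_iff]; omega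
        rw [this.neg_pow, h, neg_neg])
      exact ⟨-1, Or.inr rfl, x, by rw [← neg_neg ((y - c : ℤ) : ZMod l), hx]; push_cast; ring⟩
  obtain ⟨u, v, huv⟩ := prime_coprime_six hl (by omega) (by omega)
  set e : ℤ := x.val * (v * 6) + u * l with he
  have hex : ((e : ℤ) : ZMod l) = x := by
    have h1 : ((v * 6 : ℤ) : ZMod l) = 1 := by
      have : ((u * l + v * 6 : ℤ) : ZMod l) = 1 := by rw [huv]; simp
      push_cast at this ⊢; simpa using this
    rw [he, Int.cast_add, Int.cast_mul, h1]; simp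
  have he6 : IsCoprime e 6 := ⟨1, v - x.val * v, by rw [he]; linear_combination huv⟩
  have hd : (l : ℤ) ∣ y - (c + s * e ^ 2) := by
    rw [← ZMod.intCast_zmod_eq_zero_iff_dvd]
    push_cast at hx ⊢
    rw [hex]; linear_combination hx
  rw [per y _ hd]
  have := bet_prime_sub_aux hT hf hpT hl h3 he6 (c := c) (M := M) hs hlp hc (by
    obtain ⟨n, hn⟩ := hd
    have : c + s * e ^ 2 = y + l * (-n) := by linear_combination -hn
    rw [this]; exact hy.add_mul_left_right _) hM1 (by
    have : M * c - (c + s * e ^ 2) = (M * c - y) + (y - (c + s * e ^ 2)) := by ring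
    rw [this]; exact dvd_add hM hd)
  push_cast
  exact this

lemma bet_prime {l : ℕ} (hl : l.Prime) (h3 : 3 < l) (h4 : l % 4 = 3) (hlp : (p : ℤ) ∣ l + 1) {c : ℤ}
    (hc : IsCoprime (l : ℤ) c) : ((l - 1) / 2) • (bet p T f l (p * c) - f (-1)) = 0 := by
  have iz : ∀ z : ℤ, (z : ℚ) ∈ ZS T := fun z => intCast_mem _ _
  have := Fact.mk hl
  have hne : l ≠ p := by
    rintro rfl
    have : (l : ℤ) ∣ 1 := by simpa using hlp
    have := Int.le_of_dvd one_pos this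
    omega
  have hlpc : IsCoprime (l : ℤ) p := by
    exact_mod_cast Nat.isCoprime_iff_coprime.2 ((Nat.coprime_primes hl hp.out).2 hne)
  obtain ⟨u, v, huv⟩ := hlpc
  -- an integer congruent to `1` modulo `p` and to `c` modulo `l`
  set M : ℤ := u * l + c * (v * p) with hM
  have hM1 : (p : ℤ) ∣ M - 1 := ⟨v * (c - 1), by rw [hM]; linear_combination huv⟩
  have hMc : (l : ℤ) ∣ M - c := ⟨u * (1 - c), by rw [hM]; linear_combination c * huv⟩
  have hpow : ∀ n : ℕ, bet p T f l (p * ((c ^ n : ℤ) : ℚ)) =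
      bet p T f l (p * (1 : ℤ)) + n • bet p T f M (l * p) := by
    intro n
    induction n with
    | zero => simp
    | succ n ih =>
      rw [bet_prime_sub hT hf hpT hl h3 h4 hne (c := c ^ n) (hc.pow_right) (hc.pow_right) hM1 (by
        have : M * c ^ n - c ^ (n + 1) = (M - c) * c ^ n := by ring
        rw [this]; exact hMc.mul_right _), ih, succ_nsmul, add_assoc]
  have hp0 := p_ne p
  obtain ⟨n, hn⟩ := hlp
  have hnq : (l : ℚ) + 1 = p * n := by exact_mod_cast hn
  have F1 : bet p T f l (p * (1 : ℤ)) = f (-1) := by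
    rw [bet_congr_left hT hf (a' := -1) ⟨n, iz n, by push_cast; linear_combination hnq⟩]
    have hcol : Col p T (1 : ℚ) (-(p * (1 : ℤ))) := by
      have := col_int (p := p) (T := T) (a := 1) (c := -1) isCoprime_one_left
      convert this using 1 <;> simp
    have := bet_neg hT hf hcol
    rw [neg_neg] at this
    rw [this]
    have h1 := bet_one hT hf (p := p) (t := -1) (neg_mem (one_mem _))
    have : -((p : ℚ) * (1 : ℤ)) = p * (-1) := by simp
    rw [this, h1, add_zero]
  have F2 : bet p T f l (p * (-1 : ℤ)) = f (-1) := by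
    rw [bet_congr_left hT hf (a' := -1) ⟨-n, neg_mem (iz n), by push_cast; linear_combination hnq⟩]
    have hcol : Col p T (1 : ℚ) (p * (1 : ℤ)) := by
      have := col_int (p := p) (T := T) (a := 1) (c := 1) isCoprime_one_left
      convert this using 1 <;> simp
    have := bet_neg hT hf hcol
    have h1 := bet_one hT hf (p := p) (t := 1) (one_mem _)
    have e : ((p : ℚ) * (-1 : ℤ)) = -(p * (1 : ℤ)) := by simp
    have e' : ((p : ℚ) * 1) = (p * (1 : ℤ)) := by simp
    rw [e, this, ← e', h1, add_zero]
  have h1 := hpow 1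
  rw [F1] at h1
  simp only [pow_one, one_smul] at h1
  rw [h1, add_sub_cancel_left]
  have hL := hpow ((l - 1) / 2)
  rw [F1] at hL
  have hc0 : ((c : ℤ) : ZMod l) ≠ 0 := by
    intro h
    have := (ZMod.intCast_zmod_eq_zero_iff_dvd _ _).1 h
    have h1 := hc.isUnit_of_dvd' dvd_rfl this
    have := Int.isUnit_iff.1 h1
    omega
  have hcases : (l : ℤ) ∣ c ^ ((l - 1) / 2) - 1 ∨ (l : ℤ) ∣ c ^ ((l - 1) / 2) - (-1) := by
    have e : (l - 1) / 2 = l / 2 := by omega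
    rw [e]
    rcases ZMod.pow_div_two_eq_neg_one_or_one l hc0 with h | h
    · left; rw [← ZMod.intCast_zmod_eq_zero_iff_dvd]; push_cast; rw [h]; ring
    · right; rw [← ZMod.intCast_zmod_eq_zero_iff_dvd]; push_cast; rw [h]; ring
  have per : ∀ x x' : ℤ, (l : ℤ) ∣ x - x' → bet p T f l (p * x) = bet p T f l (p * x') := by
    rintro x x' ⟨n, hn⟩
    refine bet_congr_right hT hf ⟨n, iz n, ?_⟩
    have : (x : ℚ) - x' = l * n := by exact_mod_cast hn
    linear_combination (p : ℚ) * this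
  rcases hcases with h | h
  · rw [per _ _ h, F1] at hL
    simpa using hL
  · rw [per _ _ h, F2] at hL
    simpa using hL
end csp

section csp
variable {p : ℕ} [hp : Fact p.Prime] {T : Set ℕ} {Q : Type*} [AddCommGroup Q]

lemma exists_split (T : Set ℕ) (N : ℕ) (hN : N ≠ 0) : ∃ n w : ℕ, N = n * w ∧
    (∀ q, q.Prime → q ∣ n → q ∉ T) ∧ ∀ q, q.Prime → q ∣ w → q ∈ T := by
  induction N using induction_on_primes with
  | zero => exact absurd rfl hN
  | one => exact ⟨1, 1, rfl, fun q hq h => absurd (Nat.dvd_one.1 h) hq.ne_one,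
      fun q hq h => absurd (Nat.dvd_one.1 h) hq.ne_one⟩
  | prime_mul r a hr ih =>
    obtain ⟨n, w, rfl, h1, h2⟩ := ih (by rintro rfl; simp at hN)
    by_cases h : r ∈ T
    · refine ⟨n, r * w, by ring, h1, fun q hq hd => ?_⟩
      rcases hq.dvd_mul.1 hd with hd | hd
      · rwa [(Nat.prime_dvd_prime_iff_eq hq hr).1 hd]
      · exact h2 q hq hd
    · refine ⟨r * n, w, by ring, fun q hq hd => ?_, h2⟩
      rcases hq.dvd_mul.1 hd with hd | hd
      · rwa [(Nat.prime_dvd_prime_iff_eq hq hr).1 hd]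
      · exact h1 q hq hd

lemma exists_unit_part (hT : ∀ q ∈ T, q.Prime) {x : ℚ} (hx : x ∈ ZS T) (h0 : x ≠ 0) :
    ∃ n : ℕ, 0 < n ∧ (∀ q, q.Prime → q ∣ n → q ∉ T) ∧ x / n ∈ ZS T ∧ n / x ∈ ZS T := by
  obtain ⟨n, w, hN, h1, h2⟩ := exists_split T x.num.natAbs (by simpa using h0)
  have hnw : n * w ≠ 0 := by rw [← hN]; simpa using h0
  have hn0 : n ≠ 0 := left_ne_zero_of_mul hnw
  have hw0 : w ≠ 0 := right_ne_zero_of_mul hnw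
  have hnq : (n : ℚ) ≠ 0 := by exact_mod_cast hn0
  have hwq : (w : ℚ) ≠ 0 := by exact_mod_cast hw0
  have hdq : (x.den : ℚ) ≠ 0 := by exact_mod_cast x.den_ne_zero
  have hdi : (x.den : ℚ)⁻¹ ∈ ZS T := inv_mem_ZS _ fun q hq hd => mem_ZS_den hT hx q hq hd
  have hwi : (w : ℚ)⁻¹ ∈ ZS T := inv_mem_ZS _ h2
  obtain ⟨s, hs, hxs⟩ : ∃ s : ℚ, (s = 1 ∨ s = -1) ∧ x = s * (n * w) / x.den := by
    rcases Int.natAbs_eq x.num with h | h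
    · refine ⟨1, Or.inl rfl, ?_⟩
      have : (x.num : ℚ) = n * w := by rw [h, hN]; push_cast; ring
      rw [one_mul, ← this, Rat.num_div_den]
    · refine ⟨-1, Or.inr rfl, ?_⟩
      have : (x.num : ℚ) = -1 * (n * w) := by rw [h, hN]; push_cast; ring
      rw [← this, Rat.num_div_den]
  have hsm : s ∈ ZS T := by
    rcases hs with rfl | rfl
    · exact one_mem _
    · exact neg_mem (one_mem _)
  have hs0 : s * s = 1 := by rcases hs with rfl | rfl <;> norm_num
  have hsn : s ≠ 0 := by rintro rfl; simp at hs0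
  refine ⟨n, Nat.pos_of_ne_zero hn0, h1, ?_, ?_⟩
  · have : x / n = s * w * (x.den : ℚ)⁻¹ := by
      nth_rw 1 [hxs]; field_simp
    rw [this]
    exact mul_mem (mul_mem hsm (natCast_mem _ _)) hdi
  · have : n / x = s * (w : ℚ)⁻¹ * x.den := by
      nth_rw 1 [hxs]; field_simp; rw [pow_two, hs0]
    rw [this]
    exact mul_mem (mul_mem hsm hwi) (natCast_mem _ _)

lemma exists_residue (hT : ∀ q ∈ T, q.Prime) {n : ℕ} (h0 : 0 < n)
    (hn : ∀ q, q.Prime → q ∣ n → q ∉ T) {y : ℚ} (hy : y ∈ ZS T) :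
    ∃ z : ℤ, (y - z) / n ∈ ZS T := by
  have hc : Nat.Coprime y.den n := Nat.coprime_of_dvd fun q hq h1 h2 =>
    hn q hq h2 (mem_ZS_den hT hy q hq h1)
  obtain ⟨u, v, huv⟩ := Nat.isCoprime_iff_coprime.2 hc
  refine ⟨y.num * u, ?_⟩
  have hdq : (y.den : ℚ) ≠ 0 := by exact_mod_cast y.den_ne_zero
  have hnq : (n : ℚ) ≠ 0 := by exact_mod_cast h0.ne'
  have hyq := Rat.num_div_den y
  have huvq : (u : ℚ) * y.den + v * n = 1 := by exact_mod_cast huv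
  have : (y - ((y.num * u : ℤ) : ℚ)) / n = v * y := by
    rw [div_eq_iff hnq]
    push_cast
    have h2 : (y.num : ℚ) = y * y.den := by rw [Rat.mul_den_eq_num]
    rw [h2]; linear_combination (-y) * huvq
  rw [this]
  exact mul_mem (intCast_mem _ _) hy

lemma isCoprime_of_mem (hT : ∀ q ∈ T, q.Prime) {n : ℕ}
    (hn : ∀ q, q.Prime → q ∣ n → q ∉ T) {z : ℤ} {s t : ℚ} (hs : s ∈ ZS T) (ht : t ∈ ZS T)
    (h : n * s + z * t = 1) : IsCoprime z n := by
  rw [Int.isCoprime_iff_gcd_eq_one]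
  refine Nat.coprime_of_dvd fun q hq h1 h2 => ?_
  have h2' : q ∣ n := by simpa using h2
  apply hn q hq h2'
  obtain ⟨a, ha⟩ := Int.natCast_dvd.2 h1
  obtain ⟨b, hb⟩ := h2'
  have hq0 : (q : ℚ) ≠ 0 := by exact_mod_cast hq.ne_zero
  have : (q : ℚ)⁻¹ ∈ ZS T := by
    have e : (q : ℚ)⁻¹ = b * s + a * t := by
      rw [ha, hb] at h
      push_cast at h
      field_simp
      linear_combination -h
    rw [e]
    exact add_mem (mul_mem (natCast_mem _ _) hs) (mul_mem (intCast_mem _ _) ht)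
  refine mem_ZS_den hT this q hq ?_
  rw [Rat.inv_natCast_den]
  split_ifs with h
  · simp [h] at hq0
  · exact dvd_rfl

lemma nsmul_eq_zero_of_coprime {x : Q} {a b : ℕ} (h : Nat.Coprime a b) (ha : a • x = 0)
    (hb : b • x = 0) : x = 0 := by
  have := AddMonoid.addOrderOf_eq_one_iff.1 (Nat.dvd_one.1 (h ▸
    Nat.dvd_gcd (addOrderOf_dvd_of_nsmul_eq_zero ha) (addOrderOf_dvd_of_nsmul_eq_zero hb)))
  exact this

variable {f : S2 → Q} (hT : Good T) (hf : AddOn (Gam p T) f) (hpT : p ∉ T)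
include hT hf hpT

lemma bet_eq_of_neg_one {a c : ℚ} (h : Col p T a c) (ha : (a + 1) / p ∈ ZS T) :
    bet p T f a c = f (-1) := by
  have iz : ∀ z : ℤ, (z : ℚ) ∈ ZS T := fun z => intCast_mem _ _
  have hp0 := p_ne p
  have hp2 : 2 < p := lt_of_le_of_ne hp.out.two_le (fun h => hpT (h ▸ hT.two))
  -- reduce to nonzero `c`
  wlog hc0 : c ≠ 0 generalizing c with H
  · have hc : c = 0 := not_not.1 hc0
    have ha0 : a ≠ 0 := by
      obtain ⟨g, hg, rfl, h2⟩ := h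
      intro h1
      have := det_eq g
      rw [h1, h2, hc] at this; simp at this
    have := H (c := c + p * 1 * a) (by
      obtain ⟨g, hg, rfl, rfl⟩ := h
      exact ⟨xL (p * 1) * g, mul_mem (mem_Gam_xL p (one_mem _)) hg, by simp,
        by simp [add_comm]⟩) (by rw [hc]; simp [ha0, hp0])
    rwa [bet_add_right hT hf (one_mem _)] at this
  obtain ⟨g, hg, rfl, rfl⟩ := h
  set c := g 1 0 / p with hc
  have hcm : c ∈ ZS T := (mem_Gam.1 hg).2
  have hcg : g 1 0 = p * c := by rw [hc]; field_simp
  have hdet := det_eq g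
  obtain ⟨hg0, hg1, -, hg3⟩ := hg.1
  rw [hcg] at hdet hc0 ⊢
  clear_value c
  set a := g 0 0
  have hcn : c ≠ 0 := right_ne_zero_of_mul hc0
  obtain ⟨n, hn, hnT, hu1, hu2⟩ := exists_unit_part hT.prime hcm hcn
  obtain ⟨z, hz⟩ := exists_residue hT.prime hn hnT ha
  have hn0 : (n : ℚ) ≠ 0 := by exact_mod_cast hn.ne'
  set a₁ : ℤ := -1 + p * z with ha₁
  have haa : (a - a₁) / (p * c) ∈ ZS T := by
    have := mul_mem hz hu2
    convert this using 1
    rw [ha₁]; push_cast; field_simp; ring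
  rw [bet_congr_left hT hf (a' := a₁) ⟨_, haa, by field_simp; ring⟩]
  have ha1 : a₁ ≠ 0 := by
    intro h0
    have : (p : ℤ) ∣ 1 := ⟨z, by linear_combination -h0⟩
    have := Int.le_of_dvd one_pos this
    omega
  have ha11 : a₁ ≠ 1 := by
    intro h0
    have : (p : ℤ) ∣ 2 := ⟨z, by linear_combination -h0⟩
    have := Int.le_of_dvd two_pos this
    omega
  -- make `c` a prime
  obtain ⟨n', hn', hnT', hu1', hu2'⟩ := exists_unit_part hT.prime (iz a₁) (by exact_mod_cast ha1)
  obtain ⟨w, hw⟩ := exists_residue hT.prime hn' hnT' hcm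
  have hn0' : (n' : ℚ) ≠ 0 := by exact_mod_cast hn'.ne'
  have ha1q : (a₁ : ℚ) ≠ 0 := by exact_mod_cast ha1
  have hcop : IsCoprime w n' := by
    set b := g 0 1
    set d := g 1 1
    refine isCoprime_of_mem hT.prime hnT'
      (s := (a₁ / n') * d + (c - w) / n' * ((a - a₁) / (p * c) * d - b) * p)
      (t := ((a - a₁) / (p * c) * d - b) * p) ?_ ?_ ?_
    · exact add_mem (mul_mem hu1' hg3) (mul_mem (mul_mem hw (sub_mem (mul_mem haa hg3) hg1))
        (natCast_mem _ _))
    · exact mul_mem (sub_mem (mul_mem haa hg3) hg1) (natCast_mem _ _)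
    · have e1 : (n' : ℚ) * ((a₁ / n') * d + (c - w) / n' * ((a - a₁) / (p * c) * d - b) * p) =
        a₁ * d + (c - w) * ((a - a₁) / (p * c) * d - b) * p := by field_simp
      have e2 : (a - a₁) / (p * c) * (p * c) = a - a₁ := by field_simp
      rw [e1]
      linear_combination hdet + d * e2
  obtain ⟨r, hrb, hr, hrw⟩ := exists_prime_zmodEq (by exact_mod_cast hn'.ne') hcop
    (a₁.natAbs + p + 3)
  have hr0 : (r : ℚ) ≠ 0 := by exact_mod_cast hr.ne_zero
  have hcr : (c - r) / a₁ ∈ ZS T := by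
    obtain ⟨k, hk⟩ := hrw
    have hkq : (r : ℚ) - w = n' * k := by exact_mod_cast hk
    have := mul_mem (sub_mem hw (iz k)) hu2'
    convert this using 1
    field_simp
    linear_combination -hkq
  rw [bet_congr_right hT hf (c' := p * r) ⟨_, hcr, by field_simp; ring⟩]
  have hra : IsCoprime a₁ r := by
    refine IsCoprime.symm ?_
    rw [(Nat.prime_iff_prime_int.1 hr).coprime_iff_not_dvd]
    intro h
    have := Int.le_of_dvd (Int.natAbs_pos.2 ha1 |> fun h => by exact_mod_cast h)
      (Int.dvd_natAbs.2 h)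
    omega
  have hra1 : IsCoprime (r : ℤ) (a₁ - 1) := by
    rw [(Nat.prime_iff_prime_int.1 hr).coprime_iff_not_dvd]
    intro h
    have := Int.le_of_dvd (b := ((a₁ - 1).natAbs : ℤ)) (by omega) (Int.dvd_natAbs.2 h)
    omega
  have hpa : IsCoprime a₁ p := ⟨-1, z, by rw [ha₁]; ring⟩
  have hpp2 : IsCoprime (p : ℤ) 2 := by
    exact_mod_cast Nat.isCoprime_iff_coprime.2
      ((Nat.coprime_primes hp.out Nat.prime_two).2 (by omega))
  have hr2 : IsCoprime (r : ℤ) 2 := by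
    exact_mod_cast Nat.isCoprime_iff_coprime.2
      ((Nat.coprime_primes hr Nat.prime_two).2 (by omega))
  have hpa1 : IsCoprime (p : ℤ) (a₁ - 1) := by
    have : a₁ - 1 = -2 + p * z := by rw [ha₁]; ring
    rw [this]; exact hpp2.neg_right.add_mul_left_right _
  have hpr0 : (p : ℤ) * r ≠ 0 := by
    have := hr.ne_zero; have := hp.out.ne_zero; positivity
  have h42 : IsCoprime ((p : ℤ) * r) 4 := by
    simpa using (hpp2.mul_left hr2).pow_right (n := 2)
  have main : ∀ l : ℕ, l.Prime → 3 < l → l % 4 = 3 → (p * r : ℤ) ∣ l - a₁ →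
      ((l - 1) / 2) • (bet p T f a₁ (p * r) - f (-1)) = 0 := by
    intro l hl l3 l4 ⟨k, hk⟩
    have hkq : (l : ℚ) - a₁ = p * r * k := by exact_mod_cast hk
    have hlr : IsCoprime (l : ℤ) r := by
      have : (l : ℤ) = a₁ + r * (p * k) := by linear_combination hk
      rw [this]; exact hra.add_mul_left_left _
    have := bet_prime hT hf hpT hl l3 l4 ⟨z + r * k, by rw [ha₁] at hk; linear_combination hk⟩ hlr
    rw [bet_congr_left hT hf (a := a₁) (a' := l) ⟨-k, neg_mem (iz k), by
      linear_combination -hkq⟩]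
    exact_mod_cast this
  obtain ⟨l, l3, hl, hla, hl4⟩ := exists_prime_zmodEq₂ (a := a₁) (b := 3) (d := 4) hpr0
    (by norm_num) (hpa.mul_right hra) (by norm_num) h42 3
  obtain ⟨k, hk⟩ := id hla
  have hL : (((l - 1) / 2 : ℕ) : ℤ) * 2 = l - 1 := by omega
  have hLc : IsCoprime ((p : ℤ) * r) ((l - 1) / 2 : ℕ) := by
    have : IsCoprime ((p : ℤ) * r) (l - 1) := by
      have : (l : ℤ) - 1 = a₁ - 1 + p * r * k := by linear_combination hk
      rw [this]; exact (hpa1.mul_left hra1).add_mul_left_right _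
    rw [← hL] at this
    exact this.of_mul_right_left
  obtain ⟨l', l3', hl', hla', hl4'⟩ := exists_prime_zmodEq₂ (a := a₁) (b := -1)
    (d := 4 * ((l - 1) / 2 : ℕ)) hpr0 (by omega) (hpa.mul_right hra)
    isCoprime_one_left.neg_left (h42.mul_right hLc) 3
  obtain ⟨m, hm⟩ := id hl4'
  have hcp : Nat.Coprime ((l - 1) / 2) ((l' - 1) / 2) := by
    rw [← Nat.isCoprime_iff_coprime]
    have ho := hl'.eq_two_or_odd
    have : (((l' - 1) / 2 : ℕ) : ℤ) = -1 + (((l - 1) / 2 : ℕ) : ℤ) * (2 * m) := by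
      have : (((l' - 1) / 2 : ℕ) : ℤ) * 2 = l' - 1 := by omega
      linarith
    rw [this]
    exact (isCoprime_one_right.neg_right).add_mul_left_right _
  have h44 : (4 : ℤ) ∣ l' - -1 := (dvd_mul_right _ _).trans hl4'
  exact sub_eq_zero.1 (nsmul_eq_zero_of_coprime hcp (main l hl l3 (by omega) hla)
    (main l' hl' l3' (by omega) hla'))

lemma csp {g : S2} (hg : g ∈ Gam p T) (h : (g 0 0 - 1) / p ∈ ZS T) : f g = 0 := by
  have hn := mem_Gam_neg p hg
  have h1 := bet_eq_of_neg_one hT hf hpT (a := (-g) 0 0) (c := (-g) 1 0) ⟨-g, hn, rfl, rfl⟩ (by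
    have := neg_mem h
    convert this using 1
    rw [neg_e]; ring)
  rw [bet_eq hT hf hn] at h1
  have : -g = -1 * g := by simp
  rw [this, hf _ (mem_Gam_neg p (one_mem _)) _ hg] at h1
  exact left_eq_add.1 h1.symm

/-- Additive functions on `Gam p T` factor through the residue character. -/
lemma exists_factor_chi : ∃ θ : Additive (ZMod p)ˣ →+ Q,
    ∀ g ∈ Gam p T, f g = θ (Additive.ofMul (chi p g)) := by
  have hchi := homOn_chi p hT.prime hpT
  have key : ∀ g ∈ Gam p T, chi p g = 1 → f g = 0 := by
    intro g hg h1
    refine csp hT hf hpT hg (div_mem_of_rs p hT.prime (sub_mem hg.1.1 (one_mem _)) hpT ?_)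
    have := chi_val p hT.prime hpT hg
    rw [h1] at this
    rw [sub_eq_add_neg, rs_add p hT.prime hpT hg.1.1 (neg_mem (one_mem _)), ← this]
    simp
  have key2 : ∀ g ∈ Gam p T, ∀ h ∈ Gam p T, chi p g = chi p h → f g = f h := by
    intro g hg h hh e
    have := key (g * h⁻¹) (mul_mem hg (inv_mem hh)) (by
      rw [hchi _ hg _ (inv_mem hh), hchi.map_inv hh, e, mul_inv_cancel])
    rw [hf _ hg _ (inv_mem hh), hf.inv hh] at this
    exact add_neg_eq_zero.1 this
  choose s hs hs' using exists_chi p T hT.prime hpT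
  refine ⟨⟨⟨fun c => f (s c.toMul), ?_⟩, ?_⟩, fun g hg => ?_⟩
  · exact key _ (hs _) (hs' _)
  · intro a b
    change f (s (a + b).toMul) = _
    rw [← hf _ (hs _) _ (hs _)]
    refine key2 _ (hs _) _ (mul_mem (hs _) (hs _)) ?_
    rw [hs', hchi _ (hs _) _ (hs _), hs', hs']; rfl
  · exact key2 _ hg _ (hs _) (hs' _).symm
end csp

/-! ### Words in central extensions -/

/-- The set of all primes. -/
def pri : Set ℕ := {p | p.Prime}

lemma good_pri : Good pri := ⟨fun _ h => h, Nat.prime_two, Nat.prime_three⟩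

lemma mem_pri (a : ℚ) : a ∈ ZS pri := mem_ZS fun _ hq _ => hq

lemma xU_nsmul (n : ℕ) (b : ℚ) : xU (n * b) = xU b ^ n := by
  induction n with
  | zero => simp
  | succ n ih => rw [pow_succ, ← ih, ← xU_add]; congr 1; push_cast; ring

lemma xL_nsmul (n : ℕ) (b : ℚ) : xL (n * b) = xL b ^ n := by
  induction n with
  | zero => simp
  | succ n ih => rw [pow_succ, ← ih, ← xL_add]; congr 1; push_cast; ring

/-- The extension of `SL₂(ℚ)` defined by a cocycle. -/
def totE {Q : Type} [AddCommGroup Q] {x : S2 → S2 → Q} (hx : IsCoc ⊤ x) : CExt pri (ExtC hx) :=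
  ExtC.toCExt hx le_top

lemma totE_pr {Q : Type} [AddCommGroup Q] {x : S2 → S2 → Q} (hx : IsCoc ⊤ x) (a : ExtC hx) :
    (totE hx).pr a = a.g := rfl

namespace CExt
variable {X : Type*} [Group X] {T : Set ℕ} (E : CExt T X)

lemma X12_nsmul (hT : Good T) {b : ℚ} (hb : b ∈ ZS T) (n : ℕ) : E.X12 (n * b) = E.X12 b ^ n := by
  induction n with
  | zero => simp [E.X12_zero hT]
  | succ n ih =>
    rw [pow_succ, ← ih, ← E.X12_add hT (mul_mem (natCast_mem _ _) hb) hb]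
    congr 1; push_cast; ring

lemma X21_nsmul (hT : Good T) {b : ℚ} (hb : b ∈ ZS T) (n : ℕ) : E.X21 (n * b) = E.X21 b ^ n := by
  induction n with
  | zero => simp [E.X21_zero hT]
  | succ n ih =>
    rw [pow_succ, ← ih, ← E.X21_add hT (mul_mem (natCast_mem _ _) hb) hb]
    congr 1; push_cast; ring

lemma pow_eq_of_pr {n : ℕ} (hn : ∀ z, E.pr z = 1 → z ^ n = 1) {a b : X} (h : E.pr a = E.pr b) :
    a ^ n = b ^ n := by
  have h1 : E.pr (a * b⁻¹) = 1 := by simp [h]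
  have h2 : a = (a * b⁻¹) * b := by group
  rw [h2, (show Commute (a * b⁻¹) b from E.central _ h1 b).mul_pow, hn _ h1, one_mul]

lemma section_X12_div (hT : Good T) {K : Subgroup S2} {s : S2 → X} (hs : HomOn K s)
    (hp : ∀ g ∈ K, E.pr (s g) = g) {n : ℕ} (hn : ∀ z, E.pr z = 1 → z ^ n = 1) (h0 : n ≠ 0) {a : ℚ}
    (hb : a / n ∈ ZS T) (hK : xU (a / n) ∈ K) : s (xU a) = E.X12 a := by
  have e : (n : ℚ) * (a / n) = a := by field_simp
  have h1 : xU a = xU (a / n) ^ n := by rw [← xU_nsmul, e]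
  have h2 : s (xU (a / n) ^ n) = s (xU (a / n)) ^ n := by
    have := map_pow hs.toHom ⟨_, hK⟩ n
    simpa using this
  have h3 := E.X12_nsmul hT hb n
  rw [e] at h3
  rw [h1, h2, h3]
  exact E.pow_eq_of_pr hn (by rw [hp _ hK, E.pr_X12 hT hb])

lemma section_X21_div (hT : Good T) {K : Subgroup S2} {s : S2 → X} (hs : HomOn K s)
    (hp : ∀ g ∈ K, E.pr (s g) = g) {n : ℕ} (hn : ∀ z, E.pr z = 1 → z ^ n = 1) (h0 : n ≠ 0) {a : ℚ}
    (hb : a / n ∈ ZS T) (hK : xL (a / n) ∈ K) : s (xL a) = E.X21 a := by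
  have e : (n : ℚ) * (a / n) = a := by field_simp
  have h1 : xL a = xL (a / n) ^ n := by rw [← xL_nsmul, e]
  have h2 : s (xL (a / n) ^ n) = s (xL (a / n)) ^ n := by
    have := map_pow hs.toHom ⟨_, hK⟩ n
    simpa using this
  have h3 := E.X21_nsmul hT hb n
  rw [e] at h3
  rw [h1, h2, h3]
  exact E.pow_eq_of_pr hn (by rw [hp _ hK, E.pr_X21 hT hb])

/-- A word in the canonical lifts. -/
def wd (c' k₂ σ k₁ c y : ℚ) : X :=
  E.X21 c' * E.X12 k₂ * E.X21 σ * (E.X12 k₁ * E.X21 c) * E.X12 (-y)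

lemma map_wd {X' : Type*} [Group X'] (E : CExt pri X) (E' : CExt pri X') (F : X →* X')
    (hF : ∀ a, E'.pr (F a) = E.pr a) (c' k₂ σ k₁ c y : ℚ) :
    F (E.wd c' k₂ σ k₁ c y) = E'.wd c' k₂ σ k₁ c y := by
  simp only [wd, map_mul, E.map_X12 E' F hF good_pri (mem_pri _),
    E.map_X21 E' F hF good_pri (mem_pri _)]

end CExt

/-- Parameters for which the word `CExt.wd` projects to the identity. -/
structure Wd (c' k₂ σ k₁ c y : ℚ) : Prop where
  eq : xL c' * xU k₂ * xL σ * (xU k₁ * xL c) * xU (-y) = 1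

lemma wd_mk {q u u' N : ℚ} (hq : q ≠ 0) (hu : u ≠ 0) (hu' : u' ≠ 0) (hN : N ≠ 0) :
    Wd (q * u') (-(N + 1) / (q * u')) (q * (u + u') / N) (-(N + 1) / (q * u)) (q * u)
      (-(N + 1) / (q * u) + -(N + 1) / (q * u') * (1 + q * (u + u') / N * (-(N + 1) / (q * u)))) := by
  constructor
  apply S2_ext <;> simp <;> field_simp <;> ring

lemma Wd.pr {c' k₂ σ k₁ c y : ℚ} (h : Wd c' k₂ σ k₁ c y) {X : Type*} [Group X] (E : CExt pri X) :
    E.pr (E.wd c' k₂ σ k₁ c y) = 1 := by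
  simp only [CExt.wd, map_mul, E.pr_X12 good_pri (mem_pri _), E.pr_X21 good_pri (mem_pri _)]
  exact h.eq

/-- A word is trivial if the extension splits compatibly on a group that contains it. -/
lemma Wd.eq_one {c' k₂ σ k₁ c y : ℚ} (h : Wd c' k₂ σ k₁ c y) {X : Type*} [Group X]
    (E : CExt pri X) {K : Subgroup S2} {s : S2 → X} (hs : HomOn K s)
    (h₁ : xL c' ∈ K ∧ s (xL c') = E.X21 c') (h₂ : xU k₂ ∈ K ∧ s (xU k₂) = E.X12 k₂)
    (h₃ : xL σ ∈ K ∧ s (xL σ) = E.X21 σ) (h₄ : xU k₁ ∈ K ∧ s (xU k₁) = E.X12 k₁)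
    (h₅ : xL c ∈ K ∧ s (xL c) = E.X21 c) (h₆ : xU (-y) ∈ K → s (xU (-y)) = E.X12 (-y)) :
    E.wd c' k₂ σ k₁ c y = 1 := by
  have h45 := K.mul_mem h₄.1 h₅.1
  have h12 := K.mul_mem h₁.1 h₂.1
  have h123 := K.mul_mem h12 h₃.1
  have h15 := K.mul_mem h123 h45
  have h6 : xU (-y) ∈ K := by
    have := eq_inv_of_mul_eq_one_right h.eq
    rw [this]; exact inv_mem h15
  have := hs _ h15 _ h6
  rw [h.eq, hs.map_one, hs _ h123 _ h45, hs _ h12 _ h₃.1, hs _ h₁.1 _ h₂.1, hs _ h₄.1 _ h₅.1,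
    h₁.2, h₂.2, h₃.2, h₄.2, h₅.2, h₆ h6] at this
  exact this.symm

/-! ### The word in the winding extension -/

/-- Upper triangular matrices with positive diagonal. -/
def upB : Subgroup S2 where
  carrier := {g | g 1 0 = 0 ∧ 0 < g 0 0}
  one_mem' := by simp
  mul_mem' := by
    rintro g h ⟨h1, h2⟩ ⟨k1, k2⟩
    exact ⟨by simp [h1, k1], by simpa [k1] using mul_pos h2 k2⟩
  inv_mem' := by
    rintro g ⟨h1, h2⟩
    refine ⟨by simp [h1], ?_⟩
    have := det_eq g
    rw [h1] at this
    rw [inv_00]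
    have : 0 < g 0 0 * g 1 1 := by linarith
    exact (pos_iff_pos_of_mul_pos this).1 h2

/-- Lower triangular matrices with positive diagonal. -/
def loB : Subgroup S2 where
  carrier := {g | g 0 1 = 0 ∧ 0 < g 0 0}
  one_mem' := by simp
  mul_mem' := by
    rintro g h ⟨h1, h2⟩ ⟨k1, k2⟩
    exact ⟨by simp [h1, k1], by simpa [h1] using mul_pos h2 k2⟩
  inv_mem' := by
    rintro g ⟨h1, h2⟩
    refine ⟨by simp [h1], ?_⟩
    have := det_eq g
    rw [h1] at this
    rw [inv_00]
    have : 0 < g 0 0 * g 1 1 := by linarith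
    exact (pos_iff_pos_of_mul_pos this).1 h2

lemma Wc_upB : CobOn upB Wc 0 := by
  rintro g ⟨h1, h2⟩ h ⟨k1, k2⟩
  have : colv g = (g 0 0, 0) := by simp [colv, h1]
  have e : colv (g * h) = (g 0 0 * h 0 0, 0) := by simp [colv, h1, k1]
  simp [Wc, this, e, angI, angLt, posv, h2, crs, mul_pos h2 k2]

lemma Wc_loB : CobOn loB Wc (fun g => if g 1 0 < 0 then 1 else 0) := by
  rintro g ⟨h1, h2⟩ h ⟨k1, k2⟩
  have hd : 0 < g 1 1 := by
    have := det_eq g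
    rw [h1] at this
    have : 0 < g 0 0 * g 1 1 := by linarith
    exact (pos_iff_pos_of_mul_pos this).1 h2
  have hdet : g 0 0 * g 1 1 = 1 := by have := det_eq g; rw [h1] at this; linarith
  have hp := mul_pos h2 k2
  have e1 : posv (colv g) ↔ 0 ≤ g 1 0 := by
    simp only [posv, colv, h2, and_true, le_iff_lt_or_eq, eq_comm]
  have e2 : posv (colv (g * h)) ↔ 0 ≤ (g * h) 1 0 := by
    simp only [posv, colv, mul_00, h1, zero_mul, add_zero, hp, and_true, le_iff_lt_or_eq, eq_comm]
  have e3 : 0 < crs (colv (g * h)) (colv g) ↔ h 1 0 < 0 := by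
    have : crs (colv (g * h)) (colv g) = -h 1 0 := by
      simp only [crs, colv, mul_00, mul_10, h1]
      linear_combination (-h 1 0) * hdet
    rw [this]; exact neg_pos
  simp only [Wc, angI, angLt, e1, e2, e3]
  have e4 : (g * h) 1 0 = g 1 0 * h 0 0 + g 1 1 * h 1 0 := mul_10 g h
  generalize (g * h) 1 0 = r at e4
  rcases lt_or_ge (g 1 0) 0 with a | a <;> rcases lt_or_ge (h 1 0) 0 with b | b
  · have c : r < 0 := by nlinarith
    simp [a, b, c, not_le.2 c, not_le.2 a]
  · rcases lt_or_ge r 0 with c | c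
    · simp [a, not_lt.2 b, c, not_le.2 c, not_le.2 a]
    · simp [a, not_lt.2 b, c, not_lt.2 c, not_le.2 a]
  · rcases lt_or_ge r 0 with c | c
    · simp [a, b, c, not_lt.2 a, not_le.2 c]
    · simp [a, b, c, not_lt.2 a, not_lt.2 c]
  · have c : 0 ≤ r := by
      rw [e4]; exact add_nonneg (mul_nonneg a k2.le) (mul_nonneg hd.le b)
    simp [a, c, not_lt.2 a, not_lt.2 b, not_lt.2 c]

lemma Wc_X12 (a : ℚ) : (totE (Wc_coc ⊤)).X12 a = ⟨⟨xU a, trivial⟩, 0⟩ := by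
  have hs := ExtC.homOn_sec (Wc_coc ⊤) le_top Wc_upB
  rw [← (totE (Wc_coc ⊤)).section_X12 hs (fun g _ => ExtC.proj_sec _ _ (Subgroup.mem_top g)) (by simp [upB])
    (by simp [upB]), ExtC.sec_apply _ _ (Subgroup.mem_top _)]
  simp

lemma Wc_X21 (a : ℚ) :
    (totE (Wc_coc ⊤)).X21 a = ⟨⟨xL a, trivial⟩, if a < 0 then -1 else 0⟩ := by
  have hs := ExtC.homOn_sec (Wc_coc ⊤) le_top Wc_loB
  rw [← (totE (Wc_coc ⊤)).section_X21 hs (fun g _ => ExtC.proj_sec _ _ (Subgroup.mem_top g)) (by simp [loB])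
    (by simp [loB]), ExtC.sec_apply _ _ (Subgroup.mem_top _)]
  rw [xL_10]
  split_ifs <;> simp

lemma Wc_xU (k : ℚ) (h : S2) : Wc (xU k) h = 0 := by
  have : colv (xU k) = (1, 0) := by simp [colv]
  rw [Wc, this, angI_one]

lemma Wd.winding {c' k₂ σ k₁ c y : ℚ} (h : Wd c' k₂ σ k₁ c y) (h1 : 0 < c') (h2 : 0 < σ)
    (h3 : 0 < c) :
    (totE (Wc_coc ⊤)).wd c' k₂ σ k₁ c y = ExtC.cen _ 1 := by
  have e5 : xU k₂ * (xL σ * (xU k₁ * (xL c * xU (-y)))) = xL (-c') := by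
    rw [xL_neg]
    exact eq_inv_of_mul_eq_one_right (by rw [← h.eq]; group)
  have e3 : xL σ * (xU k₁ * (xL c * xU (-y))) = xU (-k₂) * xL (-c') := by
    rw [← e5, xU_neg k₂, inv_mul_cancel_left]
  have w1 : Wc (xL c) (xU (-y)) = 0 := by simp [Wc, colv, angI, angLt, crs]
  have w2 : Wc (xL σ) (xU k₁ * (xL c * xU (-y))) = 0 := by
    rw [Wc, e3]
    have a1 : ¬ posv (colv (xU (-k₂) * xL (-c'))) := by
      simp [posv, colv, h1.le, h1.ne']
    have a2 : posv (colv (xL σ)) := Or.inl h2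
    simp [angI, angLt, a1, a2]
  have w3 : Wc (xL c') (xL (-c')) = 1 := by
    have a1 : posv (colv (xL c' * xL (-c'))) := by simp [posv, colv]
    have a2 : posv (colv (xL c')) := Or.inl h1
    have a3 : 0 < crs (colv (xL c' * xL (-c'))) (colv (xL c')) := by simpa [crs, colv] using h1
    simp [Wc, angI, angLt, a1, a2, a3]
  have w4 : Wc 1 1 = 0 := by simp [Wc, colv, angI, angLt, crs]
  ext
  · rw [← totE_pr, h.pr]; rfl
  · simp only [CExt.wd, mul_assoc, Wc_X12, Wc_X21, not_lt.2 h1.le, not_lt.2 h2.le, not_lt.2 h3.le,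
      if_false, ExtC.mul_q, ExtC.mul_g, Subgroup.coe_mul, Wc_xU, w1, w2, e5, w3, ExtC.cen, w4]
    simp

/-! ### The word in the tame extensions -/

section tame
variable (p : ℕ) [hp : Fact p.Prime]
omit hp in
lemma tau_pow (z : ExtC (tau_coc p)) (hp : p.Prime) (hz : (totE (tau_coc p)).pr z = 1) :
    z ^ (p - 1) = 1 := by
  have := Fact.mk hp
  obtain ⟨q, rfl⟩ := ExtC.eq_cen hz
  have h : (p - 1) • q = 0 := ZMod.units_pow_card_sub_one_eq_one p q.toMul
  rw [ExtC.cen_pow, h, ExtC.cen_zero]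

lemma div_mem_cop {a : ℚ} (ha : a ∈ ZS (cop p)) : a / ((p - 1 : ℕ) : ℚ) ∈ ZS (cop p) := by
  rw [div_eq_mul_inv]
  refine mul_mem ha (inv_mem_ZS _ fun q hq hd => ⟨hq, ?_⟩)
  rintro rfl
  have h2 := hq.two_le
  have := Nat.le_of_dvd (by omega) hd
  omega

/-- The splitting over the first vertex group. -/
lemma homOn_sec_tau : HomOn (GT (cop p)) (ExtC.sec (tau_coc p) 0) :=
  ExtC.homOn_sec _ le_top fun g hg h hh => by simp [tau_eq_zero p hg hh]

lemma sec_tau_xU {a : ℚ} (ha : a ∈ ZS (cop p)) :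
    ExtC.sec (tau_coc p) 0 (xU a) = (totE (tau_coc p)).X12 a :=
  (totE (tau_coc p)).section_X12_div good_pri (homOn_sec_tau p)
    (fun g _ => ExtC.proj_sec _ _ (Subgroup.mem_top g)) (fun z => tau_pow p z hp.out)
    (by have := hp.out.two_le; omega) (mem_pri _) (xU_mem (div_mem_cop p ha))

lemma sec_tau_xL {a : ℚ} (ha : a ∈ ZS (cop p)) :
    ExtC.sec (tau_coc p) 0 (xL a) = (totE (tau_coc p)).X21 a :=
  (totE (tau_coc p)).section_X21_div good_pri (homOn_sec_tau p)
    (fun g _ => ExtC.proj_sec _ _ (Subgroup.mem_top g)) (fun z => tau_pow p z hp.out)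
    (by have := hp.out.two_le; omega) (mem_pri _) (xL_mem (div_mem_cop p ha))

lemma xU_mem_GT' {T : Set ℕ} {a : ℚ} (ha : p * a ∈ ZS T) : xU a ∈ GT' p T := by
  rw [mem_GT', mem_GT]
  simp [ha, zero_mem, one_mem]

lemma xL_mem_GT' {T : Set ℕ} {a : ℚ} (ha : a / p ∈ ZS T) : xL a ∈ GT' p T := by
  rw [mem_GT', mem_GT]
  simp [ha, zero_mem, one_mem]

lemma sec_tau_xU' {u : S2 → Additive (ZMod p)ˣ} (hu : CobOn (GT' p (cop p)) (tau p) u) {a : ℚ}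
    (ha : p * a ∈ ZS (cop p)) : ExtC.sec (tau_coc p) u (xU a) = (totE (tau_coc p)).X12 a :=
  (totE (tau_coc p)).section_X12_div good_pri (ExtC.homOn_sec _ le_top hu)
    (fun g _ => ExtC.proj_sec _ _ (Subgroup.mem_top g)) (fun z => tau_pow p z hp.out)
    (by have := hp.out.two_le; omega) (mem_pri _)
    (xU_mem_GT' p (by rw [← mul_div_assoc]; exact div_mem_cop p ha))

lemma sec_tau_xL' {u : S2 → Additive (ZMod p)ˣ} (hu : CobOn (GT' p (cop p)) (tau p) u) {a : ℚ}
    (ha : a / p ∈ ZS (cop p)) : ExtC.sec (tau_coc p) u (xL a) = (totE (tau_coc p)).X21 a :=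
  (totE (tau_coc p)).section_X21_div good_pri (ExtC.homOn_sec _ le_top hu)
    (fun g _ => ExtC.proj_sec _ _ (Subgroup.mem_top g)) (fun z => tau_pow p z hp.out)
    (by have := hp.out.two_le; omega) (mem_pri _)
    (xL_mem_GT' p (by rw [div_right_comm]; exact div_mem_cop p ha))

lemma Wd.tame_one {c' k₂ σ k₁ c y : ℚ} (h : Wd c' k₂ σ k₁ c y) (h₁ : c' ∈ ZS (cop p))
    (h₂ : k₂ ∈ ZS (cop p)) (h₃ : σ ∈ ZS (cop p)) (h₄ : k₁ ∈ ZS (cop p)) (h₅ : c ∈ ZS (cop p)) :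
    (totE (tau_coc p)).wd c' k₂ σ k₁ c y = 1 :=
  h.eq_one _ (homOn_sec_tau p) ⟨xL_mem h₁, sec_tau_xL p h₁⟩ ⟨xU_mem h₂, sec_tau_xU p h₂⟩
    ⟨xL_mem h₃, sec_tau_xL p h₃⟩ ⟨xU_mem h₄, sec_tau_xU p h₄⟩ ⟨xL_mem h₅, sec_tau_xL p h₅⟩
    fun h₆ => sec_tau_xU p (by simpa using h₆.2.1)

/-- Lifts of the diagonal matrices of the first vertex group are inverted by the Weyl element. -/
lemma conj_sec_dg {X : Type*} [Group X] {K : Subgroup S2} {s : S2 → X} (hs : HomOn K s) {w v : ℚˣ}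
    (hw : wt w ∈ K) (hv : dg v ∈ K) :
    s (wt w) * s (dg v) * (s (wt w))⁻¹ = (s (dg v))⁻¹ := by
  rw [← hs _ hw _ hv, ← hs.map_inv hw, ← hs _ (mul_mem hw hv) _ (inv_mem hw), wt_conj_dg, dg_inv,
    hs.map_inv hv]

lemma conj_two_central {X : Type*} [Group X] {a b d z : X} (hz : ∀ y, z * y = y * z)
    (h1 : a * d * a⁻¹ = d⁻¹) (h2 : b * (d * z) * b⁻¹ = (d * z)⁻¹) :
    (b * a) * d * (b * a)⁻¹ = d * z ^ 2 := by
  have h3 : b * d * b⁻¹ = (d * z)⁻¹ * z⁻¹ := by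
    rw [← h2, eq_mul_inv_iff_mul_eq]
    simp only [mul_assoc]
    rw [hz b⁻¹]
  have h4 : (b * a) * d * (b * a)⁻¹ = (b * (a * d * a⁻¹)⁻¹ * b⁻¹)⁻¹ := by group
  rw [h4, h1, inv_inv, h3, mul_inv_rev, inv_inv, inv_inv, hz, mul_assoc, pow_two]

lemma conj_pow_central {X : Type*} [Group X] {D d w : X} (hw : ∀ y, w * y = y * w)
    (h : D * d * D⁻¹ = d * w) (j : ℕ) : D ^ j * d * (D ^ j)⁻¹ = d * w ^ j := by
  induction j with
  | zero => simp
  | succ j ih =>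
    have hc : w ^ j * D⁻¹ = D⁻¹ * w ^ j := (show Commute w D⁻¹ from hw _).pow_left j
    rw [pow_succ', mul_inv_rev, show D * D ^ j * d * ((D ^ j)⁻¹ * D⁻¹) =
      D * (D ^ j * d * (D ^ j)⁻¹) * D⁻¹ by group, ih, mul_assoc, mul_assoc d, hc,
      ← mul_assoc d, ← mul_assoc, ← mul_assoc, h, mul_assoc, ← pow_succ']

/-- The comparison of the two splittings on diagonal matrices. -/
lemma sec_tau_dg {u : S2 → Additive (ZMod p)ˣ}
    (hu' : ∀ g ∈ Gam p (cop p), u g = Additive.ofMul (chi p g)) {g : S2}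
    (hd' : g ∈ Gam p (cop p)) :
    ExtC.sec (tau_coc p) u g =
      ExtC.sec (tau_coc p) 0 g * ExtC.cen _ (-Additive.ofMul (chi p g)) := by
  rw [ExtC.sec_apply _ _ (Subgroup.mem_top _), ExtC.sec_apply _ _ (Subgroup.mem_top _),
      hu' _ hd', ← ExtC.cen_comm]
  ext
  · simp [ExtC.cen]
  · rw [ExtC.cen_mul_q]; simp only [Pi.zero_apply, neg_zero, add_zero]

lemma tame_conj {v : ℚˣ} (hv : (v : ℚ) ∈ ZS (cop p)) (hv' : (v : ℚ)⁻¹ ∈ ZS (cop p)) :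
    ∃ u, CobOn (GT' p (cop p)) (tau p) u ∧
      (∀ g ∈ Gam p (cop p), u g = Additive.ofMul (chi p g)) ∧
      ∃ D : ExtC (tau_coc p), (totE (tau_coc p)).pr D = dg (pu p)⁻¹ ∧
      ∀ j : ℕ, D ^ j * ExtC.sec (tau_coc p) 0 (dg v) * (D ^ j)⁻¹ =
        ExtC.sec (tau_coc p) 0 (dg v) *
          ExtC.cen _ ((2 * j) • -Additive.ofMul (chi p (dg v))) := by
  obtain ⟨u, hu, hu'⟩ := tau_cob p
  have hd := dg_mem hv hv'
  have hd' : dg v ∈ Gam p (cop p) := mem_Gam.2 ⟨hd, by simp [zero_mem]⟩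
  set z : Additive (ZMod p)ˣ := -Additive.ofMul (chi p (dg v)) with hz
  set s := ExtC.sec (tau_coc p) 0 with hs
  set s' := ExtC.sec (tau_coc p) u with hs'
  have hss : s' (dg v) = s (dg v) * ExtC.cen _ z := sec_tau_dg p hu' hd'
  have hw : wt (-1) ∈ GT (cop p) := wt_mem (by simp [one_mem]) (by simp [one_mem])
  have c1 := conj_sec_dg (homOn_sec_tau p) hw hd
  have c2 := conj_sec_dg (ExtC.homOn_sec (tau_coc p) le_top hu)
    (wt_inv_mem_GT' (T := cop p)) hd'.2
  rw [← hs] at c1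
  rw [← hs', hss] at c2
  set b := s' (wt (pu p)⁻¹) with hb
  set a := s (wt (-1)) with ha
  have cz := fun y => ExtC.cen_comm (hx := tau_coc p) z y
  refine ⟨u, hu, hu', b * a, ?_, fun j => ?_⟩
  · have h1 : (totE (tau_coc p)).pr b = wt (pu p)⁻¹ := ExtC.proj_sec _ _ (Subgroup.mem_top _)
    have h2 : (totE (tau_coc p)).pr a = wt (-1) := ExtC.proj_sec _ _ (Subgroup.mem_top _)
    rw [map_mul, h1, h2, wt_mul]
    congr 1
    ext
    simp
    ring
  · rw [conj_pow_central (fun y => by rw [ExtC.cen_pow, ExtC.cen_comm])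
      (conj_two_central cz c1 c2), ExtC.cen_pow, ExtC.cen_pow, mul_comm 2 j, mul_smul]
lemma tame_swap {v : ℚˣ} (hv : (v : ℚ) ∈ ZS (cop p)) (hv' : (v : ℚ)⁻¹ ∈ ZS (cop p)) {k c : ℚ}
    (hkc : (v : ℚ) = 1 + k * c) {j : ℕ} (hk : (p : ℚ) * (p ^ (2 * j) * k) ∈ ZS (cop p))
    (hc : c / p ^ (2 * j) / p ∈ ZS (cop p)) :
    (totE (tau_coc p)).X12 k * (totE (tau_coc p)).X21 c =
      (totE (tau_coc p)).X21 (c / v) * ExtC.sec (tau_coc p) 0 (dg v) *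
        (totE (tau_coc p)).X12 (k / v) *
        ExtC.cen _ ((2 * j + 1) • -Additive.ofMul (chi p (dg v))) := by
  obtain ⟨u, hu, hu', D, hD, hDj⟩ := tame_conj p hv hv'
  have hp0 := p_ne p
  have hs := ExtC.homOn_sec (tau_coc p) le_top hu
  have hd' : dg v ∈ Gam p (cop p) := mem_Gam.2 ⟨dg_mem hv hv', by simp [zero_mem]⟩
  have hss := sec_tau_dg p hu' hd'
  have hpr : (totE (tau_coc p)).pr (D ^ j) = dg ((pu p)⁻¹ ^ j) := by rw [map_pow, hD, dg_pow]
  have e1 : ∀ a, D ^ j * (totE (tau_coc p)).X12 (p ^ (2 * j) * a) * (D ^ j)⁻¹ =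
      (totE (tau_coc p)).X12 a := by
    intro a
    rw [CExt.conj_dg_X12 _ good_pri (mem_pri _) hpr]
    congr 1
    simp
    field_simp
    ring
  have e2 : ∀ a, D ^ j * (totE (tau_coc p)).X21 (a / p ^ (2 * j)) * (D ^ j)⁻¹ =
      (totE (tau_coc p)).X21 a := by
    intro a
    rw [CExt.conj_dg_X21 _ good_pri (mem_pri _) hpr]
    congr 1
    simp
    field_simp
    ring
  have hk2 : (p : ℚ) * (p ^ (2 * j) * (k / v)) ∈ ZS (cop p) := by
    convert mul_mem hk hv' using 1; field_simp
  have hc2 : c / v / p ^ (2 * j) / p ∈ ZS (cop p) := by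
    convert mul_mem hc hv' using 1; field_simp
  have hm : xU (p ^ (2 * j) * k) * xL (c / p ^ (2 * j)) =
      xL (c / v / p ^ (2 * j)) * dg v * xU (p ^ (2 * j) * (k / v)) := by
    have hv0 : (v : ℚ) ≠ 0 := v.ne_zero
    apply S2_ext <;> simp <;> field_simp
    · rw [hkc]
    · rw [hkc]; ring
  have key := hs _ (xU_mem_GT' p hk) _ (xL_mem_GT' p hc)
  rw [hm, hs _ (mul_mem (xL_mem_GT' p hc2) hd'.2) _ (xU_mem_GT' p hk2),
    hs _ (xL_mem_GT' p hc2) _ hd'.2, sec_tau_xL' p hu hc2, sec_tau_xU' p hu hk2,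
    sec_tau_xL' p hu hc, sec_tau_xU' p hu hk, hss] at key
  rw [← e1 k, ← e2 c, ← e1 (k / v), ← e2 (c / v)]
  have h1 := hDj j
  generalize ExtC.sec (tau_coc p) 0 (dg v) = d at *
  rw [add_smul, one_smul, ← ExtC.cen_mul]
  have cz := fun y => ExtC.cen_comm (hx := tau_coc p) (-Additive.ofMul (chi p (dg v))) y
  have cw := fun y => ExtC.cen_comm (hx := tau_coc p) ((2 * j) • -Additive.ofMul (chi p (dg v))) y
  generalize ExtC.cen (tau_coc p) (-Additive.ofMul (chi p (dg v))) = z at *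
  generalize ExtC.cen (tau_coc p) ((2 * j) • -Additive.ofMul (chi p (dg v))) = w at *
  generalize D ^ j = D' at *
  generalize (totE (tau_coc p)).X12 (p ^ (2 * j) * k) = A at *
  generalize (totE (tau_coc p)).X21 (c / p ^ (2 * j)) = B at *
  generalize (totE (tau_coc p)).X12 (p ^ (2 * j) * (k / v)) = A' at *
  generalize (totE (tau_coc p)).X21 (c / v / p ^ (2 * j)) = B' at *
  calc D' * A * D'⁻¹ * (D' * B * D'⁻¹) = D' * (A * B) * D'⁻¹ := by group
    _ = D' * (B' * (d * z) * A') * D'⁻¹ := by rw [key]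
    _ = D' * B' * d * (z * (A' * D'⁻¹)) := by simp only [mul_assoc]
    _ = D' * B' * d * (A' * D'⁻¹) * z := by rw [cz]; simp only [mul_assoc]
    _ = D' * B' * D'⁻¹ * (D' * d * D'⁻¹) * (D' * A' * D'⁻¹) * z := by group
    _ = D' * B' * D'⁻¹ * d * (w * (D' * A' * D'⁻¹)) * z := by rw [h1]; simp only [mul_assoc]
    _ = _ := by rw [cw]; simp only [mul_assoc]

/-- The value of the word at the prime `p`. -/
lemma Wd.tame {c' k₂ σ k₁ c y : ℚ} (h : Wd c' k₂ σ k₁ c y) (h₁ : c' ∈ ZS (cop p))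
    (h₂ : k₂ ∈ ZS (cop p)) (h₃ : σ ∈ ZS (cop p)) {v : ℚˣ} (hv : (v : ℚ) ∈ ZS (cop p))
    (hv' : (v : ℚ)⁻¹ ∈ ZS (cop p)) (hkc : (v : ℚ) = 1 + k₁ * c) {j : ℕ}
    (hk : (p : ℚ) * (p ^ (2 * j) * k₁) ∈ ZS (cop p)) (hc : c / p ^ (2 * j) / p ∈ ZS (cop p)) :
    (totE (tau_coc p)).wd c' k₂ σ k₁ c y =
      ExtC.cen _ ((2 * j + 1) • -Additive.ofMul (chi p (dg v))) := by
  have hs := homOn_sec_tau p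
  have hp0 := p_ne p
  have hcv : c / v ∈ ZS (cop p) := by
    convert mul_mem (mul_mem hc hv') (natCast_mem (ZS (cop p)) (p ^ (2 * j) * p)) using 1
    push_cast; field_simp
  rw [CExt.wd, tame_swap p hv hv' hkc hk hc]
  generalize hw : ExtC.cen (tau_coc p) ((2 * j + 1) • -Additive.ofMul (chi p (dg v))) = w
  have cw : ∀ y, w * y = y * w := fun y => by rw [← hw, ExtC.cen_comm]
  have hm : xL c' * xU k₂ * xL σ * (xL (c / v) * dg v) * xU (k₁ / v - y) = 1 := by
    rw [← h.eq, sub_eq_add_neg, xU_add]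
    have : xU k₁ * xL c = xL (c / v) * dg v * xU (k₁ / v) := by
      have hv0 : (v : ℚ) ≠ 0 := v.ne_zero
      apply S2_ext <;> simp <;> field_simp
      · rw [hkc]
      · rw [hkc]; ring
    rw [this]; simp only [mul_assoc]
  have m1 := xL_mem h₁
  have m2 := xU_mem h₂
  have m3 := xL_mem h₃
  have m4 := xL_mem hcv
  have m5 := dg_mem hv hv'
  have m12 := mul_mem m1 m2
  have m123 := mul_mem m12 m3
  have m45 := mul_mem m4 m5
  have m15 := mul_mem m123 m45
  have m6 : xU (k₁ / v - y) ∈ GT (cop p) := by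
    rw [eq_inv_of_mul_eq_one_right hm]; exact inv_mem m15
  have h6 : k₁ / v - y ∈ ZS (cop p) := by simpa using m6.2.1
  have key := hs _ m15 _ m6
  rw [hm, hs.map_one, hs _ m123 _ m45, hs _ m12 _ m3, hs _ m1 _ m2, hs _ m4 _ m5, sec_tau_xL p h₁,
    sec_tau_xU p h₂, sec_tau_xL p h₃, sec_tau_xL p hcv, sec_tau_xU p h6, sub_eq_add_neg,
    CExt.X12_add _ good_pri (mem_pri _) (mem_pri _)] at key
  calc _ = (totE (tau_coc p)).X21 c' * (totE (tau_coc p)).X12 k₂ * (totE (tau_coc p)).X21 σ *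
      ((totE (tau_coc p)).X21 (c / v) * ExtC.sec (tau_coc p) 0 (dg v)) *
        ((totE (tau_coc p)).X12 (k₁ / v) * (totE (tau_coc p)).X12 (-y)) * w := by
        simp only [mul_assoc]; rw [cw]
    _ = w := by rw [← key, one_mul]
end tame

/-! ### Non-degeneracy -/

section nondeg
variable {Q : Type} [AddCommGroup Q]

/-- A combination of the winding cocycle and the tame cocycles. -/
def kap (T : Finset ℕ) (c : Q) (ψ : ∀ l : ℕ, Additive (ZMod l)ˣ →+ Q) (g h : S2) : Q :=
  Wc g h • c + ∑ l ∈ T, ψ l (tau l g h)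

lemma kap_coc (T : Finset ℕ) (c : Q) (ψ : ∀ l : ℕ, Additive (ZMod l)ˣ →+ Q) :
    IsCoc ⊤ (kap T c ψ) := by
  intro g hg h hh k hk
  have h1 := Wc_coc ⊤ g hg h hh k hk
  have h2 : ∑ l ∈ T, (ψ l (tau l g h) + ψ l (tau l (g * h) k)) =
      ∑ l ∈ T, (ψ l (tau l h k) + ψ l (tau l g (h * k))) := by
    refine Finset.sum_congr rfl fun l _ => ?_
    rw [← map_add, ← map_add, tau_coc l g hg h hh k hk]
  rw [Finset.sum_add_distrib, Finset.sum_add_distrib] at h2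
  simp only [kap]
  rw [add_add_add_comm, h2, ← add_smul, h1, add_smul, add_add_add_comm]

/-- The universal combination. -/
def kapU (T : Finset ℕ) (g h : S2) : ℤ × (∀ l : T, Additive (ZMod (l : ℕ))ˣ) :=
  (Wc g h, fun l => tau l g h)

lemma kapU_coc (T : Finset ℕ) : IsCoc ⊤ (kapU T) := by
  intro g hg h hh k hk
  exact Prod.ext (Wc_coc ⊤ g hg h hh k hk) (funext fun l => tau_coc l g hg h hh k hk)

lemma wd_kap {T : Finset ℕ} (a : Q) (ψ : ∀ l : ℕ, Additive (ZMod l)ˣ →+ Q) {c' k₂ σ k₁ c y : ℚ}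
    (h : Wd c' k₂ σ k₁ c y) {r : ℤ} (hr : (totE (Wc_coc ⊤)).wd c' k₂ σ k₁ c y = ExtC.cen _ r)
    {ρ : ∀ l : ℕ, Additive (ZMod l)ˣ}
    (hρ : ∀ l ∈ T, (totE (tau_coc l)).wd c' k₂ σ k₁ c y = ExtC.cen _ (ρ l)) :
    (totE (kap_coc T a ψ)).wd c' k₂ σ k₁ c y = ExtC.cen _ (r • a + ∑ l ∈ T, ψ l (ρ l)) := by
  obtain ⟨v, hv⟩ := ExtC.eq_cen (h.pr (totE (kapU_coc T)))
  have key : ∀ {Q' : Type} [AddCommGroup Q'] {x' : S2 → S2 → Q'} (hx' : IsCoc ⊤ x')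
      (φ : ℤ × (∀ l : T, Additive (ZMod (l : ℕ))ˣ) →+ Q') (h : ∀ a b, x' a b = φ (kapU T a b)),
      (totE hx').wd c' k₂ σ k₁ c y = ExtC.cen hx' (φ v) := by
    intro Q' _ x' hx' φ h
    rw [← ExtC.mapE_cen (hx := kapU_coc T) fun a _ b _ => h a b, ← hv]
    exact (CExt.map_wd _ _ _ (fun a => rfl) _ _ _ _ _ _).symm
  have h1 := key (Wc_coc ⊤) (AddMonoidHom.fst _ _) (fun _ _ => rfl)
  rw [hr, ExtC.cen_inj] at h1
  have h2 : ∀ l (hl : l ∈ T), ρ l = v.2 ⟨l, hl⟩ := by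
    intro l hl
    have := key (tau_coc l) ((Pi.evalAddMonoidHom
      (fun l : T => Additive (ZMod (l : ℕ))ˣ) ⟨l, hl⟩).comp (AddMonoidHom.snd _ _))
      (fun _ _ => rfl)
    rwa [hρ l hl, ExtC.cen_inj] at this
  have h3 := key (kap_coc T a ψ)
    ((zmultiplesHom Q a).comp (AddMonoidHom.fst _ _) +
      (∑ l : T, (ψ l).comp (Pi.evalAddMonoidHom _ l)).comp (AddMonoidHom.snd _ _)) (by
      intro g h
      simp [kap, kapU, ← Finset.sum_coe_sort T])
  rw [h3, h1, ExtC.cen_inj]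
  simp only [AddMonoidHom.add_apply, zmultiplesHom_apply, AddMonoidHom.coe_fst,
    AddMonoidHom.comp_apply, AddMonoidHom.coe_snd, AddMonoidHom.finsetSum_apply,
    Pi.evalAddMonoidHom_apply]
  rw [← Finset.sum_coe_sort T]
  congr 1
  exact Finset.sum_congr rfl fun (l : T) _ => by rw [h2 l l.2]

variable {T : Finset ℕ} {q : ℕ} [hq : Fact q.Prime]

lemma wd_eq_one {Q : Type} [AddCommGroup Q] {T : Set ℕ} (hT : Good T) {x : S2 → S2 → Q}
    (hx : IsCoc ⊤ x) {t : S2 → Q} (ht : CobOn (Gam q T) x t) {c' k₂ σ k₁ c y : ℚ}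
    (h : Wd c' k₂ σ k₁ c y) (h₁ : c' / (q : ℚ) ∈ ZS T)
    (h₂ : k₂ ∈ ZS T) (h₃ : σ / (q : ℚ) ∈ ZS T) (h₄ : k₁ ∈ ZS T) (h₅ : c / (q : ℚ) ∈ ZS T) :
    (totE hx).wd c' k₂ σ k₁ c y = 1 := by
  have hs := ExtC.homOn_sec hx le_top ht
  have hp : ∀ g ∈ Gam q T, (totE hx).pr (ExtC.sec hx t g) = g :=
    fun g _ => ExtC.proj_sec _ _ (Subgroup.mem_top g)
  have hU : ∀ a ∈ ZS T, xU a ∈ Gam q T := fun a ha =>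
    mem_Gam.2 ⟨xU_mem ha, by simp [zero_mem]⟩
  have hL : ∀ a, a / (q : ℚ) ∈ ZS T → xL a ∈ Gam q T := fun a ha =>
    mem_Gam.2 ⟨xL_mem (by
      have := mul_mem ha (natCast_mem (ZS T) q)
      rwa [div_mul_cancel₀ _ (p_ne q)] at this), by simpa using ha⟩
  have h2 : dg u2 ∈ Gam q T := mem_Gam.2 ⟨hT.dg2, by simp [zero_mem]⟩
  have hU' : ∀ a ∈ ZS T, xU a ∈ Gam q T ∧ ExtC.sec hx t (xU a) = (totE hx).X12 a :=
    fun a ha => ⟨hU a ha, (totE hx).section_X12 hs hp h2 (hU _ (hT.div3 ha))⟩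
  have hL' : ∀ a, a / (q : ℚ) ∈ ZS T → xL a ∈ Gam q T ∧ ExtC.sec hx t (xL a) = (totE hx).X21 a :=
    fun a ha => ⟨hL a ha, (totE hx).section_X21 hs hp h2 (hL _ (by
      rw [div_right_comm]; exact hT.div3 ha))⟩
  exact h.eq_one _ hs (hL' _ h₁) (hU' _ h₂) (hL' _ h₃) (hU' _ h₄) (hL' _ h₅)
    fun h₆ => (hU' _ (by simpa using h₆.1.2.1)).2

lemma wd_mk_int {q u u' N m s : ℚ} (hq : q ≠ 0) (hu : u ≠ 0) (hu' : u' ≠ 0) (hN : N ≠ 0)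
    (hm : N + 1 = q * m) (hs : u + u' = N * s) :
    Wd (q * u') (-(m / u')) (q * s) (-(m / u)) (q * u)
      (-(m / u) + -(m / u') * (1 + q * s * -(m / u))) := by
  have h := wd_mk hq hu hu' hN
  have e1 : -(N + 1) / (q * u') = -(m / u') := by rw [hm]; field_simp
  have e2 : -(N + 1) / (q * u) = -(m / u) := by rw [hm]; field_simp
  have e3 : q * (u + u') / N = q * s := by rw [hs]; field_simp
  rwa [e1, e2, e3] at h

lemma exists_two_pow (n : ℕ) (hn : n.Prime) (h8 : (8 : ℤ) ∣ n - 3) :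
    ∃ s : ℤ, (1 : ℤ) + 2 ^ (n / 2) = n * s := by
  have := Fact.mk hn
  have h83 : n % 8 = 3 := by omega
  have hn2 : n ≠ 2 := by omega
  have h2 : (2 : ZMod n) ≠ 0 := by
    intro h
    have h' : ((2 : ℕ) : ZMod n) = 0 := by exact_mod_cast h
    rw [ZMod.natCast_eq_zero_iff] at h'
    have := Nat.le_of_dvd (by norm_num) h'
    omega
  have h1 : ¬ IsSquare (2 : ZMod n) := by
    rw [ZMod.exists_sq_eq_two_iff hn2]; omega
  have h3 : (2 : ZMod n) ^ (n / 2) = -1 := by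
    rcases ZMod.pow_div_two_eq_neg_one_or_one n h2 with h | h
    · exact absurd ((ZMod.euler_criterion n h2).2 h) h1
    · exact h
  have h4 : (((1 + 2 ^ (n / 2) : ℤ)) : ZMod n) = 0 := by
    push_cast; rw [h3]; ring
  exact (ZMod.intCast_zmod_eq_zero_iff_dvd _ _).1 h4

lemma exists_pow_unit (l n : ℕ) (hn : n.Prime) (h : ¬ n ∣ l) :
    ∃ ε s : ℤ, (ε = 1 ∨ ε = -1) ∧ (l : ℤ) ^ (n / 2) + ε = n * s := by
  have := Fact.mk hn
  have h2 : (l : ZMod n) ≠ 0 := by rwa [Ne, ZMod.natCast_eq_zero_iff]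
  rcases ZMod.pow_div_two_eq_neg_one_or_one n h2 with h | h
  · have h4 : (((l : ℤ) ^ (n / 2) + -1 : ℤ) : ZMod n) = 0 := by
      push_cast; rw [h]; ring
    obtain ⟨s, hs⟩ := (ZMod.intCast_zmod_eq_zero_iff_dvd _ _).1 h4
    exact ⟨-1, s, Or.inr rfl, hs⟩
  · have h4 : (((l : ℤ) ^ (n / 2) + 1 : ℤ) : ZMod n) = 0 := by
      push_cast; rw [h]; ring
    obtain ⟨s, hs⟩ := (ZMod.intCast_zmod_eq_zero_iff_dvd _ _).1 h4
    exact ⟨1, s, Or.inl rfl, hs⟩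

lemma exists_cen_two {c' k₂ σ k₁ c y : ℚ} (h : Wd c' k₂ σ k₁ c y) :
    (totE (tau_coc 2)).wd c' k₂ σ k₁ c y = ExtC.cen _ 0 := by
  obtain ⟨v, hv⟩ := ExtC.eq_cen (h.pr (totE (tau_coc 2)))
  have : v.toMul = 1 := by
    generalize v.toMul = w
    revert w; decide
  rw [hv, show v = 0 from this]

theorem nondeg_winding (hT : Good (T : Set ℕ)) (hqT : q ∉ T) {a : Q}
    {ψ : ∀ l : ℕ, Additive (ZMod l)ˣ →+ Q} {t : S2 → Q} (ht : CobOn (Gam q T) (kap T a ψ) t) :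
    a = 0 := by
  have hq2 : q ≠ 2 := fun h => hqT (by rw [h]; exact_mod_cast hT.two)
  have hco : IsCoprime (8 : ℤ) q := by
    rw [show (8 : ℤ) = ((8 : ℕ) : ℤ) by rfl, Nat.isCoprime_iff_coprime]
    exact ((Nat.coprime_primes Nat.prime_two hq.out).2 hq2.symm).pow_left 3
  obtain ⟨N, -, hN, h8, ⟨m, hm⟩⟩ := exists_prime_zmodEq₂ (a := 3) (c := 8) (b := -1) (d := q)
    (by norm_num) (by exact_mod_cast hq.out.ne_zero) (by norm_num)
    (isCoprime_one_left.neg_left) hco 0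
  obtain ⟨s, hs⟩ := exists_two_pow N hN h8
  have hm' : (N : ℚ) + 1 = q * m := by have : (N : ℤ) + 1 = q * m := by linarith
                                       exact_mod_cast this
  have hs' : (1 : ℚ) + 2 ^ (N / 2) = N * s := by exact_mod_cast hs
  have hN0 : (N : ℚ) ≠ 0 := by exact_mod_cast hN.ne_zero
  have hq0 := p_ne q
  have hqp : (0 : ℚ) < q := by exact_mod_cast hq.out.pos
  have hW := wd_mk_int hq0 one_ne_zero (by positivity) hN0 hm' hs'
  have hsp : (0 : ℚ) < s := by
    have h1 : (0 : ℚ) < N * s := by rw [← hs']; positivity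
    exact (pos_iff_pos_of_mul_pos h1).1 (by exact_mod_cast hN.pos)
  have iz : ∀ (S : Set ℕ) (z : ℤ), (z : ℚ) ∈ ZS S := fun S z => intCast_mem _ _
  have m2 : ∀ S : Set ℕ, 2 ∈ S → -((m : ℚ) / 2 ^ (N / 2)) ∈ ZS S := by
    intro S hS
    rw [div_eq_mul_inv, ← inv_pow]
    exact neg_mem (mul_mem (iz _ _) (pow_mem (by exact_mod_cast inv_prime_mem hS) _))
  have key := wd_kap a ψ hW (hW.winding (by positivity) (by positivity) (by positivity))
    (ρ := fun l => 0) (by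
      intro l hl
      have := Fact.mk (hT.prime l hl)
      by_cases hl2 : l = 2
      · subst hl2; exact exists_cen_two hW
      · rw [ExtC.cen_zero]
        refine hW.tame_one l ?_ (m2 _ ⟨Nat.prime_two, Ne.symm hl2⟩) ?_ ?_ ?_
        · exact_mod_cast iz _ (q * 2 ^ (N / 2))
        · exact_mod_cast iz _ (q * s)
        · rw [div_one]; exact_mod_cast iz _ (-m)
        · rw [mul_one]; exact_mod_cast iz _ q)
  rw [wd_eq_one hT _ ht hW, ← ExtC.cen_zero, ExtC.cen_inj] at key
  · simpa using key.symm
  · rw [mul_div_cancel_left₀ _ hq0]; exact_mod_cast iz _ (2 ^ (N / 2))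
  · exact m2 _ hT.two
  · rw [mul_div_cancel_left₀ _ hq0]; exact iz _ s
  · rw [div_one]; exact_mod_cast iz _ (-m)
  · rw [mul_div_cancel_left₀ _ hq0]; exact one_mem _


lemma units_zmod_two : ∀ y : (ZMod 2)ˣ, y = 1 := by decide

theorem nondeg_tame (hT : Good (T : Set ℕ)) (hqT : q ∉ T) {a : Q}
    {ψ : ∀ l : ℕ, Additive (ZMod l)ˣ →+ Q} {t : S2 → Q} (ht : CobOn (Gam q T) (kap T a ψ) t) :
    ∀ l ∈ T, ψ l = 0 := by
  have ha := nondeg_winding hT hqT ht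
  intro l hl
  have hlp := hT.prime l hl
  have := Fact.mk hlp
  refine AddMonoidHom.ext fun x' => ?_
  suffices H : ∀ x : (ZMod l)ˣ, ψ l (Additive.ofMul x) = 0 from H x'.toMul
  intro x
  by_cases hl2 : l = 2
  · subst hl2
    rw [units_zmod_two x]; exact map_zero (ψ 2)
  have hql : q ≠ l := fun h => hqT (h ▸ hl)
  have hq2 : q ≠ 2 := fun h => hqT (by rw [h]; exact_mod_cast hT.two)
  have hx : ((x : ZMod l).val : ZMod l) = x := ZMod.natCast_zmod_val _
  have hxl : IsCoprime (-((x : ZMod l).val : ℤ)) l :=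
    (Nat.isCoprime_iff_coprime.2 (ZMod.val_coe_unit_coprime x)).neg_left
  have hl1 : 2 < l := lt_of_le_of_ne hlp.two_le (Ne.symm hl2)
  have hco : IsCoprime (l : ℤ) ((4 * (l - 1) * q : ℕ) : ℤ) := by
    rw [Nat.isCoprime_iff_coprime]
    refine Nat.Coprime.mul_right (Nat.Coprime.mul_right ?_ ?_) ?_
    · exact ((Nat.coprime_primes hlp Nat.prime_two).2 hl2).pow_right 2
    · rw [Nat.Prime.coprime_iff_not_dvd hlp]
      intro h
      have := Nat.le_of_dvd (by omega) h
      omega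
    · exact (Nat.coprime_primes hlp hq.out).2 hql.symm
  obtain ⟨N, hNl, hN, hNx, ⟨m₀, hm₀⟩⟩ := exists_prime_zmodEq₂ (a := -((x : ZMod l).val : ℤ))
    (c := l) (b := -1) (d := (4 * (l - 1) * q : ℕ)) (by exact_mod_cast hlp.ne_zero)
    (by
      have := hq.out.pos
      have : 0 < 4 * (l - 1) * q := by
        have : 0 < l - 1 := by omega
        positivity
      exact_mod_cast this.ne')
    hxl (isCoprime_one_left.neg_left) hco l
  have hNnl : ¬ N ∣ l := fun h => by have := Nat.le_of_dvd hlp.pos h; omega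
  obtain ⟨ε, s, hε, hs⟩ := exists_pow_unit l N hN hNnl
  set m : ℤ := 4 * ((l - 1 : ℕ) : ℤ) * m₀ with hmdef
  have hmz : (N : ℤ) + 1 = q * m := by rw [hmdef]; push_cast at hm₀ ⊢; linarith
  have hm' : (N : ℚ) + 1 = q * m := by exact_mod_cast hmz
  have hs' : (l : ℚ) ^ (N / 2) + ε = N * s := by exact_mod_cast hs
  have hN0 : (N : ℚ) ≠ 0 := by exact_mod_cast hN.ne_zero
  have hq0 := p_ne q
  have hl0 := p_ne l
  have hε0 : (ε : ℚ) ≠ 0 := by rcases hε with rfl | rfl <;> norm_num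
  have hεi : (ε : ℚ)⁻¹ = ε := by rcases hε with rfl | rfl <;> norm_num
  have hW := wd_mk_int hq0 (pow_ne_zero _ hl0) hε0 hN0 hm' hs'
  have iz : ∀ (S : Set ℕ) (z : ℤ), (z : ℚ) ∈ ZS S := fun S z => intCast_mem _ _
  have m2 : ∀ S : Set ℕ, -((m : ℚ) / ε) ∈ ZS S := by
    intro S
    rw [div_eq_mul_inv, hεi]
    exact_mod_cast iz _ (-(m * ε))
  have m4 : ∀ S : Set ℕ, l ∈ S → -((m : ℚ) / l ^ (N / 2)) ∈ ZS S := by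
    intro S hS
    rw [div_eq_mul_inv, ← inv_pow]
    exact neg_mem (mul_mem (iz _ _) (pow_mem (inv_prime_mem hS) _))
  obtain ⟨r, hr⟩ := ExtC.eq_cen (hW.pr (totE (Wc_coc ⊤)))
  have h4 : N % 4 = 3 := by
    have : (4 : ℤ) ∣ N + 1 := ⟨q * (((l - 1 : ℕ) : ℤ) * m₀), by rw [hmz, hmdef]; ring⟩
    omega
  obtain ⟨j, hj⟩ : ∃ j, N / 2 = 2 * j + 1 := ⟨N / 4, by omega⟩
  have key := wd_kap a ψ hW hr (ρ := Pi.single l (Additive.ofMul x)) (by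
      intro l' hl'
      have hlp' := hT.prime l' hl'
      have := Fact.mk hlp'
      by_cases hll : l' = l
      · subst hll
        rw [Pi.single_eq_same]
        have hvi : ((Units.mk0 (-(N : ℚ)) (neg_ne_zero.2 hN0) : ℚˣ) : ℚ)⁻¹ ∈ ZS (cop l') := by
          rw [Units.val_mk0, inv_neg]
          exact neg_mem (inv_prime_mem ⟨hN, by omega⟩)
        have hv : ((Units.mk0 (-(N : ℚ)) (neg_ne_zero.2 hN0) : ℚˣ) : ℚ) ∈ ZS (cop l') := by
          rw [Units.val_mk0]; exact_mod_cast iz _ (-N)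
        rw [hW.tame l' ?_ (m2 _) ?_ hv hvi (j := j) ?_ ?_ ?_]
        · congr 1
          have hchi : chi l' (dg (Units.mk0 (-(N : ℚ)) (neg_ne_zero.2 hN0))) = x := by
            ext
            rw [chi_val l' (cop_prime l') (notMem_cop l')
              (mem_Gam.2 ⟨dg_mem hv hvi, by simp [zero_mem]⟩), dg_00, Units.val_mk0]
            obtain ⟨w, hw⟩ := hNx
            have e : ((-(N : ℤ) : ℤ) : ZMod l') = x := by
              rw [show -(N : ℤ) = ((x : ZMod l').val : ℤ) - l' * w by linarith]
              push_cast
              rw [hx]; simp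
            rw [← e, ← Rat.cast_intCast (α := ZMod l')]
            push_cast; rfl
          rw [hchi]
          have e1 : (l' - 1) • Additive.ofMul x = 0 := ZMod.units_pow_card_sub_one_eq_one l' x
          have e2 : (2 * j + 1 + 1) • Additive.ofMul x = 0 := by
            have : ((2 * j + 1 + 1 : ℕ) : ℤ) = 2 * q * m₀ * ((l' - 1 : ℕ) : ℤ) := by
              have : (N : ℤ) + 1 = 2 * ((2 * j + 1 + 1 : ℕ) : ℤ) := by omega
              rw [hmz, hmdef] at this
              linarith
            rw [← natCast_zsmul, this, mul_smul, natCast_zsmul, e1, smul_zero]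
          have e3 : ((2 * j + 1) • -Additive.ofMul x : Additive (ZMod l')ˣ) = Additive.ofMul x := by
            refine (neg_nsmul (Additive.ofMul x) (2 * j + 1)).trans ?_
            rw [neg_eq_iff_add_eq_zero]
            exact (succ_nsmul (Additive.ofMul x) (2 * j + 1)).symm.trans e2
          exact e3
        · exact_mod_cast iz _ (q * ε)
        · exact_mod_cast iz _ (q * s)
        · rw [Units.val_mk0]; field_simp; linarith
        · rw [hj]
          convert iz _ (-m) using 1
          push_cast; field_simp; ring
        · rw [hj]
          convert iz _ (q : ℤ) using 1
          push_cast; field_simp; ring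
      · rw [Pi.single_eq_of_ne hll, ExtC.cen_zero]
        refine hW.tame_one l' ?_ (m2 _) ?_ (m4 _ ⟨hlp, Ne.symm hll⟩) ?_
        · exact_mod_cast iz _ (q * ε)
        · exact_mod_cast iz _ (q * s)
        · exact_mod_cast iz _ (q * l ^ (N / 2)))
  rw [wd_eq_one hT _ ht hW, ← ExtC.cen_zero, ExtC.cen_inj, ha, smul_zero, zero_add,
    Finset.sum_eq_single l] at key
  · rw [Pi.single_eq_same] at key
    exact key.symm
  · intro b _ hb
    rw [Pi.single_eq_of_ne hb, map_zero]
  · exact fun h => absurd hl h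
  · rw [mul_div_cancel_left₀ _ hq0]; exact iz _ _
  · exact m2 _
  · rw [mul_div_cancel_left₀ _ hq0]; exact iz _ s
  · exact m4 _ hl
  · rw [mul_div_cancel_left₀ _ hq0]; exact_mod_cast iz _ (l ^ (N / 2))
end nondeg

/-! ### Presentation of `SL₂(ℤ)` -/

lemma exists_homOn_zpowers {Y X : Type*} [Group Y] [Group X] (a : Y) (b : X)
    (h : ∀ n : ℤ, a ^ n = 1 → b ^ n = 1) :
    ∃ f : Y → X, HomOn (Subgroup.zpowers a) f ∧ ∀ n : ℤ, f (a ^ n) = b ^ n := by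
  classical
  have key : ∀ n m : ℤ, a ^ n = a ^ m → b ^ n = b ^ m := by
    intro n m e
    have := h (n - m) (by rw [zpow_sub, e, mul_inv_cancel])
    rwa [zpow_sub, mul_inv_eq_one] at this
  let f : Y → X := fun g => if hg : ∃ n : ℤ, a ^ n = g then b ^ hg.choose else 1
  have hf : ∀ n : ℤ, f (a ^ n) = b ^ n := by
    intro n
    have hg : ∃ m : ℤ, a ^ m = a ^ n := ⟨n, rfl⟩
    simp only [f, dif_pos hg]
    exact key _ _ hg.choose_spec
  refine ⟨f, ?_, hf⟩
  rintro g hg k hk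
  obtain ⟨n, rfl⟩ := Subgroup.mem_zpowers_iff.1 hg
  obtain ⟨m, rfl⟩ := Subgroup.mem_zpowers_iff.1 hk
  rw [← zpow_add, hf, hf, hf, zpow_add]

/-- The standard element of order 6. -/
def ord6 : S2 := xU 1 * xL (-1)

lemma wt_one_sq : wt 1 ^ (2 : ℤ) = -1 := by
  rw [zpow_ofNat, pow_two]; apply S2_ext <;> simp

lemma ord6_cube : ord6 ^ (3 : ℤ) = -1 := by
  rw [zpow_ofNat, pow_succ, pow_two]; apply S2_ext <;> simp [ord6]

lemma neg_one_zpow_S2 (n : ℤ) : (-1 : S2) ^ n = 1 ∧ Even n ∨ (-1 : S2) ^ n = -1 ∧ Odd n := by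
  rcases Int.even_or_odd n with h | h
  · exact Or.inl ⟨h.neg_one_zpow, h⟩
  · exact Or.inr ⟨h.neg_one_zpow, h⟩

lemma zpow_wt_one (n : ℤ) : (∃ k : ℤ, n = 4 * k ∧ wt 1 ^ n = 1) ∨
    (∃ k : ℤ, n = 4 * k + 2 ∧ wt 1 ^ n = -1) ∨ wt 1 ^ n = wt 1 ∨ wt 1 ^ n = -wt 1 := by
  obtain ⟨k, rfl | rfl⟩ := Int.even_or_odd' n
  · rw [zpow_mul, wt_one_sq]
    rcases neg_one_zpow_S2 k with ⟨h, m, hm⟩ | ⟨h, m, hm⟩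
    · exact Or.inl ⟨m, by omega, h⟩
    · exact Or.inr (Or.inl ⟨m, by omega, h⟩)
  · rw [zpow_add, zpow_mul, wt_one_sq, zpow_one]
    rcases neg_one_zpow_S2 k with ⟨h, -⟩ | ⟨h, -⟩ <;> rw [h] <;> simp

lemma zpow_ord6 (n : ℤ) : (∃ k : ℤ, n = 6 * k ∧ ord6 ^ n = 1) ∨
    (∃ k : ℤ, n = 6 * k + 3 ∧ ord6 ^ n = -1) ∨ ord6 ^ n = ord6 ∨ ord6 ^ n = -ord6 ∨
    ord6 ^ n = ord6 * ord6 ∨ ord6 ^ n = -(ord6 * ord6) := by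
  obtain ⟨k, hk⟩ : ∃ k, n = 3 * k ∨ n = 3 * k + 1 ∨ n = 3 * k + 2 := ⟨n / 3, by omega⟩
  rcases hk with rfl | rfl | rfl
  · rw [zpow_mul, ord6_cube]
    rcases neg_one_zpow_S2 k with ⟨h, m, hm⟩ | ⟨h, m, hm⟩
    · exact Or.inl ⟨m, by omega, h⟩
    · exact Or.inr (Or.inl ⟨m, by omega, h⟩)
  · rw [zpow_add, zpow_mul, ord6_cube, zpow_one]
    rcases neg_one_zpow_S2 k with ⟨h, -⟩ | ⟨h, -⟩ <;> rw [h] <;> simp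
  · rw [zpow_add, zpow_mul, ord6_cube, zpow_ofNat, pow_two]
    rcases neg_one_zpow_S2 k with ⟨h, -⟩ | ⟨h, -⟩ <;> rw [h] <;> simp

lemma ord6_e : ord6 0 0 = 0 ∧ ord6 0 1 = 1 ∧ ord6 1 0 = -1 ∧ ord6 1 1 = 1 := by
  simp [ord6]

lemma zpow_inter {g : S2} (h₁ : g ∈ Subgroup.zpowers (wt 1)) (h₂ : g ∈ Subgroup.zpowers ord6) :
    g = 1 ∨ g = -1 := by
  obtain ⟨n, hn⟩ := Subgroup.mem_zpowers_iff.1 h₁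
  obtain ⟨m, hm⟩ := Subgroup.mem_zpowers_iff.1 h₂
  obtain ⟨e1, e2, e3, e4⟩ := ord6_e
  rcases zpow_wt_one n with ⟨k, -, h⟩ | ⟨k, -, h⟩ | h | h <;>
    rcases zpow_ord6 m with ⟨k', -, h'⟩ | ⟨k', -, h'⟩ | h' | h' | h' | h' <;>
    rw [hn] at h <;> rw [hm] at h'
  all_goals first
    | exact Or.inl h
    | exact Or.inr h
    | exact Or.inl h'
    | exact Or.inr h'
    | skip
  all_goals
    exfalso
    have h00 := congrArg (fun g : S2 => g 0 0) (h.symm.trans h')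
    have h11 := congrArg (fun g : S2 => g 1 1) (h.symm.trans h')
    simp [e1, e2, e3, e4] at h00 h11

lemma amalg_zpowers : Amalg (Subgroup.zpowers (wt 1)) (Subgroup.zpowers ord6) := by
  obtain ⟨e1, e2, e3, e4⟩ := ord6_e
  refine amalg_of_pingpong _ _ actv actv_mul {v | v.1 * v.2 < 0} {v | 0 < v.1 * v.2}
    (fun v => |v.1| + |v.2|) ?_ (1, -1) (1, 1) (by simp) (by simp) ?_ ?_ ?_ ?_
  · intro v (hv : v.1 * v.2 < 0) (hv' : 0 < v.1 * v.2)
    exact lt_asymm hv hv'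
  · rintro k hk hk' ⟨x, y⟩ (hv : 0 < x * y)
    obtain ⟨n, rfl⟩ := Subgroup.mem_zpowers_iff.1 hk
    rcases zpow_wt_one n with ⟨m, -, h⟩ | ⟨m, -, h⟩ | h | h
    · rw [h] at hk'; exact absurd (one_mem _) hk'
    · rw [h] at hk'
      exact absurd (Subgroup.mem_zpowers_iff.2 ⟨3, ord6_cube⟩) hk'
    all_goals
      rw [h]
      constructor
      · simp [actv]; linarith
      · simp [actv, add_comm]
  · rintro k hk hk' ⟨x, y⟩ (hv : x * y < 0)
    have hx : 0 < |x| := abs_pos.2 (by rintro rfl; simp at hv)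
    have hy : 0 < |y| := abs_pos.2 (by rintro rfl; simp at hv)
    have hxy : |x - y| = |x| + |y| := by
      rcases mul_neg_iff.1 hv with ⟨h1, h2⟩ | ⟨h1, h2⟩
      · rw [abs_of_pos h1, abs_of_neg h2, abs_of_pos (by linarith)]; ring
      · rw [abs_of_neg h1, abs_of_pos h2, abs_of_neg (by linarith)]; ring
    obtain ⟨n, rfl⟩ := Subgroup.mem_zpowers_iff.1 hk
    rcases zpow_ord6 n with ⟨m, -, h⟩ | ⟨m, -, h⟩ | h | h | h | h
    · rw [h] at hk'; exact absurd (one_mem _) hk'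
    · rw [h] at hk'
      exact absurd (Subgroup.mem_zpowers_iff.2 ⟨2, wt_one_sq⟩) hk'
    all_goals
      rw [h]
      constructor
      · simp only [actv, Set.mem_ofPred_eq, neg_e, mul_00, mul_01, mul_10, mul_11, e1, e2, e3, e4]
        nlinarith [sq_nonneg x, sq_nonneg y, sq_abs x, sq_abs y]
      · simp only [actv, neg_e, mul_00, mul_01, mul_10, mul_11, e1, e2, e3, e4]
        ring_nf
        try simp only [abs_neg]
        first
        | linarith
        | (rw [show -x + y = -(x - y) by ring, abs_neg, hxy]; linarith)
        | (rw [hxy]; linarith)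
  · intro k h₁ h₂ v _
    rcases zpow_inter h₁ h₂ with rfl | rfl <;> simp [actv, abs_neg]
  · intro k h₁ h₂ v (hv : 0 < v.1 * v.2)
    rcases zpow_inter h₁ h₂ with rfl | rfl <;> simpa [actv] using hv

lemma ZS_empty {x : ℚ} (hx : x ∈ ZS ∅) : ∃ n : ℤ, (n : ℚ) = x := by
  refine ⟨x.num, ?_⟩
  have := mem_ZS_den (T := ∅) (by simp) hx
  have h1 : x.den = 1 := by
    by_contra h
    obtain ⟨q, hq, hd⟩ := Nat.exists_prime_and_dvd h
    exact this q hq hd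
  exact Rat.coe_int_num_of_den_eq_one h1

lemma xU_zpow (n : ℤ) : xU 1 ^ n = xU n := by
  induction n using Int.induction_on with
  | zero => simp
  | succ n ih => rw [zpow_add_one, ih, ← xU_add]; congr 1; push_cast; ring
  | pred n ih => rw [zpow_sub_one, ih, ← xU_neg, ← xU_add]; congr 1; push_cast; ring

lemma xL_zpow (n : ℤ) : xL 1 ^ n = xL n := by
  induction n using Int.induction_on with
  | zero => simp
  | succ n ih => rw [zpow_add_one, ih, ← xL_add]; congr 1; push_cast; ring
  | pred n ih => rw [zpow_sub_one, ih, ← xL_neg, ← xL_add]; congr 1; push_cast; ring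

lemma GT_empty_le_of_gen {H : Subgroup S2} (hU : xU 1 ∈ H) (hL : xL 1 ∈ H) : GT ∅ ≤ H := by
  refine GT_le_of_gen (by simp) ?_ ?_
  · intro a ha
    obtain ⟨n, rfl⟩ := ZS_empty ha
    rw [← xU_zpow]; exact zpow_mem hU n
  · intro a ha
    obtain ⟨n, rfl⟩ := ZS_empty ha
    rw [← xL_zpow]; exact zpow_mem hL n

/-- `SL₂(ℤ)` is presented by the braid relation and the relation `(xy⁻¹x)⁴ = 1`. -/
theorem exists_homOn_GT_empty {X : Type} [Group X] (x y : X)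
    (hb : x * y⁻¹ * x = y⁻¹ * x * y⁻¹) (h4 : (x * y⁻¹ * x) ^ 4 = 1) :
    ∃ F : S2 → X, HomOn (GT ∅) F ∧ F (xU 1) = x ∧ F (xL 1) = y := by
  have h6 : (x * y⁻¹) ^ 3 = (x * y⁻¹ * x) ^ 2 := by
    calc (x * y⁻¹) ^ 3 = x * y⁻¹ * x * (y⁻¹ * x * y⁻¹) := by rw [pow_succ, pow_two]; group
      _ = _ := by rw [← hb, pow_two]
  obtain ⟨f₁, hf₁, e₁⟩ := exists_homOn_zpowers (wt 1) (x * y⁻¹ * x) (by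
    intro n hn
    rcases zpow_wt_one n with ⟨k, rfl, h⟩ | ⟨k, rfl, h⟩ | h | h
    · rw [zpow_mul]
      rw [show (x * y⁻¹ * x) ^ (4 : ℤ) = (x * y⁻¹ * x) ^ 4 from zpow_ofNat _ _, h4, one_zpow]
    all_goals
      rw [hn] at h
      have h00 := congrArg (fun g : S2 => g 0 0) h
      simp at h00
      try norm_num at h00)
  obtain ⟨o1, o2, o3, o4⟩ := ord6_e
  obtain ⟨f₂, hf₂, e₂⟩ := exists_homOn_zpowers ord6 (x * y⁻¹) (by
    intro n hn
    rcases zpow_ord6 n with ⟨k, rfl, h⟩ | ⟨k, rfl, h⟩ | h | h | h | h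
    · rw [zpow_mul]
      rw [show (x * y⁻¹) ^ (6 : ℤ) = ((x * y⁻¹) ^ 3) ^ 2 by rw [← pow_mul]; exact zpow_ofNat _ _,
        h6, ← pow_mul, h4, one_zpow]
    all_goals
      rw [hn] at h
      have h00 := congrArg (fun g : S2 => g 0 0) h
      have h01 := congrArg (fun g : S2 => g 0 1) h
      simp [o1, o2, o3, o4] at h00 h01
      try norm_num at h00)
  obtain ⟨F, hF, F₁, F₂⟩ := amalg_zpowers X f₁ f₂ hf₁ hf₂ (by
    intro g h₁ h₂
    rcases zpow_inter h₁ h₂ with rfl | rfl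
    · rw [hf₁.map_one, hf₂.map_one]
    · nth_rewrite 1 [← wt_one_sq]
      rw [← ord6_cube, e₁, e₂]
      rw [zpow_ofNat, zpow_ofNat, h6])
  have m₁ : wt 1 ∈ Subgroup.zpowers (wt 1) := Subgroup.mem_zpowers _
  have m₂ : ord6 ∈ Subgroup.zpowers ord6 := Subgroup.mem_zpowers _
  have M₁ := (le_sup_left : _ ≤ Subgroup.zpowers (wt 1) ⊔ Subgroup.zpowers ord6) m₁
  have M₂ := (le_sup_right : _ ≤ Subgroup.zpowers (wt 1) ⊔ Subgroup.zpowers ord6) m₂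
  have a₁ : F (wt 1) = x * y⁻¹ * x := by
    rw [F₁ _ m₁]; simpa using e₁ 1
  have a₂ : F ord6 = x * y⁻¹ := by
    rw [F₂ _ m₂]; simpa using e₂ 1
  have i₁ : xU 1 = ord6⁻¹ * wt 1 := by apply S2_ext <;> simp [o1, o2, o3, o4]
  have i₂ : xL 1 = ord6⁻¹ * (ord6⁻¹ * wt 1) := by apply S2_ext <;> simp [o1, o2, o3, o4]
  have hle := GT_empty_le_of_gen (H := Subgroup.zpowers (wt 1) ⊔ Subgroup.zpowers ord6)
    (by rw [i₁]; exact mul_mem (inv_mem M₂) M₁)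
    (by rw [i₂]; exact mul_mem (inv_mem M₂) (mul_mem (inv_mem M₂) M₁))
  refine ⟨F, hF.mono hle, ?_, ?_⟩
  · rw [i₁, hF _ (inv_mem M₂) _ M₁, hF.map_inv M₂, a₁, a₂]; group
  · rw [i₂, hF _ (inv_mem M₂) _ (mul_mem (inv_mem M₂) M₁), hF _ (inv_mem M₂) _ M₁, hF.map_inv M₂,
      a₁, a₂]; group

/-! ### Relations between the canonical lifts of Weyl elements -/

/-- The units of `ZS T` as a group of rational units. -/
def UT (T : Set ℕ) : Subgroup ℚˣ where
  carrier := {u | (u : ℚ) ∈ ZS T ∧ (u : ℚ)⁻¹ ∈ ZS T}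
  one_mem' := by simp [one_mem]
  mul_mem' := by
    rintro a b ⟨h1, h2⟩ ⟨h3, h4⟩
    refine ⟨by push_cast; exact mul_mem h1 h3, ?_⟩
    rw [Units.val_mul, mul_inv]
    exact mul_mem h2 h4
  inv_mem' := by
    rintro a ⟨h1, h2⟩
    refine ⟨by rw [Units.val_inv_eq_inv_val]; exact h2, ?_⟩
    rw [Units.val_inv_eq_inv_val, inv_inv]
    exact h1

lemma neg_mem_UT {T : Set ℕ} {u : ℚˣ} (hu : u ∈ UT T) : -u ∈ UT T := by
  refine ⟨by rw [Units.val_neg]; exact neg_mem hu.1, ?_⟩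
  rw [Units.val_neg, inv_neg]
  exact neg_mem hu.2

namespace CExt
variable {X : Type*} [Group X] {T : Set ℕ} (E : CExt T X)

/-- Canonical lift of the Weyl element `wt u`. -/
def wl (u : ℚˣ) : X := E.X12 u * E.X21 (-(u : ℚ)⁻¹) * E.X12 u

variable (hT : Good T)
include hT

lemma pr_wl {u : ℚˣ} (hu : u ∈ UT T) : E.pr (E.wl u) = wt u := by
  rw [wl, map_mul, map_mul, E.pr_X12 hT hu.1, E.pr_X21 hT (neg_mem hu.2), wt_eq]

lemma wl_eq {u : ℚˣ} (hu : u ∈ UT T) :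
    E.wl u = E.X21 (-(u : ℚ)⁻¹) * E.X12 u * E.X21 (-(u : ℚ)⁻¹) := by
  have hp := E.pr_wl hT hu
  have h1 := E.conj_wt_X12 hT hu.1 hp
  have h2 := E.conj_wt_X21 hT (neg_mem hu.2) hp
  have e1 : -((u : ℚ) / (u : ℚ) ^ 2) = -(u : ℚ)⁻¹ := by field_simp
  have e2 : -((u : ℚ) ^ 2 * -(u : ℚ)⁻¹) = u := by field_simp
  rw [e1] at h1
  rw [e2] at h2
  calc E.wl u = E.wl u * (E.X12 u * E.X21 (-(u : ℚ)⁻¹) * E.X12 u) * (E.wl u)⁻¹ := by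
        rw [← wl]; group
    _ = E.wl u * E.X12 u * (E.wl u)⁻¹ * (E.wl u * E.X21 (-(u : ℚ)⁻¹) * (E.wl u)⁻¹) *
        (E.wl u * E.X12 u * (E.wl u)⁻¹) := by group
    _ = _ := by rw [h1, h2]

lemma wl_neg {u : ℚˣ} (hu : u ∈ UT T) : E.wl (-u) = (E.wl u)⁻¹ := by
  rw [wl, wl, Units.val_neg, inv_neg, E.X12_neg hT hu.1, E.X21_neg hT (neg_mem hu.2)]
  group

lemma wl_conj_wt {u w : ℚˣ} (hu : u ∈ UT T) (hw : w ∈ UT T) {d : X} (hd : E.pr d = wt w) :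
    d * E.wl u * d⁻¹ = E.wl (w ^ 2 / u) := by
  have h1 := E.conj_wt_X12 hT hu.1 hd
  have h2 := E.conj_wt_X21 hT (neg_mem hu.2) hd
  rw [E.wl_eq hT (div_mem (pow_mem hw 2) hu), wl]
  have e1 : -((u : ℚ) / (w : ℚ) ^ 2) = -((w ^ 2 / u : ℚˣ) : ℚ)⁻¹ := by
    push_cast; field_simp
  have e2 : -((w : ℚ) ^ 2 * -(u : ℚ)⁻¹) = ((w ^ 2 / u : ℚˣ) : ℚ) := by push_cast; field_simp
  rw [e1] at h1
  rw [e2] at h2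
  rw [← h1, ← h2]
  group

lemma wl_conj_dg {u w : ℚˣ} (hu : u ∈ UT T) {d : X} (hd : E.pr d = dg w) :
    d * E.wl u * d⁻¹ = E.wl (w ^ 2 * u) := by
  have h1 := E.conj_dg_X12 hT hu.1 hd
  have h2 := E.conj_dg_X21 hT (neg_mem hu.2) hd
  rw [wl, wl]
  have e1 : (w : ℚ) ^ 2 * u = ((w ^ 2 * u : ℚˣ) : ℚ) := by push_cast; ring
  have e2 : (-(u : ℚ)⁻¹) / (w : ℚ) ^ 2 = -((w ^ 2 * u : ℚˣ) : ℚ)⁻¹ := by push_cast; field_simp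
  rw [e1] at h1
  rw [e2] at h2
  rw [← h1, ← h2]
  group

lemma wl_mul {u v a : ℚˣ} (hu : u ∈ UT T) (hv : v ∈ UT T) (ha : a ∈ UT T)
    (h : (u : ℚ) + v = a) : E.wl u * E.wl v = E.wl (u ^ 2 / a) * E.wl (u * v / a) := by
  set c : ℚˣ := u * v / a with hc'
  set s : ℚˣ := u ^ 2 / a with hs'
  have hc : c ∈ UT T := div_mem (mul_mem hu hv) ha
  have hs : s ∈ UT T := div_mem (pow_mem hu 2) ha
  have cv : (c : ℚ) = u * v / a := by rw [hc']; push_cast; ring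
  have sv : (s : ℚ) = u ^ 2 / a := by rw [hs']; push_cast; ring
  have hu0 : (u : ℚ) ≠ 0 := u.ne_zero
  have hv0 : (v : ℚ) ≠ 0 := v.ne_zero
  have ha0 : (u : ℚ) + v ≠ 0 := by rw [h]; exact a.ne_zero
  rw [← h] at cv sv
  have e1 : E.X21 (-(u : ℚ)⁻¹) * E.X21 (-(v : ℚ)⁻¹)
      = E.X12 (-c) * E.wl c * E.X12 (-c) := by
    rw [← E.X21_add hT (neg_mem hu.2) (neg_mem hv.2), E.X12_neg hT hc.1, wl]
    rw [show -(u : ℚ)⁻¹ + -(v : ℚ)⁻¹ = -(c : ℚ)⁻¹ by rw [cv]; field_simp; ring]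
    group
  have e2 : E.X12 u * E.X12 (-c) = E.X12 s := by
    rw [← E.X12_add hT hu.1 (neg_mem hc.1)]
    congr 1
    rw [cv, sv]; field_simp; ring
  have e3 : E.wl c * (E.X12 (-c) * E.X12 v) * (E.wl c)⁻¹ = E.X21 (-(s : ℚ)⁻¹) := by
    rw [← E.X12_add hT (neg_mem hc.1) hv.1,
      E.conj_wt_X12 hT (add_mem (neg_mem hc.1) hv.1) (E.pr_wl hT hc)]
    congr 1
    rw [cv, sv]; field_simp; ring
  have hn : -(u : ℚ) * (s ^ 2 / u ^ 2) ∈ ZS T := by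
    have : s ^ 2 / u ^ 2 ∈ UT T := div_mem (pow_mem hs 2) (pow_mem hu 2)
    have := mul_mem (neg_mem hu.1) this.1
    push_cast at this
    exact this
  have e4 : E.wl c * E.X21 (-(v : ℚ)⁻¹) * (E.wl c)⁻¹ =
      E.X12 s * E.X12 (-(u : ℚ) * (s ^ 2 / u ^ 2)) := by
    rw [E.conj_wt_X21 hT (neg_mem hv.2) (E.pr_wl hT hc), ← E.X12_add hT hs.1 hn]
    congr 1
    rw [cv, sv]; field_simp; ring
  have e5 : E.wl s * E.X12 (-(u : ℚ) * (s ^ 2 / u ^ 2)) * (E.wl s)⁻¹ = E.X21 (u : ℚ)⁻¹ := by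
    rw [E.conj_wt_X12 hT hn (E.pr_wl hT hs)]
    congr 1
    have hs0 : (s : ℚ) ≠ 0 := s.ne_zero
    field_simp
  have e6 : E.X21 (-(u : ℚ)⁻¹) = (E.X21 (u : ℚ)⁻¹)⁻¹ := E.X21_neg hT hu.2
  have e7 : E.wl s * E.X12 (-(u : ℚ) * (s ^ 2 / u ^ 2)) = E.X21 (u : ℚ)⁻¹ * E.wl s := by
    rw [← e5]; group
  calc E.wl u * E.wl v
      = E.X21 (-(u : ℚ)⁻¹) * E.X12 u * (E.X21 (-(u : ℚ)⁻¹) * E.X21 (-(v : ℚ)⁻¹)) *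
          E.X12 v * E.X21 (-(v : ℚ)⁻¹) := by
        rw [E.wl_eq hT hu, E.wl_eq hT hv]; group
    _ = E.X21 (-(u : ℚ)⁻¹) * (E.X12 u * E.X12 (-c)) * (E.wl c * (E.X12 (-c) * E.X12 v) *
          (E.wl c)⁻¹) * (E.wl c * E.X21 (-(v : ℚ)⁻¹) * (E.wl c)⁻¹) * E.wl c := by
        rw [e1]; group
    _ = E.X21 (-(u : ℚ)⁻¹) * (E.wl s * E.X12 (-(u : ℚ) * (s ^ 2 / u ^ 2))) * E.wl c := by
        rw [e2, e3, e4, show E.wl s = E.X12 s * E.X21 (-(s : ℚ)⁻¹) * E.X12 s from rfl]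
        simp only [mul_assoc]
    _ = E.wl s * E.wl c := by rw [e7, e6]; group

end CExt

/-- The unit `3`. -/
def u3 : ℚˣ := Units.mk0 3 (by norm_num)
@[simp] lemma u3_val : (u3 : ℚ) = 3 := rfl

lemma Good.u2_mem {T : Set ℕ} (hT : Good T) : u2 ∈ UT T :=
  ⟨by simp [ofNat_mem], by simpa using hT.half⟩
lemma Good.u3_mem {T : Set ℕ} (hT : Good T) : u3 ∈ UT T :=
  ⟨by simp [ofNat_mem], by simpa using hT.third⟩

namespace CExt
variable {X : Type*} [Group X] {T : Set ℕ} (E : CExt T X)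

/-- Canonical lift of `dg u`. -/
def et (u : ℚˣ) : X := E.wl u * (E.wl 1)⁻¹

lemma et_one : E.et 1 = 1 := mul_inv_cancel _

variable (hT : Good T)
include hT

lemma pr_et {u : ℚˣ} (hu : u ∈ UT T) : E.pr (E.et u) = dg u := by
  rw [et, ← E.wl_neg hT (one_mem _), map_mul, E.pr_wl hT hu,
    E.pr_wl hT (neg_mem_UT (one_mem _)), wt_mul]
  congr 1
  rw [div_neg, div_one, neg_neg]

lemma pr_wl_sq {u : ℚˣ} (hu : u ∈ UT T) : E.pr (E.wl u * E.wl u) = dg (-1) := by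
  rw [map_mul, E.pr_wl hT hu, wt_mul, div_self']

lemma wl_sq_comm {u v : ℚˣ} (hu : u ∈ UT T) (hv : v ∈ UT T) :
    Commute (E.wl u * E.wl u) (E.wl v) := by
  have := E.wl_conj_dg hT hv (E.pr_wl_sq hT hu)
  rw [neg_one_sq, one_mul] at this
  exact mul_inv_eq_iff_eq_mul.mp this

lemma wl_inv {u : ℚˣ} (hu : u ∈ UT T) : E.wl u⁻¹ = E.wl 1 * E.wl u * (E.wl 1)⁻¹ := by
  rw [E.wl_conj_wt hT hu (one_mem _) (E.pr_wl hT (one_mem _)), one_pow, one_div]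

lemma wl_sq_inv {u : ℚˣ} (hu : u ∈ UT T) :
    E.wl u⁻¹ * E.wl u⁻¹ = E.wl u * E.wl u := by
  have h := E.wl_sq_comm hT hu (one_mem _)
  rw [E.wl_inv hT hu]
  calc _ = E.wl 1 * (E.wl u * E.wl u) * (E.wl 1)⁻¹ := by group
    _ = _ := by rw [← h.eq]; group

lemma wl_sq_half {u : ℚˣ} (hu : u ∈ UT T) :
    E.wl (u / u2) * E.wl (u / u2) = E.wl u * E.wl u := by
  rw [E.wl_mul hT hu hu (mul_mem hT.u2_mem hu) (by push_cast; simp; ring)]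
  have e1 : u / u2 = u ^ 2 / (u2 * u) := by
    rw [div_eq_div_iff_mul_eq_mul, pow_two, mul_assoc, mul_comm u u2]
  have e2 : u / u2 = u * u / (u2 * u) := by rw [← pow_two, ← e1]
  rw [← e1, ← e2]

lemma et_mul_inv {u : ℚˣ} (hu : u ∈ UT T) :
    E.et u * E.et u⁻¹ = E.wl u * E.wl u * (E.wl 1 * E.wl 1)⁻¹ := by
  have h := E.wl_sq_comm hT (one_mem _) hu
  have h1 : E.wl u⁻¹ = (E.wl 1)⁻¹ * E.wl u * E.wl 1 := by
    rw [E.wl_inv hT hu]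
    calc _ = (E.wl 1)⁻¹ * (E.wl 1 * E.wl 1 * E.wl u) * (E.wl 1)⁻¹ := by group
      _ = _ := by rw [h.eq]; group
  have h2 := h.inv_left.eq
  rw [et, et, h1]
  calc _ = E.wl u * ((E.wl 1 * E.wl 1)⁻¹ * E.wl u) := by group
    _ = _ := by rw [h2]; group

lemma central_et_mul_inv {u : ℚˣ} (hu : u ∈ UT T) (y : X) :
    Commute (E.et u * E.et u⁻¹) y := by
  apply E.central
  rw [map_mul, E.pr_et hT hu, E.pr_et hT (inv_mem hu), ← dg_mul, mul_inv_cancel, dg_one]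

lemma wl_mul_wl {u v : ℚˣ} (hv : v ∈ UT T) :
    E.wl u * E.wl v = E.et u * E.et v⁻¹ * (E.wl 1 * E.wl 1) := by
  rw [et, et, E.wl_inv hT hv]; group

lemma et_mul {u v a : ℚˣ} (hu : u ∈ UT T) (hv : v ∈ UT T) (ha : a ∈ UT T)
    (h : (u : ℚ) + v = a) : E.et u * E.et v⁻¹ = E.et (u ^ 2 / a) * E.et (u * v / a)⁻¹ := by
  have := E.wl_mul hT hu hv ha h
  rw [E.wl_mul_wl hT hv, E.wl_mul_wl hT (div_mem (mul_mem hu hv) ha)] at this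
  exact mul_right_cancel this

lemma et_sq_mul {k v : ℚˣ} (hk : k ∈ UT T) (hv : v ∈ UT T) :
    E.et (k ^ 2 * v) = E.et k * E.et v * (E.et k⁻¹)⁻¹ := by
  have := E.wl_conj_dg hT hv (E.pr_et hT hk)
  have h := (E.wl_sq_comm hT (one_mem _) hk).eq
  rw [et, ← this, et, et, et, E.wl_inv hT hk]
  group

lemma et_half : E.et u2⁻¹ = (E.et u2)⁻¹ := by
  have h := E.et_mul_inv hT hT.u2_mem
  have h2 := E.wl_sq_half hT hT.u2_mem
  rw [div_self'] at h2
  rw [← h2, mul_inv_cancel] at h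
  exact (inv_eq_of_mul_eq_one_right h).symm

/-- The symbol of `3` with itself is two-torsion. -/
lemma et_three_sq : (E.et u3 * E.et u3⁻¹) * (E.et u3 * E.et u3⁻¹) = 1 := by
  have h2 := hT.u2_mem
  have h3 := hT.u3_mem
  set α := E.et u2 with hα
  set β := E.et u3 with hβ
  set b := E.et u3⁻¹ with hb
  have c1 := E.central_et_mul_inv hT h3
  rw [← hβ, ← hb] at c1
  have eh := E.et_half hT
  rw [← hα] at eh
  have hab : Commute α b := by
    have h := E.et_mul hT (one_mem _) h3 (mul_mem h2 h2) (by push_cast; norm_num)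
    have e1 : E.et (1 ^ 2 / (u2 * u2)) = α⁻¹ * α⁻¹ := by
      rw [show (1 : ℚˣ) ^ 2 / (u2 * u2) = u2⁻¹ ^ 2 * 1 by
        rw [one_pow, mul_one, one_div, pow_two, mul_inv],
        E.et_sq_mul hT (inv_mem h2) (one_mem _), inv_inv, eh, et_one, mul_one]
    have e2 : E.et (1 * u3 / (u2 * u2))⁻¹ = α * b * α := by
      rw [show (1 * u3 / (u2 * u2))⁻¹ = u2 ^ 2 * u3⁻¹ by
        rw [one_mul, inv_div, pow_two, div_eq_mul_inv],
        E.et_sq_mul hT h2 (inv_mem h3), eh, inv_inv]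
    rw [e1, e2, et_one, one_mul] at h
    calc α * b = α * (α⁻¹ * α⁻¹ * (α * b * α)) := by rw [← h]
      _ = b * α := by group
  have hβb : β = (β * b) * b⁻¹ := by group
  have habβ : Commute α β := by
    rw [hβb]; exact (c1 α).symm.mul_right hab.inv_right
  set γ := E.et (u2 * u3) with hγ
  have h32 : E.et (u3 / u2) = α⁻¹ * γ * α⁻¹ := by
    rw [show u3 / u2 = u2⁻¹ ^ 2 * (u2 * u3) by
      ext; push_cast; field_simp,
      E.et_sq_mul hT (inv_mem h2) (mul_mem h2 h3), inv_inv, eh]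
  have g1 : α⁻¹ = b * (α⁻¹ * γ * α⁻¹) := by
    have h := E.et_mul hT (one_mem _) h2 h3 (by push_cast; norm_num)
    rw [et_one, one_mul, eh, one_pow, one_div, one_mul, inv_div, h32] at h
    exact h
  have g2 : γ = b⁻¹ * α := by
    have : γ = α * b⁻¹ * (b * (α⁻¹ * γ * α⁻¹)) * α := by group
    rw [this, ← g1, ((hab.inv_right).eq)]
    group
  have h23 : E.et (u2 / u3) = b * γ * β⁻¹ := by
    rw [show u2 / u3 = u3⁻¹ ^ 2 * (u2 * u3) by ext; push_cast; field_simp,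
      E.et_sq_mul hT (inv_mem h3) (mul_mem h2 h3), inv_inv]
  have z32 : E.et (u3 / u2) * E.et (u2 / u3) = β * b := by
    have h := E.et_mul_inv hT (div_mem h3 h2)
    rw [inv_div, E.wl_sq_half hT h3, ← E.et_mul_inv hT h3] at h
    exact h
  rw [h32, h23, g2] at z32
  have key : b⁻¹ * β⁻¹ = β * b := by
    rw [← z32]
    calc b⁻¹ * β⁻¹ = α⁻¹ * (α * b⁻¹) * β⁻¹ := by group
      _ = α⁻¹ * (b⁻¹ * α) * α⁻¹ * (α * β⁻¹) := by rw [hab.inv_right.eq]; group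
      _ = _ := by group
  have hbβ : Commute b β := by
    have := c1 b
    have h5 : b * β = b * (β * b) * b⁻¹ := by group
    rw [Commute, SemiconjBy, h5, ← this.eq]; group
  nth_rewrite 1 [← key]
  rw [← mul_inv_rev, inv_mul_cancel]

end CExt

/-! ### The invariants of a cocycle on `SL₂(ℤ[1/6])` -/

lemma Wc_wl {u : ℚˣ} (hu : 0 < (u : ℚ)) :
    (totE (Wc_coc ⊤)).wl u = ⟨⟨wt u, trivial⟩, -1⟩ := by
  have h : (u : ℚ)⁻¹ > 0 := inv_pos.2 hu
  have w1 : Wc (xL (-(u : ℚ)⁻¹)) (xU u) = 0 := by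
    simp [Wc, colv, angI, angLt, crs]
  ext1
  · exact Subtype.ext ((totE (Wc_coc ⊤)).pr_wl good_pri ⟨mem_pri _, mem_pri _⟩)
  · simp only [CExt.wl, mul_assoc, Wc_X12, Wc_X21, ExtC.mul_q, ExtC.mul_g, Subgroup.coe_mul, Wc_xU, w1]
    simp [h]

lemma Wc_wl_sq {u : ℚˣ} (hu : 0 < (u : ℚ)) :
    (totE (Wc_coc ⊤)).wl u * (totE (Wc_coc ⊤)).wl u = ⟨⟨dg (-1), trivial⟩, -1⟩ := by
  have h : (u : ℚ)⁻¹ > 0 := inv_pos.2 hu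
  have w1 : Wc (wt u) (wt u) = 1 := by
    simp [Wc, colv, angI, angLt, crs, posv, h, hu, hu.le, not_lt.2 hu.le]
  rw [Wc_wl hu]
  ext1
  · refine Subtype.ext ?_
    show wt u * wt u = _
    rw [wt_mul, div_self']
  · simp [w1]

lemma Wc_wl_four :
    (totE (Wc_coc ⊤)).wl 1 * (totE (Wc_coc ⊤)).wl 1 *
      ((totE (Wc_coc ⊤)).wl 1 * (totE (Wc_coc ⊤)).wl 1) = ExtC.cen _ (-1) := by
  have w4 : Wc 1 1 = 0 := by simp [Wc, colv, angI, angLt, crs]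
  have w1 : Wc (dg (-1)) (dg (-1)) = 1 := by
    simp [Wc, colv, angI, angLt, crs, posv]
  rw [Wc_wl_sq one_pos]
  ext1
  · refine Subtype.ext ?_
    show dg (-1) * dg (-1) = _
    rw [← dg_mul, neg_mul_neg, one_mul, dg_one]; rfl
  · simp [w1, w4, ExtC.cen]

lemma tau_three_wl : ∃ y : Additive (ZMod 3)ˣ, y ≠ 0 ∧
    (totE (tau_coc 3)).wl u3 * (totE (tau_coc 3)).wl u3 *
      ((totE (tau_coc 3)).wl 1 * (totE (tau_coc 3)).wl 1)⁻¹ = ExtC.cen _ y := by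
  have h13 : (1 : ZMod 3) ≠ -1 := by decide
  have : Fact (Nat.Prime 3) := ⟨by norm_num⟩
  obtain ⟨u, hu, hu'⟩ := tau_cob 3
  set E := totE (tau_coc 3)
  have m1 : (1 : ℚ) ∈ ZS (cop 3) := one_mem _
  have hs := homOn_sec_tau 3
  have hs' := ExtC.homOn_sec (tau_coc 3) le_top hu
  have hm : dg (-1) ∈ Gam 3 (cop 3) := by
    rw [mem_Gam, mem_GT]; simp [zero_mem, one_mem]
  have e1 : E.wl 1 * E.wl 1 = ExtC.sec (tau_coc 3) 0 (dg (-1)) := by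
    have hx := xU_mem m1
    have hy := xL_mem (neg_mem m1)
    have : ExtC.sec (tau_coc 3) 0 (wt 1) = E.wl 1 := by
      rw [wt_eq, CExt.wl, Units.val_one, inv_one, hs _ (mul_mem hx hy) _ hx, hs _ hx _ hy,
        sec_tau_xU 3 m1, sec_tau_xL 3 (neg_mem m1)]
    have hw : wt 1 ∈ GT (cop 3) := wt_mem (by simpa using m1) (by simpa using m1)
    rw [← this, ← hs _ hw _ hw, wt_mul, div_self']
  have e3 : E.wl u3⁻¹ * E.wl u3⁻¹ = ExtC.sec (tau_coc 3) u (dg (-1)) := by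
    have h1 : ((3 : ℕ) : ℚ) * ((u3⁻¹ : ℚˣ) : ℚ) ∈ ZS (cop 3) := by
      rw [Units.val_inv_eq_inv_val, u3_val]; norm_num [one_mem]
    have h2 : (-((u3⁻¹ : ℚˣ) : ℚ)⁻¹) / ((3 : ℕ) : ℚ) ∈ ZS (cop 3) := by
      rw [Units.val_inv_eq_inv_val, u3_val]; norm_num [one_mem, neg_mem]
    have hx : xU ((u3⁻¹ : ℚˣ) : ℚ) ∈ GT' 3 (cop 3) := xU_mem_GT' 3 h1
    have hy := xL_mem_GT' 3 h2
    have : ExtC.sec (tau_coc 3) u (wt u3⁻¹) = E.wl u3⁻¹ := by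
      rw [wt_eq, CExt.wl, hs' _ (mul_mem hx hy) _ hx, hs' _ hx _ hy,
        sec_tau_xU' 3 hu h1, sec_tau_xL' 3 hu h2]
    have hw : wt u3⁻¹ ∈ GT' 3 (cop 3) := by rw [wt_eq]; exact mul_mem (mul_mem hx hy) hx
    rw [← this, ← hs' _ hw _ hw, wt_mul, div_self']
  refine ⟨-Additive.ofMul (chi 3 (dg (-1))), ?_, ?_⟩
  · intro h
    rw [neg_eq_zero, ofMul_eq_zero] at h
    have := chi_val 3 (cop_prime 3) (notMem_cop 3) hm
    rw [h] at this
    simp at this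
    exact h13 this
  · rw [← E.wl_sq_inv good_pri ⟨mem_pri _, mem_pri _⟩, e3, e1, sec_tau_dg 3 hu' hm,
      ← ExtC.cen_comm, mul_inv_cancel_right]

lemma CExt.X12_congr {X : Type*} [Group X] {T T' : Set ℕ} (E : CExt T X) (E' : CExt T' X)
    (h : E.pr = E'.pr) (a : ℚ) : E.X12 a = E'.X12 a := by
  simp only [CExt.X12, CExt.lft, h]

lemma CExt.X21_congr {X : Type*} [Group X] {T T' : Set ℕ} (E : CExt T X) (E' : CExt T' X)
    (h : E.pr = E'.pr) (a : ℚ) : E.X21 a = E'.X21 a := by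
  simp only [CExt.X21, CExt.lft, h]

lemma toCExt_pr {Q : Type} [AddCommGroup Q] {x : S2 → S2 → Q} (hx : IsCoc ⊤ x) {T : Set ℕ} :
    (ExtC.toCExt hx le_top : CExt T _).pr = ExtC.proj hx := rfl

lemma totE_pr_eq {Q : Type} [AddCommGroup Q] {x : S2 → S2 → Q} (hx : IsCoc ⊤ x) :
    (totE hx).pr = ExtC.proj hx := rfl

lemma toCExt_wl {Q : Type} [AddCommGroup Q] {x : S2 → S2 → Q} (hx : IsCoc ⊤ x) {T : Set ℕ} (u : ℚˣ) :
    (ExtC.toCExt hx le_top : CExt T _).wl u = (totE hx).wl u := by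
  have h := (toCExt_pr hx (T := T)).trans (totE_pr_eq hx).symm
  rw [CExt.wl, CExt.wl, CExt.X12_congr _ _ h, CExt.X21_congr _ _ h]

lemma CExt.map_wl {X X' : Type*} [Group X] [Group X'] {T : Set ℕ} (E : CExt T X)
    (E' : CExt T X') (F : X →* X') (hF : ∀ a, E'.pr (F a) = E.pr a) (hT : Good T) {u : ℚˣ}
    (hu : u ∈ UT T) : F (E.wl u) = E'.wl u := by
  rw [CExt.wl, map_mul, map_mul, E.map_X12 E' F hF hT hu.1,
    E.map_X21 E' F hF hT (neg_mem hu.2), CExt.wl]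

/-- Functoriality of `ExtC` in the subgroup and the coefficients. -/
def ExtC.mapI {Y Q Q' : Type*} [Group Y] [AddCommGroup Q] [AddCommGroup Q'] {H H' : Subgroup Y}
    {x : Y → Y → Q} {x' : Y → Y → Q'} (hx : IsCoc H x) (hx' : IsCoc H' x') (hH : H ≤ H')
    (φ : Q →+ Q') (h : ∀ a ∈ H, ∀ b ∈ H, x' a b = φ (x a b)) : ExtC hx →* ExtC hx' :=
  MonoidHom.mk' (fun a => ⟨⟨a.g, hH a.g.2⟩, φ a.q⟩) (by
    intro a b
    ext
    · simp
    · simp [h a.g a.g.2 b.g b.g.2])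

lemma ExtC.mapI_cen {Y Q Q' : Type*} [Group Y] [AddCommGroup Q] [AddCommGroup Q']
    {H H' : Subgroup Y} {x : Y → Y → Q} {x' : Y → Y → Q'} {hx : IsCoc H x} {hx' : IsCoc H' x'}
    (hH : H ≤ H') {φ : Q →+ Q'} (h : ∀ a ∈ H, ∀ b ∈ H, x' a b = φ (x a b)) (q : Q) :
    mapI hx hx' hH φ h (cen hx q) = cen hx' (φ q) := by
  ext
  · rfl
  · simp [cen, mapI, h 1 H.one_mem 1 H.one_mem]

/-- The set `{2, 3}`. -/
abbrev T23 : Finset ℕ := {2, 3}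

lemma good_T23 : Good (T23 : Set ℕ) where
  prime p hp := by
    have : p = 2 ∨ p = 3 := by simpa using hp
    rcases this with rfl | rfl <;> norm_num
  two := by simp
  three := by simp

lemma exists_hom_zmod_three {Q : Type*} [AddCommGroup Q] {y : Additive (ZMod 3)ˣ} (hy : y ≠ 0)
    {q : Q} (hq : q + q = 0) : ∃ ψ : Additive (ZMod 3)ˣ →+ Q, ψ y = q := by
  classical
  have key : ∀ x y : (ZMod 3)ˣ, x ≠ 1 → y ≠ 1 → x * y = 1 := by decide
  refine ⟨AddMonoidHom.mk' (fun x => if x = 0 then 0 else q) fun a b => ?_, by simp [hy]⟩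
  by_cases ha : a = 0
  · simp [ha]
  by_cases hb : b = 0
  · simp [hb]
  have : a + b = 0 := key a.toMul b.toMul ha hb
  simp [this, ha, hb, hq]

/-- Every cocycle can be normalised by a combination of the winding and the tame cocycles. -/
lemma exists_normalised {Q : Type} [AddCommGroup Q] {x : S2 → S2 → Q}
    (hx : IsCoc (GT (T23 : Set ℕ)) x) : ∃ (c : Q) (ψ : ∀ l : ℕ, Additive (ZMod l)ˣ →+ Q),
    ∀ (hx' : IsCoc (GT (T23 : Set ℕ)) (fun g h => x g h - kap T23 c ψ g h)),
      (ExtC.toCExt hx' le_rfl).wl u3 * (ExtC.toCExt hx' le_rfl).wl u3 =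
        (ExtC.toCExt hx' le_rfl).wl 1 * (ExtC.toCExt hx' le_rfl).wl 1 ∧
      (ExtC.toCExt hx' le_rfl).wl 1 * (ExtC.toCExt hx' le_rfl).wl 1 *
        ((ExtC.toCExt hx' le_rfl).wl 1 * (ExtC.toCExt hx' le_rfl).wl 1) = 1 := by
  have hT := good_T23
  set T : Set ℕ := (T23 : Set ℕ) with hTdef
  have hX : IsCoc (GT T) (fun g h => (x g h, kapU T23 g h)) := by
    intro g hg h hh k hk
    exact Prod.ext (hx g hg h hh k hk)
      (kapU_coc T23 g (Subgroup.mem_top g) h (Subgroup.mem_top h) k (Subgroup.mem_top k))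
  set P : CExt T (ExtC hX) := ExtC.toCExt hX le_rfl with hP
  have m1 : (1 : ℚˣ) ∈ UT T := one_mem _
  have m3 := hT.u3_mem
  obtain ⟨z, hz⟩ := ExtC.eq_cen (a := P.wl 1 * P.wl 1 * (P.wl 1 * P.wl 1)) (by
    show P.pr _ = 1
    rw [map_mul, P.pr_wl_sq hT m1, ← dg_mul, neg_mul_neg, one_mul, dg_one])
  obtain ⟨t, ht⟩ := ExtC.eq_cen (a := P.wl u3 * P.wl u3 * (P.wl 1 * P.wl 1)⁻¹) (by
    show P.pr _ = 1
    rw [map_mul, map_inv, P.pr_wl_sq hT m1, P.pr_wl_sq hT m3, mul_inv_cancel])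
  have ht2 : t + t = 0 := by
    have := P.et_three_sq hT
    rw [P.et_mul_inv hT m3, ht, ExtC.cen_mul, ← ExtC.cen_zero, ExtC.cen_inj] at this
    exact this
  have key : ∀ {Q' : Type} [AddCommGroup Q'] {H' : Subgroup S2} (hH : GT T ≤ H')
      {x' : S2 → S2 → Q'} (hx' : IsCoc H' x')
      (φ : Q × (ℤ × (∀ l : T23, Additive (ZMod (l : ℕ))ˣ)) →+ Q')
      (_ : ∀ a ∈ GT T, ∀ b ∈ GT T, x' a b = φ (x a b, kapU T23 a b)),
      (ExtC.toCExt hx' hH).wl u3 * (ExtC.toCExt hx' hH).wl u3 *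
        ((ExtC.toCExt hx' hH).wl 1 * (ExtC.toCExt hx' hH).wl 1)⁻¹ = ExtC.cen hx' (φ t) ∧
      (ExtC.toCExt hx' hH).wl 1 * (ExtC.toCExt hx' hH).wl 1 *
        ((ExtC.toCExt hx' hH).wl 1 * (ExtC.toCExt hx' hH).wl 1) = ExtC.cen hx' (φ z) := by
    intro Q' _ H' hH x' hx' φ h
    have e1 := P.map_wl (ExtC.toCExt hx' hH) (ExtC.mapI hX hx' hH φ h) (fun _ => rfl) hT m1
    have e3 := P.map_wl (ExtC.toCExt hx' hH) (ExtC.mapI hX hx' hH φ h) (fun _ => rfl) hT m3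
    rw [← ExtC.mapI_cen (hx := hX) hH h, ← ExtC.mapI_cen (hx := hX) hH h, ← hz, ← ht, ← e1, ← e3]
    simp only [map_mul, map_inv, and_self]
  have hW := key le_top (Wc_coc ⊤) ((AddMonoidHom.fst _ _).comp (AddMonoidHom.snd _ _))
    (fun _ _ _ _ => rfl)
  have h3 := key le_top (tau_coc 3) (((Pi.evalAddMonoidHom
      (fun l : T23 => Additive (ZMod (l : ℕ))ˣ) ⟨3, by simp⟩).comp (AddMonoidHom.snd _ _)).comp
      (AddMonoidHom.snd _ _)) (fun _ _ _ _ => rfl)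
  obtain ⟨y, hy, hy3⟩ := tau_three_wl
  rw [toCExt_wl, toCExt_wl] at hW h3
  have t1 : t.2.1 = 0 := by
    have := hW.1
    rw [Wc_wl_sq (by norm_num : (0 : ℚ) < (u3 : ℚ)), Wc_wl_sq one_pos, mul_inv_cancel,
      ← ExtC.cen_zero, ExtC.cen_inj] at this
    exact this.symm
  have z1 : z.2.1 = -1 := ExtC.cen_inj.1 (hW.2.symm.trans Wc_wl_four)
  have t3 : t.2.2 ⟨3, by simp⟩ = y := ExtC.cen_inj.1 (h3.1.symm.trans hy3)
  obtain ⟨ψ₃, hψ₃⟩ := exists_hom_zmod_three hy (congrArg Prod.fst ht2 : t.1 + t.1 = 0)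
  set ψ : ∀ l : ℕ, Additive (ZMod l)ˣ →+ Q := Function.update (fun l => 0) 3 ψ₃ with hψ
  have hψ3 : ψ 3 = ψ₃ := Function.update_self _ _ _
  have hsum : ∀ w : ∀ l : T23, Additive (ZMod (l : ℕ))ˣ,
      ∑ l : T23, ψ l (w l) = ψ₃ (w ⟨3, by simp⟩) := by
    intro w
    rw [Finset.sum_eq_single ⟨3, by simp⟩]
    · rw [hψ3]
    · intro l _ hl
      rw [hψ, Function.update_of_ne (fun h => hl (Subtype.ext h))]
      rfl
    · simp
  refine ⟨ψ₃ (z.2.2 ⟨3, by simp⟩) - z.1, ψ, fun hx' => ?_⟩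
  set c := ψ₃ (z.2.2 ⟨3, by simp⟩) - z.1 with hc
  set Φ : Q × (ℤ × (∀ l : T23, Additive (ZMod (l : ℕ))ˣ)) →+ Q := AddMonoidHom.fst _ _ -
    ((zmultiplesHom Q c).comp (AddMonoidHom.fst _ _) +
      (∑ l : T23, (ψ l).comp (Pi.evalAddMonoidHom _ l)).comp (AddMonoidHom.snd _ _)).comp
      (AddMonoidHom.snd _ _) with hΦ
  have Φv : ∀ w, Φ w = w.1 - (w.2.1 • c + ∑ l : T23, ψ l (w.2.2 l)) := by
    intro w
    simp only [hΦ, AddMonoidHom.sub_apply, AddMonoidHom.add_apply, zmultiplesHom_apply,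
      AddMonoidHom.coe_fst, AddMonoidHom.comp_apply, AddMonoidHom.coe_snd,
      AddMonoidHom.finsetSum_apply, Pi.evalAddMonoidHom_apply]
  have := key le_rfl hx' Φ (fun a _ b _ => by
    rw [Φv, kapU, kap, ← Finset.sum_coe_sort T23])
  rw [Φv, Φv, hsum, hsum, t1, z1, t3, hψ₃] at this
  refine ⟨?_, ?_⟩
  · have h := this.1
    rw [zero_smul, zero_add, sub_self, ExtC.cen_zero, mul_inv_eq_one] at h
    exact h
  · have h := this.2
    have e : z.1 - ((-1 : ℤ) • c + ψ₃ (z.2.2 ⟨3, by simp⟩)) = 0 := by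
      rw [hc]; abel
    rw [e, ExtC.cen_zero] at h
    exact h

/-! ### Generators of congruence subgroups and gluing -/

lemma exists_balanced_rem (a : ℤ) {m : ℤ} (hm : m ≠ 0) : ∃ t : ℤ, 2 * |a - t * m| ≤ |m| := by
  refine ⟨round ((a : ℚ) / m), ?_⟩
  have hm' : (m : ℚ) ≠ 0 := by exact_mod_cast hm
  have h := abs_sub_round ((a : ℚ) / m)
  have e : (a : ℚ) - round ((a : ℚ) / m) * m = ((a : ℚ) / m - round ((a : ℚ) / m)) * m := by
    field_simp
  have : 2 * |(a : ℚ) - round ((a : ℚ) / m) * m| ≤ |(m : ℚ)| := by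
    rw [e, abs_mul]
    nlinarith [abs_nonneg (m : ℚ)]
  exact_mod_cast this

lemma Gam_le_of_gen {T : Set ℕ} {p : ℕ} [hp : Fact p.Prime] (hT : ∀ l ∈ T, Nat.Prime l)
    (hpT : p ∉ T) (hp3 : p ≤ 3) {H : Subgroup S2} (hU : ∀ t ∈ ZS T, xU t ∈ H)
    (hL : ∀ t ∈ ZS T, xL (p * t) ∈ H) (hD : ∀ u ∈ UT T, dg u ∈ H) : Gam p T ≤ H := by
  have iz : ∀ z : ℤ, (z : ℚ) ∈ ZS T := fun z => intCast_mem _ _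
  have hp0 := p_ne p
  have key : ∀ n : ℕ, ∀ g ∈ Gam p T, ∀ (v : ℚ) (a c : ℤ), v ≠ 0 → g 0 0 = v * a →
      g 1 0 = p * v * c → c.natAbs = n → g ∈ H := by
    intro n
    induction n using Nat.strong_induction_on with
    | _ n ih =>
    intro g hg v a c hv ha hc hn
    obtain ⟨hgT, hgp⟩ := mem_Gam.1 hg
    have hdet := det_eq g
    by_cases hc0 : c = 0
    · have h10 : g 1 0 = 0 := by rw [hc, hc0]; simp
      rw [h10, mul_zero, sub_zero] at hdet
      have h00 : g 0 0 ≠ 0 := left_ne_zero_of_mul_eq_one hdet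
      have h11 : g 1 1 = (g 0 0)⁻¹ := eq_inv_of_mul_eq_one_right hdet
      have e : g = dg (Units.mk0 (g 0 0) h00) * xU (g 0 1 * g 1 1) := by
        apply S2_ext
        · simp
        · simp [h11]; field_simp
        · simp [h10]
        · simp [h11]
      rw [e]
      refine H.mul_mem (hD _ ⟨hgT.1, ?_⟩) (hU _ (mul_mem hgT.2.1 hgT.2.2.2))
      simpa [h11] using hgT.2.2.2
    · have hpc : (p : ℤ) * c ≠ 0 := mul_ne_zero (by exact_mod_cast hp.out.ne_zero) hc0
      obtain ⟨t, ht⟩ := exists_balanced_rem a hpc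
      set a' := a - t * (p * c) with ha'
      have hUt : xU (-(t : ℚ)) ∈ Gam p T := by
        rw [mem_Gam]
        refine ⟨xU_mem (neg_mem (iz t)), by simp [zero_mem]⟩
      have hg1 := mul_mem hUt hg
      set g' := xU (-(t : ℚ)) * g with hg'
      have h00' : g' 0 0 = v * a' := by
        rw [hg', mul_00]; simp [ha, hc, ha']; ring
      have h10' : g' 1 0 = p * v * c := by
        rw [hg', mul_10]; simp [hc]
      have ha0 : a' ≠ 0 := by
        intro h0
        have hd := det_eq g'
        rw [h00', h0, Int.cast_zero, mul_zero, zero_mul, zero_sub] at hd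
        obtain ⟨hgT', hgp'⟩ := mem_Gam.1 hg1
        have hm : (p : ℚ)⁻¹ ∈ ZS T := by
          have e : (p : ℚ)⁻¹ = -(g' 0 1 * (g' 1 0 / p)) := by
            field_simp
            linarith
          rw [e]
          exact neg_mem (mul_mem hgT'.2.1 hgp')
        have := norm_le_one_of_mem p hT hpT hm
        have h1 := norm_p_lt p
        have h2 := norm_p_pos p
        have h3 : padicNorm p (p : ℚ) * padicNorm p (p : ℚ)⁻¹ = 1 := by
          rw [← padicNorm.mul, mul_inv_cancel₀ hp0, padicNorm.one]
        nlinarith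
      obtain ⟨s, hs⟩ := exists_balanced_rem c ha0
      have hLs : xL (-((p : ℚ) * s)) ∈ Gam p T := by
        rw [mem_Gam]
        refine ⟨xL_mem (neg_mem (mul_mem (natCast_mem _ _) (iz s))), ?_⟩
        have : (xL (-((p : ℚ) * s))) 1 0 / p = -(s : ℚ) := by simp; field_simp
        rw [this]
        exact neg_mem (iz s)
      have hg2 := mul_mem hLs hg1
      have hlt : (c - s * a').natAbs < n := by
        have : 4 * |c - s * a'| ≤ 3 * |c| := by
          rw [abs_mul, abs_of_nonneg (by positivity : (0 : ℤ) ≤ p)] at ht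
          have : (p : ℤ) ≤ 3 := by exact_mod_cast hp3
          nlinarith [abs_nonneg c]
        have := abs_pos.2 hc0
        rw [← hn]
        zify
        linarith
      have := ih _ hlt _ hg2 v a' (c - s * a') hv
        (by rw [mul_00]; simp [h00']) (by rw [mul_10]; simp [h00', h10']; ring) rfl
      have e : g = xU t * (xL (p * s) * (xL (-((p : ℚ) * s)) * g')) := by
        rw [← mul_assoc (xL _), ← xL_add, add_neg_cancel, xL_zero, one_mul, hg', ← mul_assoc,
          ← xU_add, add_neg_cancel, xU_zero, one_mul]
      rw [e]
      exact H.mul_mem (hU _ (iz t)) (H.mul_mem (hL _ (iz s)) this)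
  intro g hg
  have d1 : ((g 0 0).den : ℚ) ≠ 0 := by exact_mod_cast (g 0 0).den_ne_zero
  have d2 : ((g 1 0 / p).den : ℚ) ≠ 0 := by exact_mod_cast (g 1 0 / p).den_ne_zero
  refine key _ g hg (1 / ((g 0 0).den * (g 1 0 / p).den)) ((g 0 0).num * (g 1 0 / p).den)
    ((g 1 0 / p).num * (g 0 0).den) (by positivity) ?_ ?_ rfl
  · push_cast
    conv_lhs => rw [← Rat.num_div_den (g 0 0)]
    field_simp
  · have : g 1 0 = p * (g 1 0 / p) := by field_simp
    push_cast
    conv_lhs => rw [this, ← Rat.num_div_den (g 1 0 / p)]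
    field_simp

/-- Conjugation by `diag(r, 1)`. -/
def Dc (r : ℚˣ) : S2 →* S2 :=
  MonoidHom.mk' (fun g => mk (g 0 0) (g 0 1 * r) (g 1 0 / r) (g 1 1) (by
    have := det_eq g
    have := r.ne_zero
    field_simp; linarith)) (by
    intro g h
    have := r.ne_zero
    apply S2_ext <;> simp <;> field_simp)

section
variable (r : ℚˣ) (g : S2)
@[simp] lemma Dc_00 : Dc r g 0 0 = g 0 0 := rfl
@[simp] lemma Dc_01 : Dc r g 0 1 = g 0 1 * r := rfl
@[simp] lemma Dc_10 : Dc r g 1 0 = g 1 0 / r := rfl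
@[simp] lemma Dc_11 : Dc r g 1 1 = g 1 1 := rfl
end

lemma Dc_dg (r u : ℚˣ) : Dc r (dg u) = dg u := by apply S2_ext <;> simp
lemma Dc_xU (r : ℚˣ) (a : ℚ) : Dc r (xU a) = xU (r * a) := by apply S2_ext <;> simp [mul_comm]
lemma Dc_xL (r : ℚˣ) (a : ℚ) : Dc r (xL a) = xL (a / r) := by apply S2_ext <;> simp
lemma Dc_mul (r s : ℚˣ) (g : S2) : Dc r (Dc s g) = Dc (r * s) g := by
  apply S2_ext <;> simp <;> ring
lemma Dc_one (g : S2) : Dc 1 g = g := by apply S2_ext <;> simp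

lemma Dc_mem_GT {T : Set ℕ} {p : ℕ} [hp : Fact p.Prime] {g : S2} :
    Dc (pu p) g ∈ GT T ↔ g ∈ GT' p T := by
  rw [mem_GT', mem_GT, mem_GT]
  simp [mul_comm]
  tauto

/-- The subgroup where two functions multiplicative on `K` agree. -/
def eqz {Y X : Type*} [Group Y] [Group X] {K : Subgroup Y} {f f' : Y → X} (hf : HomOn K f)
    (hf' : HomOn K f') : Subgroup Y where
  carrier := {g | g ∈ K ∧ f g = f' g}
  one_mem' := ⟨K.one_mem, by rw [hf.map_one, hf'.map_one]⟩
  mul_mem' := fun ha hb => ⟨K.mul_mem ha.1 hb.1, by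
    rw [hf _ ha.1 _ hb.1, hf' _ ha.1 _ hb.1, ha.2, hb.2]⟩
  inv_mem' := fun ha => ⟨K.inv_mem ha.1, by rw [hf.map_inv ha.1, hf'.map_inv ha.1, ha.2]⟩

theorem glue_step {T : Set ℕ} {p : ℕ} [hp : Fact p.Prime] (hT : ∀ l ∈ T, Nat.Prime l)
    (hpT : p ∉ T) (hp3 : p ≤ 3) {X : Type} [Group X] {f₁ f₂ : S2 → X} (h₁ : HomOn (GT T) f₁)
    (h₂ : HomOn (GT T) f₂) (hU : ∀ t ∈ ZS T, f₁ (xU t) = f₂ (xU (p * t)))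
    (hL : ∀ t ∈ ZS T, f₁ (xL (p * t)) = f₂ (xL t)) (hD : ∀ u ∈ UT T, f₁ (dg u) = f₂ (dg u)) :
    ∃ F : S2 → X, HomOn (GT (insert p T)) F ∧ (∀ g ∈ GT T, F g = f₁ g) ∧
      ∀ g ∈ GT' p T, F g = f₂ (Dc (pu p) g) := by
  have hp0 := p_ne p
  have h₂' : HomOn (GT' p T) (fun g => f₂ (Dc (pu p) g)) := by
    intro g hg h hh
    show f₂ _ = f₂ _ * f₂ _
    rw [map_mul]
    exact h₂ _ (Dc_mem_GT.2 hg) _ (Dc_mem_GT.2 hh)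
  have hle : Gam p T ≤ eqz (h₁.mono inf_le_left : HomOn (Gam p T) f₁) (h₂'.mono inf_le_right) := by
    refine Gam_le_of_gen hT hpT hp3 (fun t ht => ⟨?_, ?_⟩) (fun t ht => ⟨?_, ?_⟩)
      (fun u hu => ⟨?_, ?_⟩)
    · exact mem_Gam.2 ⟨xU_mem ht, by simp [zero_mem]⟩
    · show f₁ _ = f₂ _
      rw [hU t ht, Dc_xU]; rfl
    · refine mem_Gam.2 ⟨xL_mem (mul_mem (natCast_mem _ _) ht), ?_⟩
      have : (xL ((p : ℚ) * t)) 1 0 / p = t := by simp; field_simp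
      rwa [this]
    · show f₁ _ = f₂ _
      rw [hL t ht, Dc_xL, pu_val]
      congr 2
      field_simp
    · exact mem_Gam.2 ⟨dg_mem hu.1 hu.2, by simp [zero_mem]⟩
    · show f₁ _ = f₂ _
      rw [hD u hu, Dc_dg]
  have := amalg_GT (p := p) hT hpT X f₁ _ h₁ h₂' fun g hg hg' => (hle ⟨hg, hg'⟩).2
  rwa [GT_insert hT] at this

/-! ### Splitting normalised extensions over `ℤ[1/6]` -/

lemma eq_of_additive {X : Type*} [Group X] {f f' : ℤ → X} (hf : ∀ m n, f (m + n) = f m * f n)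
    (hf' : ∀ m n, f' (m + n) = f' m * f' n) (h : f 1 = f' 1) (n : ℤ) : f n = f' n := by
  have := MonoidHom.ext_mint (f := MonoidHom.mk' (fun m : Multiplicative ℤ => f m.toAdd)
    (fun a b => hf _ _)) (g := MonoidHom.mk' (fun m : Multiplicative ℤ => f' m.toAdd)
    (fun a b => hf' _ _)) h
  exact DFunLike.congr_fun this (Multiplicative.ofAdd n)

lemma ZS_two_decomp {a : ℚ} (ha : a ∈ ZS ({2} : Set ℕ)) :
    ∃ (n : ℤ) (b : ℚ), b ∈ ZS ({2} : Set ℕ) ∧ a = n + 3 * b := by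
  have iz : ∀ z : ℤ, (z : ℚ) ∈ ZS ({2} : Set ℕ) := fun z => intCast_mem _ _
  have h2 : (2 : ℚ)⁻¹ ∈ ZS ({2} : Set ℕ) := Subring.subset_closure ⟨2, rfl, by norm_num⟩
  have ha' := ha
  rw [ZS] at ha'
  induction ha' using Subring.closure_induction with
  | mem x hx =>
    obtain ⟨q, hq, rfl⟩ := hx
    obtain rfl : q = 2 := hq
    exact ⟨2, -2⁻¹, neg_mem h2, by norm_num⟩
  | zero => exact ⟨0, 0, zero_mem _, by norm_num⟩
  | one => exact ⟨1, 0, zero_mem _, by norm_num⟩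
  | add x y hx hy ihx ihy =>
    obtain ⟨n, b, hb, rfl⟩ := ihx hx
    obtain ⟨m, c, hc, rfl⟩ := ihy hy
    exact ⟨n + m, b + c, add_mem hb hc, by push_cast; ring⟩
  | neg x hx ihx =>
    obtain ⟨n, b, hb, rfl⟩ := ihx hx
    exact ⟨-n, -b, neg_mem hb, by push_cast; ring⟩
  | mul x y hx hy ihx ihy =>
    obtain ⟨n, b, hb, rfl⟩ := ihx hx
    obtain ⟨m, c, hc, rfl⟩ := ihy hy
    refine ⟨n * m, n * c + b * m + 3 * b * c, ?_, by push_cast; ring⟩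
    exact add_mem (add_mem (mul_mem (iz n) hc) (mul_mem hb (iz m)))
      (mul_mem (mul_mem (by exact_mod_cast iz 3) hb) hc)

lemma UT_empty {u : ℚˣ} (hu : u ∈ UT ∅) : u = 1 ∨ u = -1 := by
  obtain ⟨n, hn⟩ := ZS_empty hu.1
  obtain ⟨m, hm⟩ := ZS_empty hu.2
  have h : n * m = 1 := by
    have : (n : ℚ) * m = 1 := by rw [hn, hm, mul_inv_cancel₀ u.ne_zero]
    exact_mod_cast this
  rcases Int.eq_one_or_neg_one_of_mul_eq_one h with rfl | rfl
  · left; ext; rw [← hn]; simp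
  · right; ext; rw [← hn]; simp

lemma dg_neg_one : dg (-1) = xU 1 * xL (-1) * xU 1 * (xU 1 * xL (-1) * xU 1) := by
  apply S2_ext <;> simp

lemma UT_two_of_gen {H : Subgroup ℚˣ} (h1 : -1 ∈ H) (h2 : u2 ∈ H) {u : ℚˣ}
    (hu : u ∈ UT ({2} : Set ℕ)) : u ∈ H := by
  have hP : ∀ l ∈ ({2} : Set ℕ), Nat.Prime l := by
    intro l hl; obtain rfl : l = 2 := hl; exact Nat.prime_two
  have hpow : ∀ n : ℕ, n ≠ 0 → (∀ q : ℕ, q.Prime → q ∣ n → q = 2) → ∃ k, n = 2 ^ k :=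
    fun n hn h => ⟨_, Nat.eq_prime_pow_of_unique_prime_dvd hn (h _)⟩
  obtain ⟨k, hk⟩ := hpow _ (u : ℚ).den_ne_zero fun q hq hd => mem_ZS_den hP hu.1 q hq hd
  obtain ⟨m, hm⟩ := hpow _ ((u : ℚ)⁻¹).den_ne_zero fun q hq hd => mem_ZS_den hP hu.2 q hq hd
  have hd : ((u : ℚ)⁻¹).den = (u : ℚ).num.natAbs :=
    Rat.den_inv_of_ne_zero u.ne_zero
  have habs : (u : ℚ) = 2 ^ m / 2 ^ k ∨ (u : ℚ) = -(2 ^ m / 2 ^ k) := by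
    have e := Rat.num_div_den (u : ℚ)
    rw [hk] at e
    rw [hd] at hm
    rcases Int.natAbs_eq (u : ℚ).num with h | h <;> rw [h, hm] at e <;> push_cast at e
    · exact Or.inl e.symm
    · right; rw [← e]; ring
  have hpos : u2 ^ m / u2 ^ k ∈ H := H.div_mem (H.pow_mem h2 _) (H.pow_mem h2 _)
  rcases habs with h | h
  · have : u = u2 ^ m / u2 ^ k := by ext; rw [h]; simp [u2]
    rwa [this]
  · have : u = -1 * (u2 ^ m / u2 ^ k) := by ext; rw [h]; simp [u2]
    rw [this]
    exact H.mul_mem h1 hpos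

lemma comm_dg_xU (b : ℚ) : ⁅dg u2, xU b⁆ = xU (3 * b) := by
  rw [commutatorElement_def, dg_conj_xU, ← xU_neg, ← xU_add]
  congr 1
  simp [u2]; ring

lemma comm_dg_xL (b : ℚ) : ⁅dg u2⁻¹, xL b⁆ = xL (3 * b) := by
  rw [commutatorElement_def, dg_conj_xL, ← xL_neg, ← xL_add]
  congr 1
  simp [u2]; ring

lemma HomOn.map_comm {Y X : Type*} [Group Y] [Group X] {H : Subgroup Y} {f : Y → X}
    (hf : HomOn H f) {g h : Y} (hg : g ∈ H) (hh : h ∈ H) : f ⁅g, h⁆ = ⁅f g, f h⁆ := by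
  rw [commutatorElement_def, commutatorElement_def, hf _ (mul_mem (mul_mem hg hh) (inv_mem hg)) _
    (inv_mem hh), hf _ (mul_mem hg hh) _ (inv_mem hg), hf _ hg _ hh, hf.map_inv hg, hf.map_inv hh]

lemma HomOn.eq_on_sup {Y X : Type*} [Group Y] [Group X] {K K₁ K₂ : Subgroup Y} {f f' : Y → X}
    (hf : HomOn K f) (hf' : HomOn K f') (hK : K₁ ⊔ K₂ = K) (h₁ : ∀ g ∈ K₁, f g = f' g)
    (h₂ : ∀ g ∈ K₂, f g = f' g) : ∀ g ∈ K, f g = f' g := by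
  have h : K₁ ⊔ K₂ ≤ eqz hf hf' :=
    sup_le (fun g hg => ⟨hK ▸ (le_sup_left : K₁ ≤ K₁ ⊔ K₂) hg, h₁ g hg⟩)
      (fun g hg => ⟨hK ▸ (le_sup_right : K₂ ≤ K₁ ⊔ K₂) hg, h₂ g hg⟩)
  exact fun g hg => (h (hK.symm ▸ hg)).2

namespace CExt
variable {X : Type} [Group X] {T : Set ℕ} (E : CExt T X) (hT : Good T)
include hT

lemma exists_section_int {r : ℚˣ} (hr : r ∈ UT T)
    (h4 : E.wl r * E.wl r * (E.wl r * E.wl r) = 1) :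
    ∃ s : S2 → X, HomOn (GT ∅) s ∧ (∀ g ∈ GT ∅, E.pr (s g) = Dc r g) ∧
      (∀ n : ℤ, s (xU n) = E.X12 (r * n)) ∧ (∀ n : ℤ, s (xL n) = E.X21 (n / r)) ∧
      s (dg (-1)) = E.wl r * E.wl r := by
  have iz : ∀ z : ℤ, (z : ℚ) ∈ ZS T := fun z => intCast_mem _ _
  have i0 : ∀ z : ℤ, (z : ℚ) ∈ ZS ∅ := fun z => intCast_mem _ _
  have hw : E.X12 r * (E.X21 (r : ℚ)⁻¹)⁻¹ * E.X12 r = E.wl r := by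
    rw [← E.X21_neg hT hr.2, wl]
  obtain ⟨s, hs, s1, s2⟩ := exists_homOn_GT_empty (E.X12 r) (E.X21 (r : ℚ)⁻¹)
    (by rw [hw, E.wl_eq hT hr, E.X21_neg hT hr.2])
    (by rw [hw, ← h4]; simp only [pow_succ, pow_zero, one_mul, mul_assoc])
  have hsU : ∀ n : ℤ, s (xU n) = E.X12 (r * n) := eq_of_additive
    (fun m n => by rw [Int.cast_add, xU_add, hs _ (xU_mem (i0 m)) _ (xU_mem (i0 n))])
    (fun m n => by
      rw [Int.cast_add, mul_add, E.X12_add hT (mul_mem hr.1 (iz m)) (mul_mem hr.1 (iz n))])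
    (by rw [Int.cast_one, s1, mul_one])
  have hm : ∀ m : ℤ, (m : ℚ) / r ∈ ZS T := fun m => mul_mem (iz m) hr.2
  have hsL : ∀ n : ℤ, s (xL n) = E.X21 (n / r) := eq_of_additive
    (fun m n => by rw [Int.cast_add, xL_add, hs _ (xL_mem (i0 m)) _ (xL_mem (i0 n))])
    (fun m n => by
      rw [Int.cast_add, add_div, E.X21_add hT (hm m) (hm n)])
    (by rw [Int.cast_one, s2, one_div])
  have m1 : xU 1 ∈ GT ∅ := xU_mem (one_mem _)
  have m2 : xL (-1) ∈ GT ∅ := xL_mem (neg_mem (one_mem _))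
  have m3 := mul_mem (mul_mem m1 m2) m1
  refine ⟨s, hs, fun g hg => ?_, hsU, hsL, ?_⟩
  · have hps : HomOn (GT ∅) (fun g => E.pr (s g)) := fun g hg h hh => by
      show E.pr _ = _
      rw [hs g hg h hh, map_mul]
    have hD : HomOn (GT ∅) (Dc r) := fun g _ h _ => map_mul _ _ _
    have : GT ∅ ≤ eqz hps hD := by
      refine GT_empty_le_of_gen ⟨m1, ?_⟩ ⟨xL_mem (one_mem _), ?_⟩
      · show E.pr (s (xU 1)) = _
        rw [s1, E.pr_X12 hT hr.1, Dc_xU, mul_one]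
      · show E.pr (s (xL 1)) = _
        rw [s2, E.pr_X21 hT hr.2, Dc_xL, one_div]
    exact (this hg).2
  · have hw1 : s (xU 1 * xL (-1) * xU 1) = E.wl r := by
      rw [hs _ (mul_mem m1 m2) _ m1, hs _ m1 _ m2, s1, wl]
      have := hsL (-1)
      rw [Int.cast_neg, Int.cast_one] at this
      rw [this, neg_div, one_div]
    rw [dg_neg_one, hs _ m3 _ m3, hw1]

lemma exists_section_two {r : ℚˣ} (hr : r ∈ UT T)
    (h4 : E.wl r * E.wl r * (E.wl r * E.wl r) = 1) :
    ∃ s : S2 → X, HomOn (GT {2}) s ∧ (∀ g ∈ GT {2}, E.pr (s g) = Dc r g) ∧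
      (∀ a ∈ ZS ({2} : Set ℕ), s (xU a) = E.X12 (r * a)) ∧
      (∀ a ∈ ZS ({2} : Set ℕ), s (xL a) = E.X21 (a / r)) ∧ s (dg (-1)) = E.wl r * E.wl r := by
  have : Fact (Nat.Prime 2) := ⟨Nat.prime_two⟩
  have h22 : ZS ({2} : Set ℕ) ≤ ZS T := ZS_mono (by simpa using hT.two)
  have iz : ∀ z : ℤ, (z : ℚ) ∈ ZS ({2} : Set ℕ) := fun z => intCast_mem _ _
  have h2 : (2 : ℚ)⁻¹ ∈ ZS ({2} : Set ℕ) := Subring.subset_closure ⟨2, rfl, by norm_num⟩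
  have hr2 : r / u2 ∈ UT T := div_mem hr hT.u2_mem
  have hsq := E.wl_sq_half hT hr
  obtain ⟨s₁, hs₁, p₁, U₁, L₁, D₁⟩ := E.exists_section_int hT hr h4
  obtain ⟨s₂, hs₂, p₂, U₂, L₂, D₂⟩ := E.exists_section_int hT hr2 (by rw [hsq, h4])
  have e2 : ((r / u2 : ℚˣ) : ℚ) = r / 2 := by simp [u2]
  obtain ⟨F, hF, F1, F2⟩ := glue_step (p := 2) (by simp) (Set.notMem_empty 2) (by norm_num)
    hs₁ hs₂ (by
      intro t ht
      obtain ⟨n, rfl⟩ := ZS_empty ht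
      have := U₂ (2 * n)
      push_cast at this ⊢
      rw [U₁, this]
      congr 1; simp [u2]; ring) (by
      intro t ht
      obtain ⟨n, rfl⟩ := ZS_empty ht
      have := L₁ (2 * n)
      push_cast at this ⊢
      rw [this, L₂]
      congr 1; simp [u2]; field_simp) (by
      intro u hu
      rcases UT_empty hu with rfl | rfl
      · rw [dg_one, hs₁.map_one, hs₂.map_one]
      · rw [D₁, D₂, hsq])
  have hins : insert 2 (∅ : Set ℕ) = {2} := by simp
  have hp : ∀ g ∈ GT {2}, E.pr (F g) = Dc r g := by
    have hps : HomOn (GT {2}) (fun g => E.pr (F g)) := fun g hg h hh => by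
      show E.pr _ = _
      rw [hins] at hF
      rw [hF g hg h hh, map_mul]
    have hD : HomOn (GT {2}) (Dc r) := fun g _ h _ => map_mul _ _ _
    have hsup := GT_insert (T := ∅) (p := 2) (by simp)
    rw [hins] at hsup
    refine hps.eq_on_sup hD hsup (fun g hg => ?_) (fun g hg => ?_)
    · rw [F1 g hg, p₁ g hg]
    · rw [F2 g hg, p₂ _ (Dc_mem_GT.2 hg), Dc_mul]
      congr 2
      ext
      simp [u2]
  rw [hins] at hF
  have hd2 : dg u2 ∈ GT {2} := dg_mem (by exact_mod_cast iz 2) h2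
  refine ⟨F, hF, hp, fun a ha => ?_, fun a ha => ?_, ?_⟩
  · obtain ⟨n, b, hb, rfl⟩ := ZS_two_decomp ha
    have h3b : 3 * b ∈ ZS ({2} : Set ℕ) := mul_mem (by exact_mod_cast iz 3) hb
    rw [xU_add, hF _ (xU_mem (iz n)) _ (xU_mem h3b), F1 _ (xU_mem (intCast_mem _ _)), U₁,
      ← comm_dg_xU, hF.map_comm hd2 (xU_mem hb), mul_add,
      E.X12_add hT (mul_mem hr.1 (h22 (iz n))) (mul_mem hr.1 (h22 h3b))]
    congr 1
    apply E.comm_eq_X12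
    · rw [hp _ hd2, Dc_dg]
    · rw [hp _ (xU_mem hb), Dc_xU]
      congr 1; ring
  · obtain ⟨n, b, hb, rfl⟩ := ZS_two_decomp ha
    have h3b : 3 * b ∈ ZS ({2} : Set ℕ) := mul_mem (by exact_mod_cast iz 3) hb
    have hd2' : dg u2⁻¹ ∈ GT {2} := by rw [dg_inv]; exact inv_mem hd2
    rw [xL_add, hF _ (xL_mem (iz n)) _ (xL_mem h3b), F1 _ (xL_mem (intCast_mem _ _)), L₁,
      ← comm_dg_xL, hF.map_comm hd2' (xL_mem hb), add_div,
      E.X21_add hT (a := n / r) (b := 3 * b / r) (mul_mem (h22 (iz n)) hr.2)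
        (mul_mem (h22 h3b) hr.2)]
    congr 1
    apply E.comm_eq_X21
    · rw [hp _ hd2', Dc_dg]
    · rw [hp _ (xL_mem hb), Dc_xL]
      congr 1; ring
  · rw [F1 _ (dg_mem (by simp [one_mem]) (by simp [one_mem])), D₁]

theorem exists_section_six (h3 : E.wl u3 * E.wl u3 = E.wl 1 * E.wl 1)
    (h4 : E.wl 1 * E.wl 1 * (E.wl 1 * E.wl 1) = 1) :
    ∃ s : S2 → X, HomOn (GT (T23 : Set ℕ)) s ∧ ∀ g ∈ GT (T23 : Set ℕ), E.pr (s g) = g := by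
  have : Fact (Nat.Prime 3) := ⟨Nat.prime_three⟩
  have hP : ∀ l ∈ ({2} : Set ℕ), Nat.Prime l := by
    intro l hl; obtain rfl : l = 2 := hl; exact Nat.prime_two
  have iz : ∀ z : ℤ, (z : ℚ) ∈ ZS ({2} : Set ℕ) := fun z => intCast_mem _ _
  have h2 : (2 : ℚ)⁻¹ ∈ ZS ({2} : Set ℕ) := Subring.subset_closure ⟨2, rfl, by norm_num⟩
  have hr : u3⁻¹ ∈ UT T := inv_mem hT.u3_mem
  have hsq : E.wl u3⁻¹ * E.wl u3⁻¹ = E.wl 1 * E.wl 1 := by rw [E.wl_sq_inv hT hT.u3_mem, h3]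
  obtain ⟨s₁, hs₁, p₁, U₁, L₁, D₁⟩ := E.exists_section_two hT (one_mem _) h4
  obtain ⟨s₂, hs₂, p₂, U₂, L₂, D₂⟩ := E.exists_section_two hT hr (by rw [hsq, h4])
  have m3 : (3 : ℚ) ∈ ZS ({2} : Set ℕ) := by exact_mod_cast iz 3
  have cU : ∀ t ∈ ZS ({2} : Set ℕ), s₁ (xU t) = s₂ (xU ((3 : ℕ) * t)) := by
    intro t ht
    rw [U₁ t ht, U₂ _ (mul_mem (by exact_mod_cast m3) ht)]
    congr 1; simp
  have cL : ∀ t ∈ ZS ({2} : Set ℕ), s₁ (xL ((3 : ℕ) * t)) = s₂ (xL t) := by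
    intro t ht
    rw [L₂ t ht, L₁ _ (mul_mem (by exact_mod_cast m3) ht)]
    congr 1; simp [mul_comm]
  have hd1 : dg (-1) ∈ GT {2} := dg_mem (by simp [one_mem]) (by simp [one_mem])
  have hd2 : dg u2 ∈ GT {2} := dg_mem (by exact_mod_cast iz 2) h2
  obtain ⟨F, hF, F1, F2⟩ := glue_step (p := 3) hP (by simp) le_rfl hs₁ hs₂ cU cL (by
    intro u hu
    have hc1 : dg (-1) ∈ eqz hs₁ hs₂ := ⟨hd1, by rw [D₁, D₂, hsq]⟩
    have hc2 : dg (-u2) ∈ eqz hs₁ hs₂ := by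
      have q1 : (1 : ℚ) ∈ ZS ({2} : Set ℕ) := one_mem _
      have q2 : (1 / 2 : ℚ) ∈ ZS ({2} : Set ℕ) := by rwa [one_div]
      have q3 : (-1 : ℚ) ∈ ZS ({2} : Set ℕ) := neg_mem q1
      have q4 : (-2 : ℚ) ∈ ZS ({2} : Set ℕ) := by exact_mod_cast iz (-2)
      have hD : dg (-u2) = xU ((3 : ℕ) * 1) * xL (-1) * xU ((3 : ℕ) * (1 / 2)) * xL (-2) := by
        apply S2_ext <;> simp [u2] <;> norm_num
      have hD' : dg (-u2) = xU 1 * xL ((3 : ℕ) * -1) * xU (1 / 2) * xL ((3 : ℕ) * -2) := by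
        apply S2_ext <;> simp [u2] <;> norm_num
      have q5 : ∀ {t : ℚ}, t ∈ ZS ({2} : Set ℕ) → ((3 : ℕ) : ℚ) * t ∈ ZS ({2} : Set ℕ) :=
        fun ht => mul_mem (natCast_mem _ _) ht
      have a1 := mul_mem (xU_mem q1) (xL_mem (q5 q3))
      have a2 := mul_mem a1 (xU_mem q2)
      have b1 := mul_mem (xU_mem (q5 q1)) (xL_mem q3)
      have b2 := mul_mem b1 (xU_mem (q5 q2))
      refine ⟨by rw [hD']; exact mul_mem a2 (xL_mem (q5 q4)), ?_⟩
      conv_lhs => rw [hD', hs₁ _ a2 _ (xL_mem (q5 q4)), hs₁ _ a1 _ (xU_mem q2),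
        hs₁ _ (xU_mem q1) _ (xL_mem (q5 q3)), cU _ q1, cU _ q2, cL _ q3, cL _ q4]
      conv_rhs => rw [hD, hs₂ _ b2 _ (xL_mem q4), hs₂ _ b1 _ (xU_mem (q5 q2)),
        hs₂ _ (xU_mem (q5 q1)) _ (xL_mem q3)]
    have hc3 : dg u2 ∈ eqz hs₁ hs₂ := by
      have : dg u2 = dg (-1) * dg (-u2) := by rw [← dg_mul]; simp
      rw [this]; exact mul_mem hc1 hc2
    have := UT_two_of_gen (H := (eqz hs₁ hs₂).comap (MonoidHom.mk' dg dg_mul)) hc1 hc3 hu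
    exact this.2)
  have hins : insert 3 ({2} : Set ℕ) = (T23 : Set ℕ) := by
    rw [T23, Finset.coe_pair, Set.pair_comm]
  have hsup := GT_insert (T := {2}) (p := 3) hP
  rw [hins] at hF hsup
  have hps : HomOn (GT (T23 : Set ℕ)) (fun g => E.pr (F g)) := fun g hg h hh => by
    show E.pr _ = _
    rw [hF g hg h hh, map_mul]
  have hD : HomOn (GT (T23 : Set ℕ)) (fun g => g) := fun g _ h _ => rfl
  refine ⟨F, hF, hps.eq_on_sup hD hsup (fun g hg => ?_) (fun g hg => ?_)⟩
  · rw [F1 g hg, p₁ g hg, Dc_one]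
  · rw [F2 g hg, p₂ _ (Dc_mem_GT.2 hg), Dc_mul]
    have : u3⁻¹ * pu 3 = 1 := by ext; simp
    rw [this, Dc_one]

end CExt

/-- Over `ℤ[1/6]` every cocycle is cohomologous to a combination of the winding and the tame
cocycles. -/
theorem univ_base {Q : Type} [AddCommGroup Q] {x : S2 → S2 → Q} (hx : IsCoc (GT (T23 : Set ℕ)) x) :
    ∃ (c : Q) (ψ : ∀ l : ℕ, Additive (ZMod l)ˣ →+ Q) (t : S2 → Q),
      CobOn (GT (T23 : Set ℕ)) (fun g h => x g h - kap T23 c ψ g h) t := by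
  obtain ⟨c, ψ, h⟩ := exists_normalised hx
  have hx' : IsCoc (GT (T23 : Set ℕ)) (fun g h => x g h - kap T23 c ψ g h) := by
    intro g hg k hk l hl
    have h1 := hx g hg k hk l hl
    have h2 := (kap_coc T23 c ψ) g (Subgroup.mem_top _) k (Subgroup.mem_top _) l
      (Subgroup.mem_top _)
    beta_reduce
    rw [sub_add_sub_comm, sub_add_sub_comm, h1, h2]
  obtain ⟨h3, h4⟩ := h hx'
  obtain ⟨s, hs, hp⟩ := (ExtC.toCExt hx' le_rfl : CExt (T23 : Set ℕ) _).exists_section_six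
    good_T23 h3 h4
  exact ⟨c, ψ, _, ExtC.cobOn_of_section hs hp⟩

/-! ### Adding a prime -/

/-- Every cocycle on `SL₂(ℤ_T)` is cohomologous to a combination of the winding cocycle and
the tame cocycles at the primes in `T`. -/
def UnivE (T : Finset ℕ) : Prop :=
  ∀ (Q : Type) [AddCommGroup Q] (x : S2 → S2 → Q), IsCoc (GT (T : Set ℕ)) x →
    ∃ (c : Q) (ψ : ∀ l : ℕ, Additive (ZMod l)ˣ →+ Q) (t : S2 → Q),
      CobOn (GT (T : Set ℕ)) (fun g h => x g h - kap T c ψ g h) t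

lemma IsCoc.sub {Y Q : Type*} [Group Y] [AddCommGroup Q] {H : Subgroup Y} {x y : Y → Y → Q}
    (hx : IsCoc H x) (hy : IsCoc H y) : IsCoc H (fun g h => x g h - y g h) := by
  intro g hg k hk l hl
  beta_reduce
  rw [sub_add_sub_comm, sub_add_sub_comm, hx g hg k hk l hl, hy g hg k hk l hl]

lemma IsCoc.map {Y Q Q' : Type*} [Group Y] [AddCommGroup Q] [AddCommGroup Q'] {H : Subgroup Y}
    {x : Y → Y → Q} (hx : IsCoc H x) (φ : Q →+ Q') : IsCoc H (fun g h => φ (x g h)) := by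
  intro g hg k hk l hl
  beta_reduce
  rw [← map_add, ← map_add, hx g hg k hk l hl]

/-- Coboundaries on two subgroups forming an amalgam can be glued. -/
lemma CobOn.glue {Y Q : Type} [Group Y] [AddCommGroup Q] {K₁ K₂ K : Subgroup Y}
    (hA : Amalg K₁ K₂) (hK : K₁ ⊔ K₂ = K) {x : Y → Y → Q} (hx : IsCoc K x) {t₁ t₂ : Y → Q}
    (h₁ : CobOn K₁ x t₁) (h₂ : CobOn K₂ x t₂) (h : ∀ g ∈ K₁, g ∈ K₂ → t₁ g = t₂ g) :
    ∃ t, CobOn K x t := by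
  have l₁ : K₁ ≤ K := hK ▸ le_sup_left
  have l₂ : K₂ ≤ K := hK ▸ le_sup_right
  obtain ⟨F, hF, F₁, F₂⟩ := hA (ExtC hx) _ _ (ExtC.homOn_sec hx l₁ h₁) (ExtC.homOn_sec hx l₂ h₂)
    (fun g hg hg' => by rw [ExtC.sec_apply hx _ (l₁ hg), ExtC.sec_apply hx _ (l₁ hg), h g hg hg'])
  rw [hK] at hF
  have hp : HomOn K (fun g => ExtC.proj hx (F g)) := fun g hg k hk => by
    show ExtC.proj hx _ = _
    rw [hF g hg k hk, map_mul]
  refine ⟨_, ExtC.cobOn_of_section hF (hp.eq_on_sup (fun g _ k _ => rfl) hK ?_ ?_)⟩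
  · intro g hg
    rw [F₁ g hg, ExtC.proj_sec hx _ (l₁ hg)]
  · intro g hg
    rw [F₂ g hg, ExtC.proj_sec hx _ (l₂ hg)]

lemma kap_insert {Q : Type} [AddCommGroup Q] {T : Finset ℕ} {p : ℕ} (hp : p ∉ T) (c : Q)
    (ψ : ∀ l : ℕ, Additive (ZMod l)ˣ →+ Q) (θ : Additive (ZMod p)ˣ →+ Q) (g h : S2) :
    kap (insert p T) c (Function.update ψ p θ) g h = kap T c ψ g h + θ (tau p g h) := by
  rw [kap, kap, Finset.sum_insert hp, Function.update_self, add_assoc, add_comm (θ _)]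
  congr 2
  refine Finset.sum_congr rfl fun l hl => ?_
  have hlp : l ≠ p := fun e => hp (e ▸ hl)
  rw [Function.update_of_ne hlp]

theorem UnivE.insert {T : Finset ℕ} (hT : Good (T : Set ℕ)) {p : ℕ} [hp : Fact p.Prime]
    (hpT : p ∉ T) (h : UnivE T) : UnivE (insert p T) := by
  intro Q _ x hx
  have hpT' : p ∉ (T : Set ℕ) := by simpa using hpT
  rw [Finset.coe_insert] at hx ⊢
  have hsup := GT_insert (p := p) hT.prime
  have hK : GT (T : Set ℕ) ≤ GT (Insert.insert p (T : Set ℕ)) := hsup ▸ le_sup_left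
  have hK' : GT' p (T : Set ℕ) ≤ GT (Insert.insert p (T : Set ℕ)) := hsup ▸ le_sup_right
  obtain ⟨c, ψ, t₁, h₁⟩ := h Q x (hx.mono hK)
  have hy := hx.sub ((kap_coc T c ψ).mono (le_top : GT (Insert.insert p (T : Set ℕ)) ≤ ⊤))
  set y : S2 → S2 → Q := fun g h => x g h - kap T c ψ g h with hydef
  obtain ⟨c', ψ', t₂, h₂⟩ := h Q (fun g h => y (AL p g) (AL p h)) (by
    intro g hg k hk l hl
    have := hy _ (hK' (AL_mem_GT' hg)) _ (hK' (AL_mem_GT' hk)) _ (hK' (AL_mem_GT' hl))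
    simpa only [map_mul] using this)
  have hΓ : CobOn (Gam p (T : Set ℕ)) (kap T c' ψ') (fun g => t₁ (AL p g) - t₂ g) := by
    intro g hg k hk
    have e1 := h₂ g hg.1 k hk.1
    have e2 := h₁ _ (AL_mem_Gam hg).1 _ (AL_mem_Gam hk).1
    beta_reduce at e1
    rw [e2, ← map_mul] at e1
    have : kap T c' ψ' g k = t₁ (AL p g) + t₁ (AL p k) - t₁ (AL p (g * k)) -
        (t₂ g + t₂ k - t₂ (g * k)) := by rw [← e1]; abel
    rw [this]; beta_reduce; abel
  have hc' := nondeg_winding hT hpT hΓ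
  have hψ' := nondeg_tame hT hpT hΓ
  have hk0 : ∀ g k, kap T c' ψ' g k = 0 := by
    intro g k
    rw [kap, hc', smul_zero, zero_add]
    exact Finset.sum_eq_zero fun l hl => by rw [hψ' l hl]; rfl
  have h₂' : CobOn (GT' p (T : Set ℕ)) y (fun g => t₂ (AL p g)) := by
    intro g hg k hk
    have := h₂ _ hg _ hk
    change y (AL p (AL p g)) (AL p (AL p k)) - _ = t₂ (AL p g) + t₂ (AL p k) -
      t₂ (AL p g * AL p k) at this
    rwa [hk0, sub_zero, AL_AL, AL_AL, ← map_mul] at this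
  have hf : AddOn (Gam p (T : Set ℕ)) (fun g => t₁ g - t₂ (AL p g)) := by
    intro g hg k hk
    have e1 := h₁ g hg.1 k hk.1
    have e2 := h₂' g hg.2 k hk.2
    have e3 := e1.symm.trans e2
    beta_reduce at e3 ⊢
    have e4 : t₁ (g * k) = t₁ g + t₁ k - (t₂ (AL p g) + t₂ (AL p k) - t₂ (AL p (g * k))) := by
      rw [← e3]; abel
    rw [e4]; abel
  obtain ⟨θ, hθ⟩ := exists_factor_chi hT hf hpT'
  obtain ⟨u, hu, hu'⟩ := tau_cob p
  have hcop : (T : Set ℕ) ⊆ cop p := fun q hq => ⟨hT.prime q hq, fun h => hpT' (h ▸ hq)⟩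
  have hz := hy.sub (((tau_coc p).map (-θ)).mono
    (le_top : GT (Insert.insert p (T : Set ℕ)) ≤ ⊤))
  obtain ⟨t, ht⟩ := CobOn.glue (amalg_GT hT.prime hpT') hsup hz (t₁ := t₁)
    (t₂ := fun g => t₂ (AL p g) + θ (u g)) (by
      intro g hg k hk
      beta_reduce
      rw [tau_eq_zero p (GT_mono hcop hg) (GT_mono hcop hk), map_zero, sub_zero]
      exact h₁ g hg k hk) (by
      intro g hg k hk
      beta_reduce
      rw [h₂' g hg k hk, hu g (GT_mono hcop hg) k (GT_mono hcop hk)]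
      simp only [AddMonoidHom.neg_apply, map_sub, map_add]
      abel) (by
      intro g hg hg'
      have := hθ g ⟨hg, hg'⟩
      beta_reduce at this ⊢
      rw [hu' g ⟨GT_mono hcop hg, GT_mono hcop hg'⟩, ← this]
      abel)
  refine ⟨c, Function.update ψ p (-θ), t, fun g hg k hk => ?_⟩
  have := ht g hg k hk
  beta_reduce at this ⊢
  rw [kap_insert hpT, ← this, hydef]
  beta_reduce
  abel

theorem univE {T : Finset ℕ} (hT : Good (T : Set ℕ)) : UnivE T := by
  have key : ∀ S : Finset ℕ, (∀ p ∈ S, p.Prime) → UnivE (S ∪ T23) := by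
    intro S
    induction S using Finset.induction_on with
    | empty =>
      intro _ Q _ x hx
      rw [Finset.empty_union] at hx ⊢
      exact univ_base hx
    | insert p S hp ih =>
      intro hS
      have hS' := fun q hq => hS q (Finset.mem_insert_of_mem hq)
      have : Fact p.Prime := ⟨hS p (Finset.mem_insert_self _ _)⟩
      rw [Finset.insert_union]
      by_cases hpm : p ∈ S ∪ T23
      · rw [Finset.insert_eq_of_mem hpm]
        exact ih hS'
      · refine (ih hS').insert ⟨fun q hq => ?_, by simp, by simp⟩ hpm
        rw [Finset.coe_union] at hq
        exact hq.elim (fun h => hS' q h) (fun h => good_T23.prime q h)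
  have e : T ∪ T23 = T := by
    rw [Finset.union_eq_left]
    intro q hq
    have : q = 2 ∨ q = 3 := by simpa using hq
    rcases this with rfl | rfl
    · exact hT.two
    · exact hT.three
  rw [← e]
  exact key T hT.prime

/-! ### Cocycles and second homology -/

section
variable {A Q : Type} [Group A] [AddCommGroup Q]

/-- Evaluation of a function of two variables on bar chains of degree 2. -/
def ev2 (x : A → A → Q) : ((A × A) →₀ ℤ) →ₗ[ℤ] Q :=
  Finsupp.lsum ℤ fun p => LinearMap.toSpanSingleton ℤ _ (x p.1 p.2)

/-- Evaluation of a function on bar chains of degree 1. -/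
def ev1 (t : A → Q) : (A →₀ ℤ) →ₗ[ℤ] Q :=
  Finsupp.lsum ℤ fun p => LinearMap.toSpanSingleton ℤ _ (t p)

lemma ev2_single (x : A → A → Q) (g h : A) : ev2 x (Finsupp.single (g, h) 1) = x g h := by
  simp [ev2]

lemma ev1_single (t : A → Q) (g : A) : ev1 t (Finsupp.single g 1) = t g := by
  simp [ev1]

lemma barD2_single (g h : A) : barD2 A (Finsupp.single (g, h) 1) =
    Finsupp.single h 1 - Finsupp.single (g * h) 1 + Finsupp.single g 1 := by
  simp [barD2]

lemma barD3_single (g h k : A) : barD3 A (Finsupp.single (g, h, k) 1) =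
    Finsupp.single (h, k) 1 - Finsupp.single (g * h, k) 1 + Finsupp.single (g, h * k) 1 -
      Finsupp.single (g, h) 1 := by
  simp [barD3]

lemma ev2_eq (x : A → A → Q) (z : (A × A) →₀ ℤ) :
    ev2 x z = ∑ p ∈ z.support, z p • x p.1 p.2 := by
  simp [ev2, Finsupp.lsum_apply, Finsupp.sum]

lemma ev2_barD3 {x : A → A → Q} (hx : ∀ g h k, x g h + x (g * h) k = x h k + x g (h * k)) :
    (ev2 x).comp (barD3 A) = 0 := by
  apply Finsupp.lhom_ext'
  rintro ⟨g, h, k⟩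
  apply LinearMap.ext_ring
  simp only [LinearMap.comp_apply, Finsupp.lsingle_apply, barD3_single, map_add, map_sub,
    ev2_single, LinearMap.zero_apply]
  have e : x h k = x g h + x (g * h) k - x g (h * k) := by rw [hx]; abel
  rw [e]
  abel

lemma ev2_barD2 (t : A → Q) :
    ev2 (fun g h => t g + t h - t (g * h)) = (ev1 t).comp (barD2 A) := by
  apply Finsupp.lhom_ext'
  rintro ⟨g, h⟩
  apply LinearMap.ext_ring
  simp only [LinearMap.comp_apply, Finsupp.lsingle_apply, barD2_single, map_add, map_sub,
    ev2_single, ev1_single]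
  abel

/-- The homomorphism from the second homology group defined by a cocycle. -/
def evH2 {x : A → A → Q} (hx : ∀ g h k, x g h + x (g * h) k = x h k + x g (h * k)) :
    H2 A →ₗ[ℤ] Q :=
  Submodule.liftQ _ ((ev2 x).comp (LinearMap.ker (barD2 A)).subtype) (by
    rintro ⟨z, hz⟩ ⟨w, hw⟩
    have := LinearMap.congr_fun (ev2_barD3 hx) w
    have hw' : barD3 A w = z := hw
    rw [LinearMap.comp_apply, hw'] at this
    exact this)

/-- The universal 2-cocycle. -/
def univC (g h : A) : ((A × A) →₀ ℤ) ⧸ LinearMap.range (barD3 A) :=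
  Submodule.Quotient.mk (Finsupp.single (g, h) 1)

lemma univC_coc (g h k : A) :
    univC g h + univC (g * h) k = univC h k + univC g (h * k) := by
  simp only [univC, ← Submodule.Quotient.mk_add]
  symm
  rw [Submodule.Quotient.eq]
  refine ⟨Finsupp.single (g, h, k) 1, ?_⟩
  rw [barD3_single]
  abel

lemma ev2_univC : ev2 (univC (A := A)) = (LinearMap.range (barD3 A)).mkQ := by
  apply Finsupp.lhom_ext'
  rintro ⟨g, h⟩
  apply LinearMap.ext_ring
  simp only [LinearMap.comp_apply, Finsupp.lsingle_apply, ev2_single]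
  rfl

/-- The class of a group element modulo the image of `barD2`. -/
def clsH1 : A →* Multiplicative ((A →₀ ℤ) ⧸ LinearMap.range (barD2 A)) :=
  MonoidHom.mk' (fun g => Multiplicative.ofAdd (Submodule.Quotient.mk (Finsupp.single g 1))) (by
    intro g h
    rw [← ofAdd_add, ← Submodule.Quotient.mk_add]
    congr 1
    symm
    rw [Submodule.Quotient.eq]
    refine ⟨Finsupp.single (g, h) 1, ?_⟩
    rw [barD2_single]
    abel)

lemma barD2_surjective (h : ∀ g : A, clsH1 g = 1) : Function.Surjective (barD2 A) := by
  rw [← LinearMap.range_eq_top, eq_top_iff]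
  rintro z -
  have h1 : ∀ g, Finsupp.single g (1 : ℤ) ∈ LinearMap.range (barD2 A) := fun g =>
    (Submodule.Quotient.mk_eq_zero _).1 (congrArg Multiplicative.toAdd (h g))
  induction z using Finsupp.induction_linear with
  | zero => exact zero_mem _
  | add z w hz hw => exact add_mem hz hw
  | single g n =>
    have := Submodule.smul_mem _ n (h1 g)
    rwa [Finsupp.smul_single, smul_eq_mul, mul_one] at this

/-- If `A` is perfect, a function vanishing on all cycles is a coboundary. -/
lemma exists_cob (h : Function.Surjective (barD2 A)) {x : A → A → Q}
    (hx : ∀ z ∈ LinearMap.ker (barD2 A), ev2 x z = 0) :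
    ∃ t : A → Q, ∀ g h, x g h = t g + t h - t (g * h) := by
  choose s hs using h
  have key : ∀ z z', barD2 A z = barD2 A z' → ev2 x z = ev2 x z' := by
    intro z z' e
    rw [← sub_eq_zero, ← map_sub]
    exact hx _ (by rw [LinearMap.mem_ker, map_sub, e, sub_self])
  refine ⟨fun g => ev2 x (s (Finsupp.single g 1)), fun g h => ?_⟩
  beta_reduce
  rw [← ev2_single x, ← map_add, ← map_sub]
  apply key
  rw [map_sub, map_add, hs, hs, hs, barD2_single]
  abel

end

/-! ### The second homology of `SL₂(ℤ_T)` -/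

/-- The primes dividing a denominator of an entry. -/
def pden (g : S2) : Finset ℕ :=
  ((g 0 0).den * (g 0 1).den * (g 1 0).den * (g 1 1).den).primeFactors

lemma mem_GT_of_pden {S : Set ℕ} {g : S2} (h : ∀ q ∈ pden g, q ∈ S) : g ∈ GT S := by
  have hne : (g 0 0).den * (g 0 1).den * (g 1 0).den * (g 1 1).den ≠ 0 := by
    simp [Rat.den_ne_zero]
  have key : ∀ q : ℕ, q.Prime → q ∣ (g 0 0).den * (g 0 1).den * (g 1 0).den * (g 1 1).den →
    q ∈ S := fun q hq hd => h q (Nat.mem_primeFactors.2 ⟨hq, hd, hne⟩)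
  refine ⟨mem_ZS fun q hq hd => key q hq ?_, mem_ZS fun q hq hd => key q hq ?_,
    mem_ZS fun q hq hd => key q hq ?_, mem_ZS fun q hq hd => key q hq ?_⟩
  · exact Dvd.dvd.mul_right (Dvd.dvd.mul_right (Dvd.dvd.mul_right hd _) _) _
  · exact Dvd.dvd.mul_right (Dvd.dvd.mul_right (Dvd.dvd.mul_left hd _) _) _
  · exact Dvd.dvd.mul_right (Dvd.dvd.mul_left hd _) _
  · exact Dvd.dvd.mul_left hd _

lemma pden_subset {T : Set ℕ} (hT : ∀ p ∈ T, Nat.Prime p) {g : S2} (hg : g ∈ GT T) :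
    ∀ q ∈ pden g, q ∈ T := by
  intro q hq
  obtain ⟨hp, hd, -⟩ := Nat.mem_primeFactors.1 hq
  rcases (Nat.Prime.dvd_mul hp).1 hd with hd | hd
  · rcases (Nat.Prime.dvd_mul hp).1 hd with hd | hd
    · rcases (Nat.Prime.dvd_mul hp).1 hd with hd | hd
      · exact mem_ZS_den hT hg.1 q hp hd
      · exact mem_ZS_den hT hg.2.1 q hp hd
    · exact mem_ZS_den hT hg.2.2.1 q hp hd
  · exact mem_ZS_den hT hg.2.2.2 q hp hd

lemma tau_eq_zero_of_pden {l : ℕ} {g h : S2} (hg : l ∉ pden g) (hh : l ∉ pden h) :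
    tau l g h = 0 := by
  have key : ∀ k : S2, l ∉ pden k → k ∈ GT (cop l) := fun k hk =>
    mem_GT_of_pden fun q hq => ⟨Nat.prime_of_mem_primeFactors hq, fun e => hk (e ▸ hq)⟩
  exact tau_eq_zero l (key g hg) (key h hh)

section
variable (T : Set ℕ)

open Classical in
/-- The tame cocycles at all primes of `T` simultaneously. -/
def tauD (g h : S2) : DirectSum ↑T (fun p => Additive (ZMod (p : ℕ))ˣ) :=
  DirectSum.mk _ (Finset.subtype (· ∈ T) (pden g ∪ pden h)) fun l => tau (l : T) g h

lemma tauD_apply (g h : S2) (l : T) : tauD T g h l = tau l g h := by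
  classical
  rw [tauD, DirectSum.mk, AddMonoidHom.coe_mk, ZeroHom.coe_mk, DFinsupp.mk_apply]
  split_ifs with H
  · rfl
  · simp only [Finset.mem_subtype, Finset.mem_union, not_or] at H
    exact (tau_eq_zero_of_pden H.1 H.2).symm

/-- The universal cocycle. -/
def kapD (g h : S2) : ℤ × DirectSum ↑T (fun p => Additive (ZMod (p : ℕ))ˣ) :=
  (Wc g h, tauD T g h)

lemma kapD_coc : IsCoc ⊤ (kapD T) := by
  intro g hg h hh k hk
  refine Prod.ext (Wc_coc ⊤ g hg h hh k hk) ?_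
  refine DFinsupp.ext fun l => ?_
  have := tau_coc l g hg h hh k hk
  simp only [← tauD_apply T] at this
  exact this

open Classical in
/-- The homomorphism with which `kap` is obtained from `kapD`. -/
def kapHom {Q : Type} [AddCommGroup Q] (S : Finset ℕ) (c : Q)
    (ψ : ∀ l : ℕ, Additive (ZMod l)ˣ →+ Q) :
    ℤ × DirectSum ↑T (fun p => Additive (ZMod (p : ℕ))ˣ) →+ Q :=
  AddMonoidHom.coprod (zmultiplesHom Q c)
    (∑ l ∈ S.subtype (· ∈ T), (ψ l).comp (DFinsupp.evalAddMonoidHom l))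

variable {T}

lemma kapHom_kapD {Q : Type} [AddCommGroup Q] {S : Finset ℕ} (hS : (S : Set ℕ) ⊆ T) (c : Q)
    (ψ : ∀ l : ℕ, Additive (ZMod l)ˣ →+ Q) (g h : S2) :
    kapHom T S c ψ (kapD T g h) = kap S c ψ g h := by
  classical
  rw [kapHom, kapD, AddMonoidHom.coprod_apply, kap, zmultiplesHom_apply,
    AddMonoidHom.finsetSum_apply]
  congr 1
  rw [← Finset.sum_subtype_of_mem (fun l => ψ l (tau l g h)) (fun l hl => hS hl)]
  refine Finset.sum_congr (by congr) fun l _ => ?_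
  rw [← tauD_apply T]
  rfl

open Classical in
lemma tauD_eq_sum {S : Finset ℕ} (hp : ∀ l ∈ S, Nat.Prime l)
    {g h : S2} (hg : g ∈ GT (S : Set ℕ)) (hh : h ∈ GT (S : Set ℕ)) :
    tauD T g h = ∑ l ∈ S.subtype (· ∈ T),
      DirectSum.of (fun p : T => Additive (ZMod (p : ℕ))ˣ) l (tau l g h) := by
  refine DFinsupp.ext fun k => ?_
  rw [show (tauD T g h) k = tau k g h from tauD_apply T g h k]
  have e : ∀ y : DirectSum ↑T (fun p => Additive (ZMod (p : ℕ))ˣ),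
      y k = DFinsupp.evalAddMonoidHom (β := fun p : T => Additive (ZMod (p : ℕ))ˣ) k y :=
    fun y => rfl
  rw [e, map_sum, Finset.sum_eq_single k]
  · rw [← e, DirectSum.of_eq_same]
  · intro l _ hl
    rw [← e, DirectSum.of_eq_of_ne _ _ _ hl.symm]
  · intro hk
    rw [Finset.mem_subtype] at hk
    rw [← e, DirectSum.of_eq_same]
    exact tau_eq_zero_of_pden (fun H => hk (pden_subset hp hg _ H))
      (fun H => hk (pden_subset hp hh _ H))

open Classical in
/-- Every homomorphism on the coefficients of `kapD` turns it into some `kap` over finitely many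
primes. -/
lemma map_kapD {Q : Type} [AddCommGroup Q]
    (π : ℤ × DirectSum ↑T (fun p => Additive (ZMod (p : ℕ))ˣ) →+ Q) {S : Finset ℕ}
    (hS : (S : Set ℕ) ⊆ T) {ψ : ∀ l : ℕ, Additive (ZMod l)ˣ →+ Q}
    (hψ : ∀ (l : T) (y), ψ l y = π (0, DirectSum.of _ l y)) (hp : ∀ l ∈ S, Nat.Prime l)
    {g h : S2} (hg : g ∈ GT (S : Set ℕ)) (hh : h ∈ GT (S : Set ℕ)) :
    π (kapD T g h) = kap S (π (1, 0)) ψ g h := by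
  have e : kapD T g h = Wc g h • ((1, 0) : ℤ × _) + AddMonoidHom.inr _ _ (tauD T g h) := by
    refine Prod.ext ?_ ?_ <;> simp [kapD]
  rw [e, map_add, show π (Wc g h • ((1, 0) : ℤ × _)) = Wc g h • π (1, 0) from map_zsmul π _ _, kap]
  congr 1
  rw [tauD_eq_sum hp hg hh, map_sum, map_sum,
    ← Finset.sum_subtype_of_mem (fun l => ψ l (tau l g h)) (fun l hl => hS hl)]
  exact Finset.sum_congr rfl fun l _ => (hψ l _).symm

end

section
variable {T : Set ℕ}

/-- The inclusion `SL₂(ℤ_T) → SL₂(ℚ)`. -/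
def incl (T : Set ℕ) : Matrix.SpecialLinearGroup (Fin 2) (ZS T) →* S2 :=
  Matrix.SpecialLinearGroup.map (ZS T).subtype

lemma incl_apply (g : Matrix.SpecialLinearGroup (Fin 2) (ZS T)) (i j : Fin 2) :
    incl T g i j = (g i j : ℚ) := rfl

lemma incl_mem (g : Matrix.SpecialLinearGroup (Fin 2) (ZS T)) : incl T g ∈ GT T :=
  ⟨(g 0 0).2, (g 0 1).2, (g 1 0).2, (g 1 1).2⟩

lemma incl_injective : Function.Injective (incl T) := by
  intro g h e
  apply Matrix.SpecialLinearGroup.ext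
  intro i j
  apply Subtype.ext
  rw [← incl_apply, e, incl_apply]

lemma exists_incl {g : S2} (hg : g ∈ GT T) : ∃ a, incl T a = g := by
  have h := Matrix.SpecialLinearGroup.det_coe g
  rw [Matrix.det_fin_two] at h
  refine ⟨⟨!![⟨g 0 0, hg.1⟩, ⟨g 0 1, hg.2.1⟩; ⟨g 1 0, hg.2.2.1⟩, ⟨g 1 1, hg.2.2.2⟩], ?_⟩, ?_⟩
  · rw [Matrix.det_fin_two_of]
    exact Subtype.ext h
  · apply S2_ext <;> rfl

open Classical in
/-- A partial inverse of the inclusion. -/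
def jmap (T : Set ℕ) (g : S2) : Matrix.SpecialLinearGroup (Fin 2) (ZS T) :=
  if h : g ∈ GT T then (exists_incl h).choose else 1

lemma incl_jmap {g : S2} (hg : g ∈ GT T) : incl T (jmap T g) = g := by
  rw [jmap, dif_pos hg]; exact (exists_incl hg).choose_spec

lemma jmap_incl (a : Matrix.SpecialLinearGroup (Fin 2) (ZS T)) : jmap T (incl T a) = a :=
  incl_injective (incl_jmap (incl_mem a))

lemma homOn_jmap : HomOn (GT T) (jmap T) := by
  intro g hg h hh
  apply incl_injective
  rw [map_mul, incl_jmap hg, incl_jmap hh, incl_jmap (mul_mem hg hh)]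

lemma HomOn.eq_one_of_good {X : Type*} [CommGroup X] (hT : Good T) {f : S2 → X}
    (hf : HomOn (GT T) f) {g : S2} (hg : g ∈ GT T) : f g = 1 := by
  have h1 : HomOn (GT T) (fun _ => (1 : X)) := fun _ _ _ _ => (one_mul _).symm
  have key : GT T ≤ eqz hf h1 := by
    refine GT_le_of_gen hT.prime (fun a ha => ⟨xU_mem ha, ?_⟩) (fun a ha => ⟨xL_mem ha, ?_⟩)
    · rw [show a = 3 * (a / 3) by ring, ← comm_dg_xU, hf.map_comm hT.dg2 (xU_mem (hT.div3 ha)),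
        commutatorElement_eq_one_iff_commute]
      exact Commute.all _ _
    · rw [show a = 3 * (a / 3) by ring, ← comm_dg_xL,
        hf.map_comm (by rw [dg_inv]; exact inv_mem hT.dg2) (xL_mem (hT.div3 ha)),
        commutatorElement_eq_one_iff_commute]
      exact Commute.all _ _
  exact (key hg).2

lemma barD2_surjective_of_good (hT : Good T) :
    Function.Surjective (barD2 (Matrix.SpecialLinearGroup (Fin 2) (ZS T))) := by
  apply barD2_surjective
  intro a
  have h : HomOn (GT T) (fun g => clsH1 (jmap T g)) := fun g hg k hk => by
    beta_reduce
    rw [homOn_jmap g hg k hk, map_mul]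
  have := h.eq_one_of_good hT (incl_mem a)
  beta_reduce at this
  rwa [jmap_incl] at this

lemma kapD_incl_coc (g h k : Matrix.SpecialLinearGroup (Fin 2) (ZS T)) :
    kapD T (incl T g) (incl T h) + kapD T (incl T (g * h)) (incl T k) =
      kapD T (incl T h) (incl T k) + kapD T (incl T g) (incl T (h * k)) := by
  rw [map_mul, map_mul]
  exact kapD_coc T _ (Subgroup.mem_top _) _ (Subgroup.mem_top _) _ (Subgroup.mem_top _)

/-- The homomorphism of the main theorem. -/
def phi (T : Set ℕ) :=
  evH2 (x := fun g h => kapD T (incl T g) (incl T h)) kapD_incl_coc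

/-- A finite good subset containing all denominators in a finite set of matrices. -/
lemma exists_finite_level (hT : Good T)
    (s : Finset (Matrix.SpecialLinearGroup (Fin 2) (ZS T) ×
      Matrix.SpecialLinearGroup (Fin 2) (ZS T))) :
    ∃ S : Finset ℕ, Good (S : Set ℕ) ∧ (S : Set ℕ) ⊆ T ∧
      ∀ p ∈ s, incl T p.1 ∈ GT (S : Set ℕ) ∧ incl T p.2 ∈ GT (S : Set ℕ) := by
  classical
  set S : Finset ℕ := T23 ∪ s.biUnion fun p => pden (incl T p.1) ∪ pden (incl T p.2) with hS
  have hsub : (S : Set ℕ) ⊆ T := by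
    intro q hq
    rw [hS, Finset.mem_coe, Finset.mem_union, Finset.mem_biUnion] at hq
    rcases hq with hq | ⟨p, -, hq⟩
    · have : q = 2 ∨ q = 3 := by simpa [T23] using hq
      rcases this with rfl | rfl
      exacts [hT.two, hT.three]
    · rcases Finset.mem_union.1 hq with hq | hq
      exacts [pden_subset hT.prime (incl_mem _) q hq, pden_subset hT.prime (incl_mem _) q hq]
  refine ⟨S, ⟨fun p hp => hT.prime p (hsub hp), by simp [hS, T23], by simp [hS, T23]⟩, hsub,
    fun p hp => ⟨mem_GT_of_pden fun q hq => ?_, mem_GT_of_pden fun q hq => ?_⟩⟩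
  · exact Finset.mem_union_right _ (Finset.mem_biUnion.2 ⟨p, hp, Finset.mem_union_left _ hq⟩)
  · exact Finset.mem_union_right _ (Finset.mem_biUnion.2 ⟨p, hp, Finset.mem_union_right _ hq⟩)

lemma phi_injective (hT : Good T) : Function.Injective (phi T) := by
  refine (injective_iff_map_eq_zero (phi T)).2 fun y hy => ?_
  obtain ⟨z, rfl⟩ := Submodule.Quotient.mk_surjective _ y
  obtain ⟨z, hz⟩ := z
  have hz' : ev2 (fun g h => kapD T (incl T g) (incl T h)) z = 0 := hy
  obtain ⟨S, hS, hST, hsupp⟩ := exists_finite_level hT z.support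
  have hx : IsCoc (GT (S : Set ℕ)) (fun a b => univC (jmap T a) (jmap T b)) := by
    intro a ha b hb c hc
    have ha' := GT_mono hST ha
    have hb' := GT_mono hST hb
    have hc' := GT_mono hST hc
    beta_reduce
    rw [homOn_jmap a ha' b hb', homOn_jmap b hb' c hc']
    exact univC_coc _ _ _
  obtain ⟨c, ψ, t, ht⟩ := univE hS _ _ hx
  rw [Submodule.Quotient.mk_eq_zero, Submodule.mem_comap, Submodule.subtype_apply,
    ← Submodule.ker_mkQ (LinearMap.range (barD3 _)), LinearMap.mem_ker, ← ev2_univC]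
  have e1 : ev2 univC z = kapHom T S c ψ (ev2 (fun g h => kapD T (incl T g) (incl T h)) z) +
      ev2 (fun g h => t (incl T g) + t (incl T h) - t (incl T (g * h))) z := by
    rw [ev2_eq, ev2_eq, ev2_eq, map_sum, ← Finset.sum_add_distrib]
    refine Finset.sum_congr rfl fun p hp => ?_
    have := ht _ (hsupp p hp).1 _ (hsupp p hp).2
    beta_reduce at this
    rw [jmap_incl, jmap_incl, ← map_mul, sub_eq_iff_eq_add'] at this
    rw [show kapHom T S c ψ (z p • kapD T (incl T p.1) (incl T p.2)) =
      z p • kapHom T S c ψ (kapD T (incl T p.1) (incl T p.2)) from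
        map_zsmul (kapHom T S c ψ) (z p) _,
      kapHom_kapD hST, ← smul_add, this]
  rw [e1, hz', map_zero, zero_add, ev2_barD2 (fun g => t (incl T g)), LinearMap.comp_apply,
    LinearMap.mem_ker.1 hz, map_zero]

lemma phi_surjective (hT : Good T) : Function.Surjective (phi T) := by
  classical
  set R := (phi T).toAddMonoidHom.range
  set π := QuotientAddGroup.mk' R
  have h0 : ∀ z ∈ LinearMap.ker (barD2 (Matrix.SpecialLinearGroup (Fin 2) (ZS T))),
      ev2 (fun g h => π (kapD T (incl T g) (incl T h))) z = 0 := by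
    intro z hz
    have h1 : π (ev2 (fun g h => kapD T (incl T g) (incl T h)) z) = 0 :=
      (QuotientAddGroup.eq_zero_iff _).2 ⟨Submodule.Quotient.mk ⟨z, hz⟩, rfl⟩
    rw [← h1, ev2_eq, ev2_eq, map_sum]
    exact Finset.sum_congr rfl fun p hp => (map_zsmul π _ _).symm
  obtain ⟨t, ht⟩ := exists_cob (barD2_surjective_of_good hT) h0
  have key : ∀ S : Finset ℕ, Good (S : Set ℕ) → (S : Set ℕ) ⊆ T → π (1, 0) = 0 ∧
      ∀ l : T, (l : ℕ) ∈ S → ∀ y, π (0, DirectSum.of _ l y) = 0 := by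
    intro S hS hST
    obtain ⟨q, hq, hqp⟩ := Nat.exists_infinite_primes (S.sup id + 1)
    have hqS : q ∉ S := fun h => by
      have : q ≤ S.sup id := Finset.le_sup (f := id) h
      omega
    have := Fact.mk hqp
    set ψ : ∀ l : ℕ, Additive (ZMod l)ˣ →+ _ := fun l => if h : l ∈ T then
      π.comp ((AddMonoidHom.inr ℤ _).comp
        (DirectSum.of (fun p : T => Additive (ZMod (p : ℕ))ˣ) ⟨l, h⟩)) else 0 with hψ
    have hψ' : ∀ (l : T) (y), ψ l y = π (0, DirectSum.of _ l y) := by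
      intro l y
      simp only [hψ]
      rw [dif_pos l.2]
      rfl
    have hc : CobOn (Gam q (S : Set ℕ)) (kap S (π (1, 0)) ψ) (fun g => t (jmap T g)) := by
      intro g hg h hh
      have hg' := GT_mono hST hg.1
      have hh' := GT_mono hST hh.1
      have := ht (jmap T g) (jmap T h)
      rw [incl_jmap hg', incl_jmap hh', map_kapD π hST hψ' hS.prime hg.1 hh.1,
        ← homOn_jmap g hg' h hh'] at this
      exact this
    refine ⟨nondeg_winding hS hqS hc, fun l hl y => ?_⟩
    rw [← hψ', nondeg_tame hS hqS hc l hl]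
    rfl
  have hT23 : ((T23 : Finset ℕ) : Set ℕ) ⊆ T := by
    intro q hq
    have : q = 2 ∨ q = 3 := by simpa [T23] using hq
    rcases this with rfl | rfl
    exacts [hT.two, hT.three]
  have k1 : π (1, 0) = 0 := (key T23 good_T23 hT23).1
  have k2 : ∀ (l : T) y, π (0, DirectSum.of _ l y) = 0 := by
    intro l y
    refine (key (insert (l : ℕ) T23) ?_ ?_).2 l (Finset.mem_insert_self _ _) y
    · refine ⟨?_, ?_, ?_⟩
      · intro p hp
        rcases Finset.mem_insert.1 (Finset.mem_coe.1 hp) with rfl | hp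
        exacts [hT.prime _ l.2, good_T23.prime p hp]
      · exact Finset.mem_insert_of_mem good_T23.two
      · exact Finset.mem_insert_of_mem good_T23.three
    · intro p hp
      rcases Finset.mem_insert.1 (Finset.mem_coe.1 hp) with rfl | hp
      exacts [l.2, hT23 hp]
  have k3 : π.comp (AddMonoidHom.inr ℤ _) = 0 := by
    refine DirectSum.addHom_ext fun l y => ?_
    exact k2 l y
  rintro ⟨n, w⟩
  have e : ((n, w) : ℤ × DirectSum ↑T (fun p => Additive (ZMod (p : ℕ))ˣ)) =
      n • (1, 0) + (0, w) := by
    refine Prod.ext ?_ ?_ <;> simp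
  have h3 : π (0, w) = 0 := DFunLike.congr_fun k3 w
  have h4 : π (n, w) = 0 := by
    rw [e, map_add, h3, add_zero]
    exact (map_zsmul π n (1, 0)).trans (by rw [k1, smul_zero])
  exact (QuotientAddGroup.eq_zero_iff _).1 h4

end

theorem h2_iso {T : Set ℕ} (hT : Good T) :
    Nonempty (H2 (Matrix.SpecialLinearGroup (Fin 2) (ZS T)) ≃+
      ℤ × DirectSum ↑T (fun p => Additive (ZMod (p : ℕ))ˣ)) :=
  ⟨AddEquiv.ofBijective (phi T).toAddMonoidHom ⟨phi_injective hT, phi_surjective hT⟩⟩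

lemma Zinv_eq {m : ℕ} (hm : 0 < m) : Zinv m = ZS {p | p.Prime ∧ p ∣ m} := by
  have hm' : (m : ℚ) ≠ 0 := by exact_mod_cast hm.ne'
  apply le_antisymm
  · refine Subring.closure_le.2 ?_
    rintro _ rfl
    refine mem_ZS fun q hq hd => ⟨hq, ?_⟩
    rwa [Rat.inv_natCast_den_of_pos hm] at hd
  · refine Subring.closure_le.2 ?_
    rintro _ ⟨p, ⟨hp, k, rfl⟩, rfl⟩
    have : ((p : ℚ)⁻¹) = k * ((p * k : ℕ) : ℚ)⁻¹ := by
      push_cast at hm' ⊢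
      have := left_ne_zero_of_mul hm'
      have := right_ne_zero_of_mul hm'
      field_simp
    show (p : ℚ)⁻¹ ∈ Zinv _
    rw [this]
    exact mul_mem (natCast_mem _ _) (Subring.subset_closure rfl)

end SL2H

/-- if `T` is a set of primes containing `2` and `3` then
`H₂(SL₂(ℤ_T), ℤ) ≅ ℤ ⊕ (⊕_{p ∈ T} (ℤ/pℤ)^×)`; in particular for `6 ∣ m`, `m > 0`,
`H₂(SL₂(ℤ[1/m]), ℤ) ≅ ℤ ⊕ (⊕_{p ∣ m prime} (ℤ/pℤ)^×)`. -/
theorem stmt15 :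
    (∀ T : Set ℕ, (∀ p ∈ T, Nat.Prime p) → 2 ∈ T → 3 ∈ T →
      Nonempty
        (H2 (Matrix.SpecialLinearGroup (Fin 2) (ZS T)) ≃+
          ℤ × DirectSum ↑T (fun p => Additive (ZMod (p : ℕ))ˣ))) ∧
    (∀ m : ℕ, 0 < m → 6 ∣ m →
      Nonempty
        (H2 (Matrix.SpecialLinearGroup (Fin 2) (Zinv m)) ≃+
          ℤ × DirectSum {p : ℕ // p.Prime ∧ p ∣ m} (fun p => Additive (ZMod (p : ℕ))ˣ))) := by
  refine ⟨fun T hT h2 h3 => SL2H.h2_iso ⟨hT, h2, h3⟩, fun m hm h6 => ?_⟩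
  rw [SL2H.Zinv_eq hm]
  exact SL2H.h2_iso ⟨fun p hp => hp.1, ⟨Nat.prime_two, dvd_trans (by norm_num) h6⟩,
    ⟨Nat.prime_three, dvd_trans (by norm_num) h6⟩⟩
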